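/- arXiv:2102.08017 — 2 statements merged into one kernel-verified Lean document; each statement's English description precedes it below -/
import Mathlib

section
/- Let U be a C²(ℝ^N) stable solution of ΔU + f(U) = 0 in ℝ^N with 0 ≤ U ≤ 1, axisymmetric with respect to the x₁-axis (i.e. U(x) depends only on x₁ and |x'|, x' = (x₂,…,x_N)). Then either U(x₁,x') → 0 as |x'| → +∞ uniformly in x₁ ∈ ℝ, or U(x₁,x') → 1 as |x'| → +∞ uniformly in x₁ ∈ ℝ. -/
open Set Filter Topology MeasureTheory

noncomputable section

/-- `ℝ^N` with `N = d+1`, Euclidean structure. -/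
abbrev Euc (d : ℕ) := EuclideanSpace ℝ (Fin (d + 1))

/-- The Euclidean norm of `x' = (x₂,…,x_N)` for `x = (x₁,x') ∈ ℝ^N`. -/
def primeNorm {d : ℕ} (x : Euc d) : ℝ :=
  Real.sqrt (∑ i, if i = 0 then 0 else (x i) ^ 2)

/-- The funnel-shaped domain `Ω = {x : |x'| < h(x₁)}`. -/
def funnel (d : ℕ) (h : ℝ → ℝ) : Set (Euc d) := {x | primeNorm x < h (x 0)}

/-- The Laplacian of `g` at `x`, computed with derivatives taken within the set `s`. -/
def lapW {d : ℕ} (s : Set (Euc d)) (g : Euc d → ℝ) (x : Euc d) : ℝ :=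
  ∑ i, fderivWithin ℝ (fun y => fderivWithin ℝ g s y (EuclideanSpace.single i 1)) s x
      (EuclideanSpace.single i 1)

/-- The quantity `ν·∇g` at a boundary point `x` of the funnel domain `Ω_{R,α}`, where
`ν(x) = (1+h'(x₁)²)^{-1/2}·(-h'(x₁), x'/|x'|)` is the outward unit normal. -/
def neumannLHS {d : ℕ} (h : ℝ → ℝ) (g : Euc d → ℝ) (x : Euc d) : ℝ :=
  (Real.sqrt (1 + deriv h (x 0) ^ 2))⁻¹ *
    (-(deriv h (x 0)) * fderivWithin ℝ g (closure (funnel d h)) x (EuclideanSpace.single 0 1)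
      + ∑ i, if i = 0 then 0 else
          (x i / primeNorm x) *
            fderivWithin ℝ g (closure (funnel d h)) x (EuclideanSpace.single i 1))

/-- The bistable nonlinearity `f`, of class `C^{1,1}`, with positive mass, extended affinely
outside `[0,1]`. -/
structure Bistable (f : ℝ → ℝ) (θ : ℝ) : Prop where
  smooth : ContDiff ℝ 1 f
  lip_deriv : ∃ C : NNReal, LipschitzWith C (deriv f)
  f0 : f 0 = 0
  f1 : f 1 = 0
  df0 : deriv f 0 < 0
  df1 : deriv f 1 < 0
  θmem : θ ∈ Ioo (0 : ℝ) 1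
  neg : ∀ s ∈ Ioo (0 : ℝ) θ, f s < 0
  pos : ∀ s ∈ Ioo θ (1 : ℝ), 0 < f s
  dθ : 0 < deriv f θ
  mass : 0 < ∫ s in (0 : ℝ)..1, f s
  ext_neg : ∀ s < (0 : ℝ), f s = deriv f 0 * s
  ext_pos : ∀ s > (1 : ℝ), f s = deriv f 1 * (s - 1)

/-- The planar traveling front `φ(x₁ - ct)`: `φ'' + cφ' + f(φ) = 0`, `φ(-∞) = 1`,
`φ(+∞) = 0`, `0 < φ < 1`, `φ` decreasing, normalized by `φ(0) = θ`, with speed `c > 0`. -/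
structure PlanarFront (f : ℝ → ℝ) (θ c : ℝ) (φ : ℝ → ℝ) : Prop where
  cpos : 0 < c
  mem : ∀ z : ℝ, φ z ∈ Ioo (0 : ℝ) 1
  smooth : ContDiff ℝ 2 φ
  anti : StrictAnti φ
  ode : ∀ z : ℝ, deriv (deriv φ) z + c * deriv φ z + f (φ z) = 0
  lim_bot : Tendsto φ atBot (nhds 1)
  lim_top : Tendsto φ atTop (nhds 0)
  pin : φ 0 = θ

/-- `h : ℝ → ℝ` defines a funnel-shaped domain `Ω_{R,α}` (of dimension `N = d+1 ≥ 2`) with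
cylinder radius `R`, opening angle `α` and transition parameter `L`. -/
structure IsFunnel (d : ℕ) (R α L : ℝ) (h : ℝ → ℝ) : Prop where
  dpos : 1 ≤ d
  Rpos : 0 < R
  αmem : α ∈ Ico (0 : ℝ) (Real.pi / 2)
  RL : R < L
  smooth : ContDiff ℝ 2 h
  holder : ∃ β : NNReal, 0 < β ∧ (β : ℝ) < 1 ∧ ∃ C : NNReal, HolderWith C β (deriv (deriv h))
  deriv_nonneg : ∀ x : ℝ, 0 ≤ deriv h x
  deriv_le : ∀ x : ℝ, deriv h x ≤ Real.tan α
  left : ∀ x ≤ (0 : ℝ), h x = R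
  right : ∀ x : ℝ, L * Real.cos α ≤ x → h x = x * Real.tan α

/-- An entire solution of `u_t = Δu + f(u)` in `ℝ × Ω̄` (with values in `[0,1]`),
Neumann boundary condition `ν·∇u = 0` on `ℝ × ∂Ω`, emanating from the planar front
`φ(x₁ - ct)` as `t → -∞`. -/
structure IsEntireSolution (d : ℕ) (h f : ℝ → ℝ) (c : ℝ) (φ : ℝ → ℝ)
    (u : ℝ → Euc d → ℝ) : Prop where
  range01 : ∀ t : ℝ, ∀ x ∈ closure (funnel d h), u t x ∈ Icc (0 : ℝ) 1
  time_diff : ∀ x ∈ closure (funnel d h), Differentiable ℝ fun t => u t x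
  space_reg : ∀ t : ℝ, ContDiffOn ℝ 2 (u t) (closure (funnel d h))
  pde : ∀ t : ℝ, ∀ x ∈ closure (funnel d h),
      deriv (fun s => u s x) t = lapW (closure (funnel d h)) (u t) x + f (u t x)
  neumann : ∀ t : ℝ, ∀ x ∈ frontier (funnel d h), neumannLHS h (u t) x = 0
  past : ∀ ε > (0 : ℝ), ∃ T : ℝ, ∀ t ≤ T, ∀ x ∈ closure (funnel d h),
      |u t x - φ (x 0 - c * t)| ≤ ε

/-- Complete propagation: `u(t,x) → 1` as `t → +∞` locally uniformly in `x ∈ Ω̄`. -/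
def CompletePropagation (d : ℕ) (h : ℝ → ℝ) (u : ℝ → Euc d → ℝ) : Prop :=
  TendstoLocallyUniformlyOn u (fun _ => (1 : ℝ)) atTop (closure (funnel d h))

/-- Blocking: `u(t,·)` converges uniformly on `Ω̄`, as `t → +∞`, to a stationary solution
`u_∞` with `u_∞(x) → 0` as `x₁ → +∞`. -/
def Blocked (d : ℕ) (h f : ℝ → ℝ) (u : ℝ → Euc d → ℝ) : Prop :=
  ∃ uinf : Euc d → ℝ,
    TendstoUniformlyOn u uinf atTop (closure (funnel d h)) ∧
    ContDiffOn ℝ 2 uinf (closure (funnel d h)) ∧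
    (∀ x ∈ closure (funnel d h), lapW (closure (funnel d h)) uinf x + f (uinf x) = 0) ∧
    (∀ x ∈ frontier (funnel d h), neumannLHS h uinf x = 0) ∧
    (∀ ε > (0 : ℝ), ∃ A : ℝ, ∀ x ∈ closure (funnel d h), A ≤ x 0 → |uinf x| ≤ ε)

/-- Stability of a solution `U` of `ΔU + f(U) = 0` on `s̄`:
`∫_s (|∇ψ|² - f'(U)ψ²) ≥ 0` for all compactly supported `C¹` functions `ψ`. -/
def StableOn {d : ℕ} (s : Set (Euc d)) (f : ℝ → ℝ) (U : Euc d → ℝ) : Prop :=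
  ∀ ψ : Euc d → ℝ, ContDiff ℝ 1 ψ → HasCompactSupport ψ →
    0 ≤ ∫ x in s, (‖gradient ψ x‖ ^ 2 - deriv f (U x) * ψ x ^ 2)

/-- The second derivative is nonpositive at a local maximum. -/
lemma second_deriv_nonpos_of_isLocalMax {h h' : ℝ → ℝ} {c : ℝ}
    (h1 : ∀ t, HasDerivAt h (h' t) t) (h2 : HasDerivAt h' c 0) (hm : IsLocalMax h 0) : c ≤ 0 := by
  by_contra! hc
  have hd : deriv h = h' := funext fun t => (h1 t).deriv
  have hmin : IsLocalMin h 0 := by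
    apply isLocalMin_of_deriv_deriv_pos
    · rw [hd, h2.deriv]; exact hc
    · exact hm.deriv_eq_zero
    · exact (h1 0).continuousAt
  have hev : ∀ᶠ t in 𝓝 (0 : ℝ), h t = h 0 := by
    filter_upwards [hm, hmin] with t a b using le_antisymm a b
  have hev2 : h' =ᶠ[𝓝 0] fun _ => 0 := by
    filter_upwards [hev.eventually_nhds] with t ht
    have : HasDerivAt h 0 t := (hasDerivAt_const t (h 0)).congr_of_eventuallyEq ht
    exact (h1 t).unique this
  have := (hasDerivAt_const (0 : ℝ) (0 : ℝ)).congr_of_eventuallyEq hev2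
  exact hc.ne' (h2.unique this)

/-- The standard basis vector of `ℝ^n`. -/
abbrev bv {n : ℕ} (i : Fin n) : EuclideanSpace ℝ (Fin n) := EuclideanSpace.single i 1

lemma HasFDerivAt.hasDerivAt_line {E F : Type*} [NormedAddCommGroup E] [NormedSpace ℝ E]
    [NormedAddCommGroup F] [NormedSpace ℝ F]
    {w : E → F} {G : E → E →L[ℝ] F} (hG : ∀ x, HasFDerivAt w (G x) x) (x e : E) (t : ℝ) :
    HasDerivAt (fun t : ℝ => w (x + t • e)) (G (x + t • e) e) t := by
  have h : HasDerivAt (fun t : ℝ => x + t • e) e t := by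
    simpa using ((hasDerivAt_id t).smul_const e).const_add x
  exact (hG (x + t • e)).comp_hasDerivAt t h

section gradientBound

variable {n : ℕ} {w : EuclideanSpace ℝ (Fin n) → ℝ}
  {G : EuclideanSpace ℝ (Fin n) → EuclideanSpace ℝ (Fin n) →L[ℝ] ℝ}
  {H : EuclideanSpace ℝ (Fin n) →
    EuclideanSpace ℝ (Fin n) →L[ℝ] EuclideanSpace ℝ (Fin n) →L[ℝ] ℝ}

lemma antisymmetrization_le_barrier (hG : ∀ x, HasFDerivAt w (G x) x)
    (hH : ∀ x, HasFDerivAt G (H x) x) {M K K' : ℝ} (hM : ∀ x, |w x| ≤ M)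
    (hK : ∀ x, |∑ i, H x (bv i) (bv i)| ≤ K) (hK' : K < K')
    (x : EuclideanSpace ℝ (Fin n)) (i : Fin n) (y : EuclideanSpace ℝ (Fin n))
    (hy : ‖y‖ ≤ 1) (hyi : 0 ≤ y i) :
    (w (x + y) - w (x + (y - (2 * y i) • bv i))) / 2 ≤
      M * (‖y‖ ^ 2 + n * y i - n * (y i) ^ 2) + K' / 2 * (y i - (y i) ^ 2) := by
  set g : EuclideanSpace ℝ (Fin n) → ℝ := fun y =>
    (w (x + y) - w (x + (y - (2 * y i) • bv i))) / 2 -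
      (M * (‖y‖ ^ 2 + n * y i - n * (y i) ^ 2) + K' / 2 * (y i - (y i) ^ 2)) with hg
  have hwc : Continuous w := continuous_iff_continuousAt.2 fun x => (hG x).continuousAt
  have hgc : Continuous g := by
    simp only [hg]; fun_prop
  set Q : Set (EuclideanSpace ℝ (Fin n)) := Metric.closedBall 0 1 ∩ {y | 0 ≤ y i} with hQ
  have hQc : IsCompact Q := (isCompact_closedBall _ _).inter_right
    (isClosed_le continuous_const (by fun_prop))
  have hM0 : 0 ≤ M := (abs_nonneg _).trans (hM x)
  have hK0 : 0 ≤ K := (abs_nonneg _).trans (hK x)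
  have hn1 : (1 : ℝ) ≤ n := by
    have : 0 < n := i.pos
    exact_mod_cast this
  obtain ⟨z, hzQ, hz⟩ := hQc.exists_isMaxOn ⟨0, by simp [hQ]⟩ hgc.continuousOn
  have hcoord : ∀ y : EuclideanSpace ℝ (Fin n), |y i| ≤ ‖y‖ := fun y => PiLp.norm_apply_le y i
  suffices hgz : g z ≤ 0 by
    have := hz (show y ∈ Q by simp [hQ, hy, hyi])
    simp only [mem_ofPred_eq] at this
    have h2 : g y ≤ 0 := this.trans hgz
    simp only [hg] at h2
    linarith
  obtain ⟨hz1, hzi⟩ := hzQ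
  simp only [Metric.mem_closedBall, dist_zero_right, mem_ofPred_eq] at hz1 hzi
  have hzi1 : z i ≤ 1 := (le_abs_self _).trans ((hcoord z).trans hz1)
  have hpoly : 0 ≤ z i - z i ^ 2 := by nlinarith
  have hφM : (w (x + z) - w (x + (z - (2 * z i) • bv i))) / 2 ≤ M := by
    have h1 := abs_le.1 (hM (x + z))
    have h2 := abs_le.1 (hM (x + (z - (2 * z i) • bv i)))
    linarith [h1.2, h2.1]
  rcases hz1.eq_or_lt with hz1 | hz1
  · simp only [hg]
    rw [hz1]
    have : 0 ≤ M * (n * (z i - z i ^ 2)) := by positivity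
    have : 0 ≤ K' / 2 * (z i - z i ^ 2) := mul_nonneg (by linarith) hpoly
    nlinarith
  rcases hzi.eq_or_lt with hzi | hzi
  · simp only [hg, ← hzi]
    have : 0 ≤ M * ‖z‖ ^ 2 := by positivity
    simp
    linarith
  -- interior maximum: contradiction
  exfalso
  have hloc : IsLocalMax g z := by
    have : Q ∈ 𝓝 z := by
      apply Filter.inter_mem
      · exact mem_of_superset (Metric.isOpen_ball.mem_nhds (by simpa using hz1))
          Metric.ball_subset_closedBall
      · exact mem_of_superset ((isOpen_lt (f := fun _ => (0 : ℝ))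
          (g := fun y : EuclideanSpace ℝ (Fin n) => y i) continuous_const (by fun_prop)).mem_nhds hzi)
          (fun y (hy : 0 < y i) => hy.le)
    exact hz.isLocalMax this
  set σz := z - (2 * z i) • bv i with hσ
  have key : ∀ j, (H (x + z) (bv j) (bv j) - H (x + σz) (bv j) (bv j)) / 2 ≤
      2 * M - (if j = i then 2 * n * M + K' else 0) := by
    intro j
    have hl : IsLocalMax (fun t : ℝ => g (z + t • bv j)) 0 := by
      have hc : ContinuousAt (fun t : ℝ => z + t • bv j) 0 := by fun_prop
      have := hc.tendsto
      simp only [zero_smul, add_zero] at this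
      have h2 := this.eventually hloc
      simpa [IsLocalMax, IsMaxFilter] using h2
    set s : ℝ := if j = i then -1 else 1 with hs
    have hss : s * s = 1 := by simp only [hs]; split_ifs <;> norm_num
    set b : ℝ := if j = i then 1 else 0 with hb
    have hsb : s = 1 - 2 * b := by simp only [hs, hb]; split_ifs <;> norm_num
    have hcoordt : ∀ t : ℝ, (z + t • bv j) i = z i + t * b := by
      intro t
      simp only [PiLp.add_apply, PiLp.smul_apply, smul_eq_mul, bv, hb]
      by_cases hji : j = i
      · subst hji; simp
      · simp [hji, Ne.symm hji]
    have hgt : (fun t : ℝ => g (z + t • bv j)) = fun t : ℝ =>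
        (w ((x + z) + t • bv j) - w ((x + σz) + t • (s • bv j))) / 2 -
        (M * ((‖z‖ ^ 2 + 2 * t * z j + t ^ 2) + n * (z i + t * b) - n * (z i + t * b) ^ 2)
          + K' / 2 * ((z i + t * b) - (z i + t * b) ^ 2)) := by
      funext t
      simp only [hg, hcoordt]
      have e1 : x + (z + t • bv j) = (x + z) + t • bv j := by abel
      have e2 : x + (z + t • bv j - (2 * (z i + t * b)) • bv i) = (x + σz) + t • (s • bv j) := by
        have : (2 * (t * b)) • bv i = (2 * (t * b)) • (bv j : EuclideanSpace ℝ (Fin n)) := by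
          by_cases hji : j = i
          · rw [hji]
          · simp [hb, hji]
        rw [mul_add, add_smul, this, hsb, hσ]
        module
      have e3 : ‖z + t • (bv j : EuclideanSpace ℝ (Fin n))‖ ^ 2 = ‖z‖ ^ 2 + 2 * t * z j + t ^ 2 := by
        rw [norm_add_sq_real, inner_smul_right, norm_smul]
        simp [bv, EuclideanSpace.inner_single_right]
        ring
      rw [e1, e2, e3]
    rw [hgt] at hl
    have d1 : ∀ t : ℝ, HasDerivAt (fun t : ℝ =>
        (w ((x + z) + t • bv j) - w ((x + σz) + t • (s • bv j))) / 2 -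
        (M * ((‖z‖ ^ 2 + 2 * t * z j + t ^ 2) + n * (z i + t * b) - n * (z i + t * b) ^ 2)
          + K' / 2 * ((z i + t * b) - (z i + t * b) ^ 2)))
        ((G ((x + z) + t • bv j) (bv j) - G ((x + σz) + t • (s • bv j)) (s • bv j)) / 2 -
        (M * ((2 * z j + 2 * t) + n * b - n * (2 * (z i + t * b) * b))
          + K' / 2 * (b - 2 * (z i + t * b) * b))) t := by
      intro t
      have a1 := HasFDerivAt.hasDerivAt_line hG (x + z) (bv j) t
      have a2 := HasFDerivAt.hasDerivAt_line hG (x + σz) (s • bv j) t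
      have c1 : HasDerivAt (fun t : ℝ => z i + t * b) b t := by
        simpa using ((hasDerivAt_id t).mul_const b).const_add (z i)
      have c2 : HasDerivAt (fun t : ℝ => (z i + t * b) ^ 2) (2 * (z i + t * b) * b) t := by
        exact (c1.pow 2).congr_deriv (by simp)
      have c3 : HasDerivAt (fun t : ℝ => ‖z‖ ^ 2 + 2 * t * z j + t ^ 2) (2 * z j + 2 * t) t := by
        have p1 : HasDerivAt (fun t : ℝ => 2 * t * z j) (2 * z j) t := by
          simpa using ((hasDerivAt_id t).const_mul 2).mul_const (z j)
        have p2 : HasDerivAt (fun t : ℝ => t ^ 2) (2 * t) t := by simpa using hasDerivAt_pow 2 t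
        exact (p1.const_add _).add p2
      exact ((a1.sub a2).div_const 2).sub
        ((((c3.add (c1.const_mul (n : ℝ))).sub (c2.const_mul (n : ℝ))).const_mul M).add
          ((c1.sub c2).const_mul (K' / 2)))
    have d2 : HasDerivAt (fun t : ℝ =>
        ((G ((x + z) + t • bv j) (bv j) - G ((x + σz) + t • (s • bv j)) (s • bv j)) / 2 -
        (M * ((2 * z j + 2 * t) + n * b - n * (2 * (z i + t * b) * b))
          + K' / 2 * (b - 2 * (z i + t * b) * b))))
        ((H (x + z) (bv j) (bv j) - H (x + σz) (s • bv j) (s • bv j)) / 2 -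
        (M * (2 - n * (2 * b * b)) + K' / 2 * (- (2 * b * b)))) 0 := by
      have a1 := (HasFDerivAt.hasDerivAt_line hH (x + z) (bv j) 0).clm_apply
        (hasDerivAt_const (0 : ℝ) (bv j))
      have a2 := (HasFDerivAt.hasDerivAt_line hH (x + σz) (s • bv j) 0).clm_apply
        (hasDerivAt_const (0 : ℝ) (s • bv j))
      have c1 : HasDerivAt (fun t : ℝ => 2 * (z i + t * b) * b) (2 * b * b) 0 := by
        simpa using ((((hasDerivAt_id (0 : ℝ)).mul_const b).const_add (z i)).const_mul 2).mul_const b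
      have c3 : HasDerivAt (fun t : ℝ => (2 * z j + 2 * t) + n * b) 2 0 := by
        simpa using (((hasDerivAt_id (0 : ℝ)).const_mul 2).const_add (2 * z j)).add_const (n * b)
      have := ((a1.sub a2).div_const 2).sub
        (((c3.sub (c1.const_mul (n : ℝ))).const_mul M).add ((c1.const_sub b).const_mul (K' / 2)))
      refine this.congr_deriv ?_
      simp
    have := second_deriv_nonpos_of_isLocalMax d1 d2 hl
    simp only [map_smul, _root_.smul_apply, smul_eq_mul] at this
    rw [← mul_assoc, hss, one_mul] at this
    by_cases hji : j = i
    · simp only [hb, hji, if_true] at this ⊢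
      linarith
    · simp only [hb, hji, if_false] at this ⊢
      linarith
  have hsum := Finset.sum_le_sum fun j (_ : j ∈ Finset.univ) => key j
  rw [← Finset.sum_div, Finset.sum_sub_distrib, Finset.sum_sub_distrib] at hsum
  simp only [Finset.sum_const, Finset.card_univ, Fintype.card_fin, nsmul_eq_mul,
    Finset.sum_ite_eq', Finset.mem_univ, if_true] at hsum
  have h1 := abs_le.1 (hK (x + z))
  have h2 := abs_le.1 (hK (x + σz))
  linarith [h1.1, h2.2]

/-- Interior gradient bound for functions with bounded Laplacian. -/
lemma partial_le_of_laplacian_bounded (hG : ∀ x, HasFDerivAt w (G x) x)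
    (hH : ∀ x, HasFDerivAt G (H x) x) {M K : ℝ} (hM : ∀ x, |w x| ≤ M)
    (hK : ∀ x, |∑ i, H x (bv i) (bv i)| ≤ K) (x : EuclideanSpace ℝ (Fin n)) (i : Fin n) :
    G x (bv i) ≤ n * M + K := by
  have hK0 : 0 ≤ K := (abs_nonneg _).trans (hK x)
  refine le_of_forall_gt_imp_ge_of_dense fun a ha => ?_
  set K' := a - n * M with hK'
  have hlt : K < K' := by linarith
  have hle : ∀ t : ℝ, 0 < t → t ≤ 1 → (w (x + t • bv i) - w (x + t • (- bv i))) / 2 ≤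
      M * (t ^ 2 + n * t - n * t ^ 2) + K' / 2 * (t - t ^ 2) := by
    intro t ht0 ht1
    have := antisymmetrization_le_barrier hG hH hM hK hlt x i (t • bv i)
      (by rw [norm_smul]; simp [abs_of_pos ht0, ht1]) (by simp [ht0.le])
    have e : t • bv i - (2 * (t • (bv i : EuclideanSpace ℝ (Fin n))) i) • bv i = t • (- bv i) := by
      simp only [PiLp.smul_apply, bv, PiLp.single_apply, if_true, smul_eq_mul, mul_one]
      module
    rw [e, norm_smul] at this
    simpa [abs_of_pos ht0] using this
  set p : ℝ → ℝ := fun t => M * (t ^ 2 + n * t - n * t ^ 2) + K' / 2 * (t - t ^ 2) -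
    (w (x + t • bv i) - w (x + t • (- bv i))) / 2 with hp
  have hpd : HasDerivAt p (M * n + K' / 2 - G x (bv i)) 0 := by
    have a1 := HasFDerivAt.hasDerivAt_line hG x (bv i) 0
    have a2 := HasFDerivAt.hasDerivAt_line hG x (- bv i) 0
    have s : HasDerivAt (fun t : ℝ => t ^ 2) 0 0 := by simpa using hasDerivAt_pow 2 (0 : ℝ)
    have id' : HasDerivAt (fun t : ℝ => t) 1 0 := hasDerivAt_id 0
    have := ((((s.add (id'.const_mul (n : ℝ))).sub (s.const_mul (n : ℝ))).const_mul M).add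
      ((id'.sub s).const_mul (K' / 2))).sub ((a1.sub a2).div_const 2)
    refine this.congr_deriv ?_
    simp only [zero_smul, add_zero, map_neg]
    ring
  have hp0 : p 0 = 0 := by simp [hp]
  have hnn : 0 ≤ M * n + K' / 2 - G x (bv i) := by
    have ht := hpd.tendsto_slope_zero_right
    refine ge_of_tendsto ht ?_
    filter_upwards [Ioc_mem_nhdsGT (show (0 : ℝ) < 1 by norm_num)] with t ht
    have := hle t ht.1 ht.2
    simp only [zero_add, hp0, sub_zero, smul_eq_mul]
    refine mul_nonneg (inv_nonneg.2 ht.1.le) ?_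
    simp only [hp]; linarith
  linarith

lemma norm_le_of_apply_basis_le {F : Type*} [NormedAddCommGroup F] [NormedSpace ℝ F]
    (A : EuclideanSpace ℝ (Fin n) →L[ℝ] F) {B : ℝ}
    (hB0 : 0 ≤ B) (h : ∀ i, ‖A (bv i)‖ ≤ B) : ‖A‖ ≤ n * B := by
  refine A.opNorm_le_bound (by positivity) fun x => ?_
  have hx : x = ∑ i, x i • bv i := by
    simpa [EuclideanSpace.basisFun_apply] using ((EuclideanSpace.basisFun (Fin n) ℝ).sum_repr x).symm
  calc ‖A x‖ = ‖∑ i, x i • A (bv i)‖ := by conv_lhs => rw [hx]; simp only [map_sum, map_smul]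
    _ ≤ ∑ i, ‖x i • A (bv i)‖ := norm_sum_le _ _
    _ ≤ ∑ _i : Fin n, ‖x‖ * B := by
        refine Finset.sum_le_sum fun i _ => ?_
        rw [norm_smul]
        exact mul_le_mul (PiLp.norm_apply_le x i) (h i) (norm_nonneg _) (norm_nonneg _)
    _ = n * B * ‖x‖ := by simp; ring

lemma norm_fderiv_le_of_laplacian_bounded (hG : ∀ x, HasFDerivAt w (G x) x)
    (hH : ∀ x, HasFDerivAt G (H x) x) {M K : ℝ} (hM : ∀ x, |w x| ≤ M)
    (hK : ∀ x, |∑ i, H x (bv i) (bv i)| ≤ K) (x : EuclideanSpace ℝ (Fin n)) :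
    ‖G x‖ ≤ n * (n * M + K) := by
  have hK0 : 0 ≤ K := (abs_nonneg _).trans (hK x)
  have hM0 : 0 ≤ M := (abs_nonneg _).trans (hM x)
  refine norm_le_of_apply_basis_le _ (by positivity) fun i => abs_le.2 ⟨?_, ?_⟩
  · have := partial_le_of_laplacian_bounded (w := fun x => - w x) (G := fun x => - G x)
      (H := fun x => - H x) (fun x => (hG x).neg) (fun x => (hH x).neg) (M := M) (K := K)
      (by simpa using hM) (by simpa [abs_neg] using hK) x i
    simp at this
    linarith
  · exact partial_le_of_laplacian_bounded hG hH hM hK x i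

end gradientBound

lemma norm_sub_le_of_fderiv_bounded {E F : Type*} [NormedAddCommGroup E] [NormedSpace ℝ E]
    [NormedAddCommGroup F] [NormedSpace ℝ F] {w : E → F} {G : E → E →L[ℝ] F}
    (hG : ∀ x, HasFDerivAt w (G x) x) {C : ℝ} (hC : ∀ x, ‖G x‖ ≤ C) (x y : E) :
    ‖w y - w x‖ ≤ C * ‖y - x‖ :=
  convex_univ.norm_image_sub_le_of_norm_hasFDerivWithin_le
    (fun x _ => (hG x).hasFDerivWithinAt) (fun x _ => hC x) (mem_univ x) (mem_univ y)

lemma norm_fderiv_le_of_norm_sub_le {E F : Type*} [NormedAddCommGroup E] [NormedSpace ℝ E]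
    [NormedAddCommGroup F] [NormedSpace ℝ F] {w : E → F} {x : E} {A : E →L[ℝ] F}
    (hA : HasFDerivAt w A x) {C : ℝ} (hC0 : 0 ≤ C) (hC : ∀ y, ‖w y - w x‖ ≤ C * ‖y - x‖) :
    ‖A‖ ≤ C :=
  hA.le_of_lip' hC0 (Eventually.of_forall hC)

lemma HasFDerivAt.comp_translate {E F : Type*} [NormedAddCommGroup E] [NormedSpace ℝ E]
    [NormedAddCommGroup F] [NormedSpace ℝ F] {w : E → F} {A : E →L[ℝ] F} {x h : E}
    (hA : HasFDerivAt w A (x + h)) : HasFDerivAt (fun y => w (y + h)) A x :=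
  (hasFDerivAt_comp_add_right h).2 hA

lemma Bistable.exists_bounds {f : ℝ → ℝ} {θ : ℝ} (hf : Bistable f θ) :
    ∃ K : ℝ, 0 ≤ K ∧ (∀ s ∈ Icc (0 : ℝ) 1, |f s| ≤ K) ∧ (∀ s ∈ Icc (0 : ℝ) 1, |deriv f s| ≤ K) ∧
      (∀ s ∈ Icc (0 : ℝ) 1, ∀ t ∈ Icc (0 : ℝ) 1, |f s - f t| ≤ K * |s - t|) ∧
      (∀ s t, |deriv f s - deriv f t| ≤ K * |s - t|) := by
  have hd : Continuous (deriv f) := hf.smooth.continuous_deriv le_rfl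
  obtain ⟨K1, h1⟩ := (isCompact_Icc (a := (0 : ℝ)) (b := 1)).exists_bound_of_continuousOn
    hf.smooth.continuous.continuousOn
  obtain ⟨K2, h2⟩ := (isCompact_Icc (a := (0 : ℝ)) (b := 1)).exists_bound_of_continuousOn
    hd.continuousOn
  obtain ⟨K3, h3⟩ := hf.lip_deriv
  refine ⟨max (max K1 K2) K3, ?_, ?_, ?_, ?_, ?_⟩
  · exact le_max_of_le_right K3.2
  · exact fun s hs => (h1 s hs).trans ((le_max_left _ _).trans (le_max_left _ _))
  · exact fun s hs => (h2 s hs).trans ((le_max_right _ _).trans (le_max_left _ _))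
  · intro s hs t ht
    have := (convex_Icc (0 : ℝ) 1).norm_image_sub_le_of_norm_deriv_le
      (fun x _ => (hf.smooth.differentiable one_ne_zero).differentiableAt) h2 ht hs
    refine this.trans ?_
    exact mul_le_mul_of_nonneg_right ((le_max_right _ _).trans (le_max_left _ _)) (norm_nonneg _)
  · intro s t
    have := h3.dist_le_mul s t
    rw [Real.dist_eq, Real.dist_eq] at this
    exact this.trans (mul_le_mul_of_nonneg_right (le_max_right _ _) (abs_nonneg _))

/-- A stable solution `u` of `Δu + f(u) = 0` in `ℝ^n` with values in `[0,1]`, whose first and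
second derivatives `G`, `H` are bounded by `C`, with `H` Lipschitz. -/
structure StableSol (n : ℕ) (f : ℝ → ℝ) (C : ℝ) (u : EuclideanSpace ℝ (Fin n) → ℝ)
    (G : EuclideanSpace ℝ (Fin n) → EuclideanSpace ℝ (Fin n) →L[ℝ] ℝ)
    (H : EuclideanSpace ℝ (Fin n) →
      EuclideanSpace ℝ (Fin n) →L[ℝ] EuclideanSpace ℝ (Fin n) →L[ℝ] ℝ) : Prop where
  range : ∀ x, u x ∈ Icc (0 : ℝ) 1
  hG : ∀ x, HasFDerivAt u (G x) x
  hH : ∀ x, HasFDerivAt G (H x) x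
  bG : ∀ x, ‖G x‖ ≤ C
  bH : ∀ x, ‖H x‖ ≤ C
  lipH : ∀ x y, ‖H y - H x‖ ≤ C * ‖y - x‖
  pde : ∀ x, ∑ i, H x (bv i) (bv i) + f (u x) = 0
  stable : ∀ ψ : EuclideanSpace ℝ (Fin n) → ℝ, ContDiff ℝ 1 ψ → HasCompactSupport ψ →
    0 ≤ ∫ x, (∑ i, (fderiv ℝ ψ x (bv i)) ^ 2 - deriv f (u x) * ψ x ^ 2)

lemma derivatives_bounded {f : ℝ → ℝ} {θ : ℝ} (hf : Bistable f θ) {n : ℕ}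
    {u : EuclideanSpace ℝ (Fin n) → ℝ}
    {G : EuclideanSpace ℝ (Fin n) → EuclideanSpace ℝ (Fin n) →L[ℝ] ℝ}
    {H : EuclideanSpace ℝ (Fin n) →
      EuclideanSpace ℝ (Fin n) →L[ℝ] EuclideanSpace ℝ (Fin n) →L[ℝ] ℝ}
    (range : ∀ x, u x ∈ Icc (0 : ℝ) 1)
    (hG : ∀ x, HasFDerivAt u (G x) x) (hH : ∀ x, HasFDerivAt G (H x) x)
    (pde : ∀ x, ∑ i, H x (bv i) (bv i) + f (u x) = 0) :
    ∃ C : ℝ, (∀ x, ‖G x‖ ≤ C) ∧ (∀ x, ‖H x‖ ≤ C) ∧ ∀ x y, ‖H y - H x‖ ≤ C * ‖y - x‖ := by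
  obtain ⟨K, hK0, hK1, hK2, hK3, hK4⟩ := hf.exists_bounds
  have hlap : ∀ x, ∑ i, H x (bv i) (bv i) = - f (u x) := fun x => by linarith [pde x]
  have hGs : ∀ h x, HasFDerivAt (fun y => u (y + h)) (G (x + h)) x := fun h x =>
    (hG (x + h)).comp_translate
  have hHs : ∀ h x, HasFDerivAt (fun y => G (y + h)) (H (x + h)) x := fun h x =>
    (hH (x + h)).comp_translate
  -- first derivatives
  set C0 : ℝ := n * (n * 1 + K) with hC0
  have h0 : 0 ≤ C0 := by positivity
  have b0 : ∀ x, ‖G x‖ ≤ C0 := norm_fderiv_le_of_laplacian_bounded hG hH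
    (fun x => abs_le.2 ⟨by linarith [(range x).1], (range x).2⟩)
    (fun x => by rw [hlap, abs_neg]; exact hK1 _ (range x))
  have l0 := norm_sub_le_of_fderiv_bounded hG b0
  -- second derivatives
  set C1 : ℝ := n * (n * C0 + K * C0) with hC1
  have h1 : 0 ≤ C1 := by positivity
  have b1 : ∀ h x, ‖G (x + h) - G x‖ ≤ C1 * ‖h‖ := by
    intro h x
    have := norm_fderiv_le_of_laplacian_bounded (fun x => (hGs h x).sub (hG x))
      (fun x => (hHs h x).sub (hH x)) (M := C0 * ‖h‖) (K := K * (C0 * ‖h‖))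
      (fun x => by simpa using l0 x (x + h))
      (fun x => by
        simp only [sub_apply, Finset.sum_sub_distrib, hlap]
        rw [show -f (u (x + h)) - -f (u x) = -(f (u (x + h)) - f (u x)) by ring, abs_neg]
        refine (hK3 _ (range _) _ (range _)).trans (mul_le_mul_of_nonneg_left ?_ hK0)
        simpa using l0 x (x + h)) x
    refine this.trans (le_of_eq ?_)
    rw [hC1]; ring
  have l1 : ∀ x y, ‖G y - G x‖ ≤ C1 * ‖y - x‖ := fun x y => by
    simpa using b1 (y - x) x
  have bH : ∀ x, ‖H x‖ ≤ C1 := fun x => norm_fderiv_le_of_norm_sub_le (hH x) h1 (l1 x)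
  -- Lipschitz bound for the second derivatives
  have hfG : ∀ x, HasFDerivAt (fun y => f (u y)) (deriv f (u x) • G x) x := fun x =>
    ((hf.smooth.differentiable one_ne_zero).differentiableAt.hasDerivAt).comp_hasFDerivAt x (hG x)
  set C2 : ℝ := K * C0 * C0 + K * C1 with hC2
  have h2 : 0 ≤ C2 := by positivity
  have l2 : ∀ h x, ‖deriv f (u (x + h)) • G (x + h) - deriv f (u x) • G x‖ ≤ C2 * ‖h‖ := by
    intro h x
    have e : deriv f (u (x + h)) • G (x + h) - deriv f (u x) • G x =
      (deriv f (u (x + h)) - deriv f (u x)) • G (x + h) + deriv f (u x) • (G (x + h) - G x) := by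
      module
    rw [e]
    refine (norm_add_le _ _).trans ?_
    rw [norm_smul, norm_smul]
    have a1 : ‖deriv f (u (x + h)) - deriv f (u x)‖ ≤ K * (C0 * ‖h‖) :=
      (hK4 _ _).trans (mul_le_mul_of_nonneg_left (by simpa using l0 x (x + h)) hK0)
    have a2 := mul_le_mul a1 (b0 (x + h)) (norm_nonneg _) (by positivity)
    have a3 := mul_le_mul (hK2 _ (range x)) (b1 h x) (norm_nonneg _) hK0
    calc _ ≤ K * (C0 * ‖h‖) * C0 + K * (C1 * ‖h‖) := add_le_add a2 a3
      _ = C2 * ‖h‖ := by rw [hC2]; ring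
  set C3 : ℝ := n * (n * C1 + C2) with hC3
  have b3 : ∀ h k x, ‖(G (x + k + h) - G (x + k)) - (G (x + h) - G x)‖ ≤ C3 * ‖h‖ * ‖k‖ := by
    intro h k x
    have hv : ∀ x, HasFDerivAt (fun y => u (y + h) - u y) (G (x + h) - G x) x :=
      fun x => (hGs h x).sub (hG x)
    have hv' : ∀ x, HasFDerivAt (fun y => G (y + h) - G y) (H (x + h) - H x) x :=
      fun x => (hHs h x).sub (hH x)
    have hg : ∀ x, HasFDerivAt (fun y => f (u (y + h)) - f (u y))
        (deriv f (u (x + h)) • G (x + h) - deriv f (u x) • G x) x :=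
      fun x => ((hfG (x + h)).comp_translate).sub (hfG x)
    have := norm_fderiv_le_of_laplacian_bounded
      (w := fun y => (u (y + k + h) - u (y + k)) - (u (y + h) - u y))
      (fun x => ((hv (x + k)).comp_translate).sub (hv x))
      (fun x => ((hv' (x + k)).comp_translate).sub (hv' x))
      (M := C1 * ‖h‖ * ‖k‖) (K := C2 * ‖h‖ * ‖k‖)
      (fun x => by simpa using norm_sub_le_of_fderiv_bounded hv (b1 h) x (x + k))
      (fun x => by
        simp only [sub_apply, Finset.sum_sub_distrib, hlap]
        have := norm_sub_le_of_fderiv_bounded hg (l2 h) x (x + k)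
        rw [Real.norm_eq_abs, ← abs_neg] at this
        convert this using 2
        · ring
        · simp) x
    refine this.trans (le_of_eq ?_)
    rw [hC3]; ring
  have l3 : ∀ x y, ‖H y - H x‖ ≤ C3 * ‖y - x‖ := by
    intro x y
    have hv' : HasFDerivAt (fun z => G (z + (y - x)) - G z) (H (x + (y - x)) - H x) x :=
      (hHs (y - x) x).sub (hH x)
    have := norm_fderiv_le_of_norm_sub_le hv' (C := C3 * ‖y - x‖) (by positivity) fun z => by
      simpa using b3 (y - x) (z - x) x
    simpa using this
  refine ⟨max (max C0 C1) C3, fun x => (b0 x).trans ((le_max_left _ _).trans (le_max_left _ _)),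
    fun x => (bH x).trans ((le_max_right _ _).trans (le_max_left _ _)), fun x y => (l3 x y).trans ?_⟩
  exact mul_le_mul_of_nonneg_right (le_max_right _ _) (norm_nonneg _)

lemma StableSol.of_contDiff {d : ℕ} {f : ℝ → ℝ} {θ : ℝ} (hf : Bistable f θ)
    {U : Euc d → ℝ} (hU : ContDiff ℝ 2 U)
    (hrange : ∀ x : Euc d, U x ∈ Icc (0 : ℝ) 1)
    (hpde : ∀ x : Euc d, lapW Set.univ U x + f (U x) = 0)
    (hstable : StableOn Set.univ f U) :
    ∃ C, StableSol (d + 1) f C U (fderiv ℝ U) (fderiv ℝ (fderiv ℝ U)) := by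
  have hG : ∀ x, HasFDerivAt U (fderiv ℝ U x) x := fun x =>
    (hU.differentiable two_ne_zero x).hasFDerivAt
  have hd : Differentiable ℝ (fderiv ℝ U) :=
    (hU.fderiv_right (m := 1) (by norm_num)).differentiable one_ne_zero
  have hH : ∀ x, HasFDerivAt (fderiv ℝ U) (fderiv ℝ (fderiv ℝ U) x) x := fun x =>
    (hd x).hasFDerivAt
  have pde : ∀ x, ∑ i, fderiv ℝ (fderiv ℝ U) x (bv i) (bv i) + f (U x) = 0 := by
    intro x
    rw [← hpde x]
    congr 1
    simp only [lapW, fderivWithin_univ]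
    refine Finset.sum_congr rfl fun i _ => ?_
    have := (hH x).clm_apply (hasFDerivAt_const (bv i) x)
    rw [this.fderiv]
    simp
  obtain ⟨C, c1, c2, c3⟩ := derivatives_bounded hf hrange hG hH pde
  refine ⟨C, hrange, hG, hH, c1, c2, c3, pde, fun ψ hψ hs => ?_⟩
  have := hstable ψ hψ hs
  rw [Measure.restrict_univ] at this
  convert this using 5 with x
  rw [EuclideanSpace.norm_sq_eq]
  refine Finset.sum_congr rfl fun i _ => ?_
  have : fderiv ℝ ψ x (bv i) = (gradient ψ x) i := by
    have h1 := (hψ.differentiable one_ne_zero x).hasGradientAt.hasFDerivAt.fderiv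
    rw [h1, InnerProductSpace.toDual_apply_apply, EuclideanSpace.inner_single_right]
    simp
  rw [this, Real.norm_eq_abs, sq_abs]

lemma norm_taylor_remainder_le {E F : Type*} [NormedAddCommGroup E] [NormedSpace ℝ E]
    [NormedAddCommGroup F] [NormedSpace ℝ F] {w : E → F} {G : E → E →L[ℝ] F}
    (hG : ∀ x, HasFDerivAt w (G x) x) {C : ℝ} (hC0 : 0 ≤ C) {x : E}
    (hC : ∀ y, ‖G y - G x‖ ≤ C * ‖y - x‖) (y : E) :
    ‖w y - w x - G x (y - x)‖ ≤ C * ‖y - x‖ * ‖y - x‖ := by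
  refine (convex_closedBall x ‖y - x‖).norm_image_sub_le_of_norm_hasFDerivWithin_le'
    (fun z _ => (hG z).hasFDerivWithinAt) (fun z hz => ?_) (by simp) (by simp [dist_eq_norm])
  refine (hC z).trans (mul_le_mul_of_nonneg_left ?_ hC0)
  simpa [dist_eq_norm] using hz

lemma hasFDerivAt_of_taylor_remainder_le {E F : Type*} [NormedAddCommGroup E] [NormedSpace ℝ E]
    [NormedAddCommGroup F] [NormedSpace ℝ F] {w : E → F} {A : E →L[ℝ] F} {C : ℝ} {x : E}
    (h : ∀ y, ‖w y - w x - A (y - x)‖ ≤ C * ‖y - x‖ * ‖y - x‖) : HasFDerivAt w A x := by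
  rw [hasFDerivAt_iff_isLittleO]
  have h1 : (fun y => w y - w x - A (y - x)) =O[𝓝 x] fun y => ‖y - x‖ * ‖y - x‖ :=
    Asymptotics.IsBigO.of_bound C (Eventually.of_forall fun y => by
      simpa [mul_assoc] using h y)
  refine h1.trans_isLittleO ?_
  have h2 : (fun y => ‖y - x‖) =o[𝓝 x] fun _ => (1 : ℝ) := by
    rw [Asymptotics.isLittleO_one_iff]
    have : Continuous fun y => ‖y - x‖ := by fun_prop
    simpa using this.tendsto x
  simpa using (h2.mul_isBigO (Asymptotics.isBigO_refl (fun y => ‖y - x‖) (𝓝 x))).trans_isBigO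
    ((Asymptotics.isBigO_refl (fun y => y - x) (𝓝 x)).norm_left.congr_left (by simp))

lemma exists_tendsto_ultrafilter {F : Type*} [NormedAddCommGroup F] [ProperSpace F]
    (𝓕 : Ultrafilter ℕ) {a : ℕ → F} {C : ℝ} (ha : ∀ k, ‖a k‖ ≤ C) :
    ∃ y, Tendsto a 𝓕 (𝓝 y) := by
  obtain ⟨y, -, hy⟩ := (isCompact_closedBall (0 : F) C).ultrafilter_le_nhds (𝓕.map a)
    (by
      rw [Ultrafilter.coe_map, le_principal_iff, mem_map]
      exact Filter.univ_mem' fun k => by simpa using ha k)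
  exact ⟨y, hy⟩

lemma hasFDerivAt_of_tendsto {E F : Type*} [NormedAddCommGroup E] [NormedSpace ℝ E]
    [NormedAddCommGroup F] [NormedSpace ℝ F] {l : Filter ℕ} [l.NeBot]
    {w : ℕ → E → F} {G : ℕ → E → E →L[ℝ] F}
    (hG : ∀ k x, HasFDerivAt (w k) (G k x) x) {C : ℝ} (hC0 : 0 ≤ C)
    (hC : ∀ k x y, ‖G k y - G k x‖ ≤ C * ‖y - x‖)
    {w' : E → F} {G' : E → E →L[ℝ] F} (hw : ∀ x, Tendsto (fun k => w k x) l (𝓝 (w' x)))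
    (hG' : ∀ x, Tendsto (fun k => G k x) l (𝓝 (G' x))) (x : E) : HasFDerivAt w' (G' x) x := by
  refine hasFDerivAt_of_taylor_remainder_le (C := C) fun y => ?_
  have ht : Tendsto (fun k => ‖w k y - w k x - G k x (y - x)‖) l
      (𝓝 ‖w' y - w' x - G' x (y - x)‖) :=
    (((hw y).sub (hw x)).sub
      (((ContinuousLinearMap.apply ℝ F (y - x)).continuous.tendsto _).comp (hG' x))).norm
  exact le_of_tendsto ht (Eventually.of_forall fun k =>
    norm_taylor_remainder_le (hG k) hC0 (hC k x) y)

lemma eventually_abs_sub_le_of_compact {E : Type*} [NormedAddCommGroup E]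
    {l : Filter ℕ} {w : ℕ → E → ℝ} {w' : E → ℝ} {C : ℝ} (hC0 : 0 ≤ C)
    (hC : ∀ k x y, |w k y - w k x| ≤ C * ‖y - x‖) (hC' : ∀ x y, |w' y - w' x| ≤ C * ‖y - x‖)
    (hw : ∀ x, Tendsto (fun k => w k x) l (𝓝 (w' x))) {S : Set E} (hS : IsCompact S)
    {δ : ℝ} (hδ : 0 < δ) : ∀ᶠ k in l, ∀ x ∈ S, |w k x - w' x| ≤ (2 * C + 1) * δ := by
  obtain ⟨t, -, ht, hcov⟩ := hS.finite_cover_balls hδ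
  have : ∀ᶠ k in l, ∀ c ∈ t, |w k c - w' c| < δ := by
    rw [eventually_all_finite ht]
    intro c _
    simpa [Real.dist_eq] using (Metric.tendsto_nhds.1 (hw c)) δ hδ
  filter_upwards [this] with k hk x hx
  obtain ⟨c, hc, hxc⟩ := mem_iUnion₂.1 (hcov hx)
  rw [Metric.mem_ball, dist_eq_norm] at hxc
  have h1 := (hC k c x).trans (mul_le_mul_of_nonneg_left hxc.le hC0)
  have h2 := (hC' c x).trans (mul_le_mul_of_nonneg_left hxc.le hC0)
  have h3 := hk c hc
  rw [abs_le] at h1 h2 ⊢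
  rw [abs_lt] at h3
  constructor <;> linarith [h1.1, h1.2, h2.1, h2.2, h3.1, h3.2]

section

variable {n : ℕ}

lemma continuous_stability_integrand {f : ℝ → ℝ} (hf : Continuous (deriv f))
    {u ψ : EuclideanSpace ℝ (Fin n) → ℝ} (hu : Continuous u) (hψ : ContDiff ℝ 1 ψ) :
    Continuous fun x => ∑ i, (fderiv ℝ ψ x (bv i)) ^ 2 - deriv f (u x) * ψ x ^ 2 := by
  have h1 : Continuous (fderiv ℝ ψ) := hψ.continuous_fderiv one_ne_zero
  have h2 : Continuous ψ := hψ.continuous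
  fun_prop

lemma hasCompactSupport_stability_integrand {f : ℝ → ℝ}
    {u ψ : EuclideanSpace ℝ (Fin n) → ℝ} (hψ : HasCompactSupport ψ) :
    HasCompactSupport fun x => ∑ i, (fderiv ℝ ψ x (bv i)) ^ 2 - deriv f (u x) * ψ x ^ 2 := by
  refine hψ.mono' fun x hx => ?_
  by_contra hx'
  refine hx ?_
  have h1 : fderiv ℝ ψ x = 0 := by
    by_contra h
    exact hx' (support_fderiv_subset ℝ h)
  simp [h1, image_eq_zero_of_notMem_tsupport hx']

lemma integrable_stability_integrand {f : ℝ → ℝ} (hf : Continuous (deriv f))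
    {u ψ : EuclideanSpace ℝ (Fin n) → ℝ} (hu : Continuous u) (hψ : ContDiff ℝ 1 ψ)
    (hs : HasCompactSupport ψ) :
    Integrable fun x => ∑ i, (fderiv ℝ ψ x (bv i)) ^ 2 - deriv f (u x) * ψ x ^ 2 :=
  (continuous_stability_integrand hf hu hψ).integrable_of_hasCompactSupport
    (hasCompactSupport_stability_integrand hs)

variable {f : ℝ → ℝ} {θ C : ℝ}

lemma StableSol.continuous {u : EuclideanSpace ℝ (Fin n) → ℝ} {G H} (hu : StableSol n f C u G H) :
    Continuous u :=
  continuous_iff_continuousAt.2 fun x => (hu.hG x).continuousAt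

lemma StableSol.continuous_fst {u : EuclideanSpace ℝ (Fin n) → ℝ} {G H}
    (hu : StableSol n f C u G H) : Continuous G :=
  continuous_iff_continuousAt.2 fun x => (hu.hH x).continuousAt

lemma StableSol.nonneg {u : EuclideanSpace ℝ (Fin n) → ℝ} {G H} (hu : StableSol n f C u G H) :
    0 ≤ C := (norm_nonneg _).trans (hu.bG 0)

lemma norm_le_of_tendsto_ultrafilter {F : Type*} [NormedAddCommGroup F] {𝓕 : Ultrafilter ℕ}
    {a : ℕ → F} {b : F} (h : Tendsto a 𝓕 (𝓝 b)) {C : ℝ} (hC : ∀ k, ‖a k‖ ≤ C) : ‖b‖ ≤ C :=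
  le_of_tendsto h.norm (Eventually.of_forall hC)

lemma norm_sub_le_of_tendsto_ultrafilter {F : Type*} [NormedAddCommGroup F] {𝓕 : Ultrafilter ℕ}
    {a a' : ℕ → F} {b b' : F} (h : Tendsto a 𝓕 (𝓝 b)) (h' : Tendsto a' 𝓕 (𝓝 b')) {C : ℝ}
    (hC : ∀ k, ‖a k - a' k‖ ≤ C) : ‖b - b'‖ ≤ C :=
  le_of_tendsto (h.sub h').norm (Eventually.of_forall hC)

lemma stability_of_tendsto (hf : Bistable f θ) (𝓕 : Ultrafilter ℕ)
    {u : ℕ → EuclideanSpace ℝ (Fin n) → ℝ} {u' : EuclideanSpace ℝ (Fin n) → ℝ} (hC0 : 0 ≤ C)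
    (huk : ∀ k, Continuous (u k)) (huc : Continuous u')
    (hlip : ∀ k x y, ‖u k y - u k x‖ ≤ C * ‖y - x‖) (hlip' : ∀ x y, ‖u' y - u' x‖ ≤ C * ‖y - x‖)
    (hu' : ∀ x, Tendsto (fun k => u k x) 𝓕 (𝓝 (u' x)))
    {ψ : EuclideanSpace ℝ (Fin n) → ℝ} (hψ : ContDiff ℝ 1 ψ) (hs : HasCompactSupport ψ)
    (hstable : ∀ k, 0 ≤ ∫ x, (∑ i, (fderiv ℝ ψ x (bv i)) ^ 2 - deriv f (u k x) * ψ x ^ 2)) :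
    0 ≤ ∫ x, (∑ i, (fderiv ℝ ψ x (bv i)) ^ 2 - deriv f (u' x) * ψ x ^ 2) := by
  obtain ⟨K, hK0, -, -, -, hK⟩ := hf.exists_bounds
  have hd : Continuous (deriv f) := hf.smooth.continuous_deriv le_rfl
  have hψc := hψ.continuous
  have iψ : Integrable fun x => ψ x ^ 2 :=
    (hψc.pow 2).integrable_of_hasCompactSupport (by
      simpa [sq] using hs.mul_left (f' := ψ))
  have i' := integrable_stability_integrand hd huc hψ hs
  set I := ∫ x, ψ x ^ 2 with hI
  have hI0 : 0 ≤ I := integral_nonneg fun x => sq_nonneg _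
  refine le_of_forall_pos_le_add fun ε hε => ?_
  set δ : ℝ := ε / ((K * (2 * C + 1)) * I + 1) with hδ
  have hδ0 : 0 < δ := by positivity
  obtain ⟨k, hk⟩ := (eventually_abs_sub_le_of_compact (w := u) (w' := u') hC0
    hlip
    hlip' hu' hs.isCompact hδ0).exists
  have i1 := integrable_stability_integrand hd (huk k) hψ hs
  have h0 := hstable k
  refine h0.trans ?_
  have hle : ∫ x, (∑ i, (fderiv ℝ ψ x (bv i)) ^ 2 - deriv f (u k x) * ψ x ^ 2) ≤
      ∫ x, ((∑ i, (fderiv ℝ ψ x (bv i)) ^ 2 - deriv f (u' x) * ψ x ^ 2) +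
        (K * ((2 * C + 1) * δ)) * ψ x ^ 2) := by
    refine integral_mono i1 (i'.add (iψ.const_mul _)) fun x => ?_
    by_cases hx : x ∈ tsupport ψ
    · have h1 := (hK (u' x) (u k x)).trans
        (mul_le_mul_of_nonneg_left ((abs_sub_comm _ _).le.trans (hk x hx)) hK0)
      have h2 := (le_abs_self _).trans h1
      simp only
      nlinarith [sq_nonneg (ψ x)]
    · simp [image_eq_zero_of_notMem_tsupport hx]
  refine hle.trans ?_
  rw [integral_add i' (iψ.const_mul _), integral_const_mul]
  refine add_le_add le_rfl ?_
  have : K * ((2 * C + 1) * δ) * I = ((K * (2 * C + 1)) * I) * δ := by ring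
  rw [this, hδ, mul_div_assoc', div_le_iff₀ (by positivity)]
  nlinarith [show 0 ≤ K * (2 * C + 1) * I by positivity]

lemma StableSol.exists_limit (hf : Bistable f θ) (𝓕 : Ultrafilter ℕ)
    {u : ℕ → EuclideanSpace ℝ (Fin n) → ℝ}
    {G : ℕ → EuclideanSpace ℝ (Fin n) → EuclideanSpace ℝ (Fin n) →L[ℝ] ℝ}
    {H : ℕ → EuclideanSpace ℝ (Fin n) →
      EuclideanSpace ℝ (Fin n) →L[ℝ] EuclideanSpace ℝ (Fin n) →L[ℝ] ℝ}
    (hu : ∀ k, StableSol n f C (u k) (G k) (H k)) :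
    ∃ u' G' H', StableSol n f C u' G' H' ∧ (∀ x, Tendsto (fun k => u k x) 𝓕 (𝓝 (u' x))) ∧
      ∀ x, Tendsto (fun k => G k x) 𝓕 (𝓝 (G' x)) := by
  have hC0 : 0 ≤ C := (hu 0).nonneg
  have e1 : ∀ x, ∃ y, Tendsto (fun k => u k x) 𝓕 (𝓝 y) := fun x =>
    exists_tendsto_ultrafilter 𝓕 (C := 1) fun k => by
      rw [Real.norm_eq_abs, abs_le]
      exact ⟨by linarith [((hu k).range x).1], ((hu k).range x).2⟩
  have e2 : ∀ x, ∃ y, Tendsto (fun k => G k x) 𝓕 (𝓝 y) := fun x =>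
    exists_tendsto_ultrafilter 𝓕 fun k => (hu k).bG x
  have : ProperSpace (EuclideanSpace ℝ (Fin n) →L[ℝ] EuclideanSpace ℝ (Fin n) →L[ℝ] ℝ) :=
    FiniteDimensional.proper_real (EuclideanSpace ℝ (Fin n) →L[ℝ] EuclideanSpace ℝ (Fin n) →L[ℝ] ℝ)
  have e3 : ∀ x, ∃ y, Tendsto (fun k => H k x) 𝓕 (𝓝 y) := fun x =>
    exists_tendsto_ultrafilter
      (F := EuclideanSpace ℝ (Fin n) →L[ℝ] EuclideanSpace ℝ (Fin n) →L[ℝ] ℝ) 𝓕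
      fun k => (hu k).bH x
  choose u' hu' using e1
  choose G' hG' using e2
  choose H' hH' using e3
  have hGd : ∀ x, HasFDerivAt u' (G' x) x := hasFDerivAt_of_tendsto (fun k => (hu k).hG) hC0
    (fun k => norm_sub_le_of_fderiv_bounded (hu k).hH (hu k).bH) hu' hG'
  have hHd : ∀ x, HasFDerivAt G' (H' x) x := hasFDerivAt_of_tendsto (fun k => (hu k).hH) hC0
    (fun k => (hu k).lipH) hG' hH'
  have bG : ∀ x, ‖G' x‖ ≤ C := fun x =>
    le_of_tendsto (hG' x).norm (Eventually.of_forall fun k => (hu k).bG x)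
  have huc : Continuous u' := continuous_iff_continuousAt.2 fun x => (hGd x).continuousAt
  refine ⟨u', G', H', ⟨?_, hGd, hHd, bG, ?_, ?_, ?_, ?_⟩, hu', hG'⟩
  · exact fun x => isClosed_Icc.mem_of_tendsto (hu' x)
      (Eventually.of_forall fun k => (hu k).range x)
  · exact fun x => norm_le_of_tendsto_ultrafilter
      (F := EuclideanSpace ℝ (Fin n) →L[ℝ] EuclideanSpace ℝ (Fin n) →L[ℝ] ℝ) (hH' x)
      fun k => (hu k).bH x
  · exact fun x y => norm_sub_le_of_tendsto_ultrafilter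
      (F := EuclideanSpace ℝ (Fin n) →L[ℝ] EuclideanSpace ℝ (Fin n) →L[ℝ] ℝ) (hH' y) (hH' x)
      fun k => (hu k).lipH x y
  · intro x
    have t1 : Tendsto (fun k => ∑ i, H k x (bv i) (bv i) + f (u k x)) 𝓕
        (𝓝 (∑ i, H' x (bv i) (bv i) + f (u' x))) := by
      refine Tendsto.add (tendsto_finsetSum _ fun i _ => ?_)
        ((hf.smooth.continuous.tendsto _).comp (hu' x))
      have hc : Continuous fun A : EuclideanSpace ℝ (Fin n) →L[ℝ]
          EuclideanSpace ℝ (Fin n) →L[ℝ] ℝ => A (bv i) (bv i) := by fun_prop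
      exact (hc.tendsto _).comp (hH' x)
    simp only [(hu _).pde] at t1
    exact (tendsto_nhds_unique t1 tendsto_const_nhds)
  · intro ψ hψ hs
    exact stability_of_tendsto hf 𝓕 hC0 (fun k => (hu k).continuous) huc
      (fun k => norm_sub_le_of_fderiv_bounded (hu k).hG (hu k).bG)
      (norm_sub_le_of_fderiv_bounded hGd bG) hu' hψ hs fun k => (hu k).stable ψ hψ hs

lemma StableSol.translate {u : EuclideanSpace ℝ (Fin n) → ℝ} {G H}
    (hu : StableSol n f C u G H) (a : EuclideanSpace ℝ (Fin n)) :
    StableSol n f C (fun x => u (x + a)) (fun x => G (x + a)) (fun x => H (x + a)) where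
  range x := hu.range _
  hG x := (hu.hG _).comp_translate
  hH x := (hu.hH _).comp_translate
  bG x := hu.bG _
  bH x := hu.bH _
  lipH x y := by simpa using hu.lipH (x + a) (y + a)
  pde x := hu.pde _
  stable ψ hψ hs := by
    have h := hu.stable (fun x => ψ (x - a)) (hψ.comp (contDiff_id.sub contDiff_const))
      (hs.comp_homeomorph (Homeomorph.subRight a))
    rw [← integral_add_right_eq_self _ a] at h
    simpa [fderiv_comp_sub] using h

end

section

variable {n : ℕ}

/-- Forget the last coordinate. -/
def dropLast (n : ℕ) : EuclideanSpace ℝ (Fin (n + 1)) →L[ℝ] EuclideanSpace ℝ (Fin n) :=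
  LinearMap.toContinuousLinearMap
    { toFun := fun X => WithLp.toLp 2 fun i => X i.castSucc
      map_add' := fun X Y => by ext; simp
      map_smul' := fun c X => by ext; simp }

/-- Append a last coordinate equal to zero. -/
def appendZero (n : ℕ) : EuclideanSpace ℝ (Fin n) →L[ℝ] EuclideanSpace ℝ (Fin (n + 1)) :=
  LinearMap.toContinuousLinearMap
    { toFun := fun x => WithLp.toLp 2 (Fin.snoc (α := fun _ => ℝ) x 0)
      map_add' := fun X Y => by
        ext i; refine Fin.lastCases ?_ (fun j => ?_) i <;> simp
      map_smul' := fun c X => by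
        ext i; refine Fin.lastCases ?_ (fun j => ?_) i <;> simp }

@[simp] lemma dropLast_apply (X : EuclideanSpace ℝ (Fin (n + 1))) (i : Fin n) :
    dropLast n X i = X i.castSucc := rfl

@[simp] lemma appendZero_castSucc (x : EuclideanSpace ℝ (Fin n)) (i : Fin n) :
    appendZero n x i.castSucc = x i := by
  change Fin.snoc (α := fun _ => ℝ) x 0 i.castSucc = _
  simp

@[simp] lemma appendZero_last (x : EuclideanSpace ℝ (Fin n)) :
    appendZero n x (Fin.last n) = 0 := by
  change Fin.snoc (α := fun _ => ℝ) x 0 (Fin.last n) = _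
  simp

lemma norm_appendZero (x : EuclideanSpace ℝ (Fin n)) : ‖appendZero n x‖ = ‖x‖ := by
  rw [← sq_eq_sq₀ (norm_nonneg _) (norm_nonneg _), EuclideanSpace.norm_sq_eq,
    EuclideanSpace.norm_sq_eq, Fin.sum_univ_castSucc]
  simp

lemma norm_sq_eq_dropLast (X : EuclideanSpace ℝ (Fin (n + 1))) :
    ‖X‖ ^ 2 = ‖dropLast n X‖ ^ 2 + X (Fin.last n) ^ 2 := by
  rw [EuclideanSpace.norm_sq_eq, EuclideanSpace.norm_sq_eq, Fin.sum_univ_castSucc]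
  simp

lemma appendZero_dropLast_add (X : EuclideanSpace ℝ (Fin (n + 1))) :
    appendZero n (dropLast n X) + X (Fin.last n) • bv (Fin.last n) = X := by
  ext i
  refine Fin.lastCases ?_ (fun j => ?_) i
  · simp
  · simp [Fin.castSucc_ne_last]

lemma dropLast_bv (i : Fin n) : dropLast n (bv i.castSucc) = bv i := by
  ext j
  simp

lemma dropLast_bv_last : dropLast n (bv (Fin.last n)) = 0 := by
  ext j
  simp [Fin.castSucc_ne_last]

lemma appendZero_bv (i : Fin n) : appendZero n (bv i) = bv i.castSucc := by
  ext j
  refine Fin.lastCases ?_ (fun k => ?_) j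
  · simp [(Fin.castSucc_ne_last i).symm]
  · simp

/-- Splitting off the last coordinate, as a measurable equivalence. -/
def splitLast (n : ℕ) :
    EuclideanSpace ℝ (Fin (n + 1)) ≃ᵐ ℝ × EuclideanSpace ℝ (Fin n) :=
  ((MeasurableEquiv.toLp 2 (Fin (n + 1) → ℝ)).symm.trans
    (MeasurableEquiv.piFinSuccAbove (fun _ => ℝ) (Fin.last n))).trans
    (MeasurableEquiv.prodCongr (MeasurableEquiv.refl ℝ) (MeasurableEquiv.toLp 2 (Fin n → ℝ)))

lemma splitLast_apply (X : EuclideanSpace ℝ (Fin (n + 1))) :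
    splitLast n X = (X (Fin.last n), dropLast n X) := by
  refine Prod.ext ?_ ?_
  · simp [splitLast]
    rfl
  · ext i
    simp [splitLast]
    rfl

lemma measurePreserving_splitLast : MeasurePreserving (splitLast n) volume volume := by
  refine MeasurePreserving.trans (MeasurePreserving.trans
    (EuclideanSpace.volume_preserving_symm_measurableEquiv_toLp (Fin (n + 1)))
    (volume_preserving_piFinSuccAbove (fun _ => ℝ) (Fin.last n))) ?_
  exact (MeasurePreserving.id volume).prod (PiLp.volume_preserving_toLp (Fin n))

lemma integral_mul_last (a : EuclideanSpace ℝ (Fin n) → ℝ) (b : ℝ → ℝ) :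
    ∫ X : EuclideanSpace ℝ (Fin (n + 1)), b (X (Fin.last n)) * a (dropLast n X) =
      (∫ t, b t) * ∫ x, a x := by
  have h := (measurePreserving_splitLast (n := n)).integral_comp'
    (g := fun p : ℝ × EuclideanSpace ℝ (Fin n) => b p.1 * a p.2)
  simp only [splitLast_apply] at h
  rw [h]
  exact integral_prod_mul b a

lemma integrable_mul_last {a : EuclideanSpace ℝ (Fin n) → ℝ} {b : ℝ → ℝ}
    (ha : Integrable a) (hb : Integrable b) :
    Integrable fun X : EuclideanSpace ℝ (Fin (n + 1)) => b (X (Fin.last n)) * a (dropLast n X) := by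
  have h := (measurePreserving_splitLast (n := n)).integrable_comp_emb
    (splitLast n).measurableEmbedding
    (g := fun p : ℝ × EuclideanSpace ℝ (Fin n) => b p.1 * a p.2)
  have h2 := h.2 (hb.mul_prod ha)
  refine h2.congr (Eventually.of_forall fun X => ?_)
  simp [splitLast_apply]

lemma integral_comp_dropLast_test {u ψ : EuclideanSpace ℝ (Fin n) → ℝ} {g χ : ℝ → ℝ}
    (hg : Continuous g) (hu : Continuous u) (hψ : ContDiff ℝ 1 ψ) (hs : HasCompactSupport ψ)
    (hχ : ContDiff ℝ 1 χ) (hχs : HasCompactSupport χ) :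
    ∫ X : EuclideanSpace ℝ (Fin (n + 1)),
      (∑ i, (fderiv ℝ (fun X => ψ (dropLast n X) * χ (X (Fin.last n))) X (bv i)) ^ 2
        - g (u (dropLast n X)) * (ψ (dropLast n X) * χ (X (Fin.last n))) ^ 2) =
    (∫ t, χ t ^ 2) * (∫ x, (∑ i, (fderiv ℝ ψ x (bv i)) ^ 2 - g (u x) * ψ x ^ 2)) +
      (∫ t, deriv χ t ^ 2) * ∫ x, ψ x ^ 2 := by
  have hdχ : Continuous (deriv χ) := hχ.continuous_deriv le_rfl
  have i1 : Integrable fun t => χ t ^ 2 :=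
    (hχ.continuous.pow 2).integrable_of_hasCompactSupport (by
      simpa [sq] using hχs.mul_left (f' := χ))
  have i2 : Integrable fun t => deriv χ t ^ 2 :=
    (hdχ.pow 2).integrable_of_hasCompactSupport (by
      simpa [sq] using (hχs.deriv).mul_left (f' := deriv χ))
  have i3 : Integrable fun x => ψ x ^ 2 :=
    (hψ.continuous.pow 2).integrable_of_hasCompactSupport (by
      simpa [sq] using hs.mul_left (f' := ψ))
  have i4 : Integrable fun x => (∑ i, (fderiv ℝ ψ x (bv i)) ^ 2 - g (u x) * ψ x ^ 2) := by
    have h1 : Continuous (fderiv ℝ ψ) := hψ.continuous_fderiv one_ne_zero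
    have h2 : Continuous ψ := hψ.continuous
    refine Continuous.integrable_of_hasCompactSupport (by fun_prop) ?_
    refine hs.mono' fun x hx => ?_
    by_contra hx'
    refine hx ?_
    have h1 : fderiv ℝ ψ x = 0 := by
      by_contra h
      exact hx' (support_fderiv_subset ℝ h)
    simp [h1, image_eq_zero_of_notMem_tsupport hx']
  rw [← integral_mul_last, ← integral_mul_last,
    ← integral_add (integrable_mul_last i4 i1) (integrable_mul_last i3 i2)]
  refine integral_congr_ae (Eventually.of_forall fun X => ?_)
  have d1 : HasFDerivAt (fun X => ψ (dropLast n X))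
      ((fderiv ℝ ψ (dropLast n X)).comp (dropLast n)) X :=
    (hψ.differentiable one_ne_zero _).hasFDerivAt.comp X (dropLast n).hasFDerivAt
  have d2 : HasFDerivAt (fun X : EuclideanSpace ℝ (Fin (n + 1)) => χ (X (Fin.last n)))
      (deriv χ (X (Fin.last n)) • (EuclideanSpace.proj (Fin.last n) :
        EuclideanSpace ℝ (Fin (n + 1)) →L[ℝ] ℝ)) X :=
    HasDerivAt.comp_hasFDerivAt (f := fun X : EuclideanSpace ℝ (Fin (n + 1)) => X (Fin.last n)) X
      ((hχ.differentiable one_ne_zero _).hasDerivAt)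
      (EuclideanSpace.proj (Fin.last n) : EuclideanSpace ℝ (Fin (n + 1)) →L[ℝ] ℝ).hasFDerivAt
  have d3 := (d1.mul d2).fderiv
  have d4 : fderiv ℝ (fun X => ψ (dropLast n X) * χ (X (Fin.last n))) X = _ := d3
  simp only [d4, Fin.sum_univ_castSucc]
  simp [dropLast_bv, dropLast_bv_last, mul_pow, ← Finset.mul_sum]
  ring

variable {f : ℝ → ℝ} {θ C : ℝ}

lemma stability_of_comp_dropLast {g : ℝ → ℝ} (hg : Continuous g)
    {u ψ : EuclideanSpace ℝ (Fin n) → ℝ} (hu : Continuous u) (hψ : ContDiff ℝ 1 ψ)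
    (hs : HasCompactSupport ψ)
    (hst : ∀ Ψ : EuclideanSpace ℝ (Fin (n + 1)) → ℝ, ContDiff ℝ 1 Ψ → HasCompactSupport Ψ →
      0 ≤ ∫ X, (∑ i, (fderiv ℝ Ψ X (bv i)) ^ 2 - g (u (dropLast n X)) * Ψ X ^ 2)) :
    0 ≤ ∫ x, (∑ i, (fderiv ℝ ψ x (bv i)) ^ 2 - g (u x) * ψ x ^ 2) := by
  set A := ∫ x, (∑ i, (fderiv ℝ ψ x (bv i)) ^ 2 - g (u x) * ψ x ^ 2) with hA
  obtain ⟨χ, hχ, hχs, hχ0⟩ : ∃ χ : ℝ → ℝ, ContDiff ℝ 1 χ ∧ HasCompactSupport χ ∧ χ 0 = 1 := by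
    let χ : ContDiffBump (0 : ℝ) := ⟨1, 2, one_pos, one_lt_two⟩
    exact ⟨χ, χ.contDiff, χ.hasCompactSupport, χ.one_of_mem_closedBall (by simp [χ])⟩
  have hpos : 0 < ∫ t, χ t ^ 2 := by
    refine Continuous.integral_pos_of_hasCompactSupport_nonneg_nonzero (x := 0)
      (hχ.continuous.pow 2) (hχs.comp_left (g := fun s => s ^ 2) (by simp))
      (fun t => sq_nonneg _) (by simp [hχ0])
  have key : ∀ k : ℝ, 0 < k →
      0 ≤ (k * ∫ t, χ t ^ 2) * A + (k⁻¹ * ∫ t, deriv χ t ^ 2) * ∫ x, ψ x ^ 2 := by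
    intro k hk
    have c1 : ContDiff ℝ 1 fun t : ℝ => χ (t / k) := hχ.comp (contDiff_id.div_const k)
    have s1 : HasCompactSupport fun t : ℝ => χ (t / k) := by
      have := hχs.comp_homeomorph (Homeomorph.mulRight₀ (k⁻¹) (inv_ne_zero hk.ne'))
      simpa [Function.comp_def, div_eq_mul_inv] using this
    have h := hst (fun X => ψ (dropLast n X) * χ (X (Fin.last n) / k)) ?_ ?_
    · rw [integral_comp_dropLast_test hg hu hψ hs c1 s1] at h
      have e1 : ∫ t, χ (t / k) ^ 2 = k * ∫ t, χ t ^ 2 := by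
        rw [Measure.integral_comp_div (fun t => χ t ^ 2) k, abs_of_pos hk, smul_eq_mul]
      have e2 : ∫ t, deriv (fun t => χ (t / k)) t ^ 2 = k⁻¹ * ∫ t, deriv χ t ^ 2 := by
        have : ∀ t, deriv (fun t => χ (t / k)) t ^ 2 = k⁻¹ ^ 2 * deriv χ (t / k) ^ 2 := by
          intro t
          have : HasDerivAt (fun t => χ (t / k)) (deriv χ (t / k) * (1 / k)) t :=
            HasDerivAt.comp t (h₂ := χ) (hχ.differentiable one_ne_zero _).hasDerivAt
              ((hasDerivAt_id t).div_const k)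
          rw [this.deriv]
          field_simp
        simp only [this]
        rw [integral_const_mul, Measure.integral_comp_div (fun t => deriv χ t ^ 2) k,
          abs_of_pos hk, smul_eq_mul]
        field_simp
      rwa [e1, e2] at h
    · exact (hψ.comp (dropLast n).contDiff).mul
        (c1.comp (EuclideanSpace.proj (Fin.last n) :
          EuclideanSpace ℝ (Fin (n + 1)) →L[ℝ] ℝ).contDiff)
    · obtain ⟨R1, h1⟩ := hs.isCompact.isBounded.exists_norm_le
      obtain ⟨R2, h2⟩ := s1.isCompact.isBounded.exists_norm_le
      refine HasCompactSupport.intro (isCompact_closedBall 0 (|R1| + |R2|)) fun X hX => ?_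
      rw [mem_closedBall_zero_iff, not_le] at hX
      by_contra h0
      have n1 := h1 _ (subset_tsupport _ (left_ne_zero_of_mul h0))
      have n2 := h2 _ (subset_tsupport (fun t => χ (t / k)) (right_ne_zero_of_mul h0))
      rw [Real.norm_eq_abs] at n2
      have n3 := norm_sq_eq_dropLast X
      have n4 := n1.trans (le_abs_self _)
      have n5 := n2.trans (le_abs_self _)
      rw [← sq_abs (X (Fin.last n))] at n3
      nlinarith [norm_nonneg (dropLast n X), abs_nonneg (X (Fin.last n)), norm_nonneg X]
  by_contra hneg
  rw [not_le] at hneg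
  have t1 : Tendsto (fun k : ℝ => (∫ t, χ t ^ 2) * A +
      (k⁻¹ * k⁻¹) * ((∫ t, deriv χ t ^ 2) * ∫ x, ψ x ^ 2)) atTop
      (𝓝 ((∫ t, χ t ^ 2) * A + (0 * 0) * ((∫ t, deriv χ t ^ 2) * ∫ x, ψ x ^ 2))) :=
    ((tendsto_inv_atTop_zero.mul tendsto_inv_atTop_zero).mul_const _).const_add _
  have t2 := ge_of_tendsto (b := (0 : ℝ)) t1 (by
    filter_upwards [eventually_gt_atTop 0] with k hk
    have := mul_nonneg (inv_nonneg.2 hk.le) (key k hk)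
    refine this.trans_eq ?_
    field_simp)
  nlinarith

lemma StableSol.dropLast (hf : Bistable f θ) {U : EuclideanSpace ℝ (Fin (n + 1)) → ℝ} {G H}
    (hU : StableSol (n + 1) f C U G H)
    (hinv : ∀ (t : ℝ) X, U (X + t • bv (Fin.last n)) = U X) :
    ∃ G' H', StableSol n f C (fun x => U (appendZero n x)) G' H' := by
  have hC0 := hU.nonneg
  have hd : Continuous (deriv f) := hf.smooth.continuous_deriv le_rfl
  have hGz : ∀ X, G X (bv (Fin.last n)) = 0 := by
    intro X
    have h1 := HasFDerivAt.hasDerivAt_line hU.hG X (bv (Fin.last n)) 0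
    simp only [hinv] at h1
    simpa using h1.unique (hasDerivAt_const 0 (U X))
  have hHz : ∀ X, H X (bv (Fin.last n)) (bv (Fin.last n)) = 0 := by
    intro X
    have h1 : HasFDerivAt (fun Y => G Y (bv (Fin.last n))) ((H X).flip (bv (Fin.last n))) X :=
      ((ContinuousLinearMap.apply ℝ ℝ (bv (Fin.last n))).hasFDerivAt).comp X (hU.hH X)
    simp only [hGz] at h1
    have := h1.unique (hasFDerivAt_const 0 X)
    simpa using congrArg (fun A => A (bv (Fin.last n))) this
  set e := appendZero n with he
  have b2 : ∀ (A : EuclideanSpace ℝ (Fin (n + 1)) →L[ℝ] EuclideanSpace ℝ (Fin (n + 1)) →L[ℝ] ℝ)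
      (M : ℝ), ‖A‖ ≤ M → ‖A.bilinearComp e e‖ ≤ M := by
    intro A M hM
    refine ContinuousLinearMap.opNorm_le_bound₂ _ ((norm_nonneg A).trans hM) fun x y => ?_
    have := A.le_of_opNorm₂_le_of_le hM (norm_appendZero x).le (norm_appendZero y).le
    simpa using this
  refine ⟨fun x => (G (e x)).comp e, fun x => (H (e x)).bilinearComp e e, ?_, ?_, ?_, ?_, ?_, ?_,
    ?_, ?_⟩
  · exact fun x => hU.range _
  · exact fun x => (hU.hG _).comp x e.hasFDerivAt
  · intro x
    have h1 := (hU.hH (e x)).comp x e.hasFDerivAt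
    have h2 := ((ContinuousLinearMap.compL ℝ (EuclideanSpace ℝ (Fin n))
      (EuclideanSpace ℝ (Fin (n + 1))) ℝ).flip e).hasFDerivAt.comp x h1
    refine h2.congr_fderiv ?_
    ext a b
    simp
  · intro x
    refine ContinuousLinearMap.opNorm_le_bound _ hC0 fun y => ?_
    refine ((G (e x)).le_of_opNorm_le (hU.bG _) _).trans ?_
    exact (congrArg (C * ·) (norm_appendZero y)).le
  · exact fun x => b2 _ _ (hU.bH _)
  · intro x y
    have := b2 _ _ (hU.lipH (e x) (e y))
    rw [← map_sub, he, norm_appendZero] at this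
    convert this using 2
    ext; simp [he]
  · intro x
    have := hU.pde (e x)
    rw [Fin.sum_univ_castSucc, hHz] at this
    simpa [he, appendZero_bv] using this
  · intro ψ hψ hs
    refine stability_of_comp_dropLast hd (hU.continuous.comp e.continuous) hψ hs
      fun Ψ hΨ hΨs => ?_
    have h := hU.stable Ψ hΨ hΨs
    have e1 : ∀ X, U (e (_root_.dropLast n X)) = U X := fun X => by
      conv_rhs => rw [← appendZero_dropLast_add X, hinv]
    simpa [e1] using h

lemma StableSol.exists_planar (hf : Bistable f θ) {m : ℕ} :
    ∀ {U : EuclideanSpace ℝ (Fin (m + 2)) → ℝ} {G H}, StableSol (m + 2) f C U G H →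
      (∀ i : Fin (m + 2), 2 ≤ i.val → ∀ (t : ℝ) X, U (X + t • bv i) = U X) →
      ∃ u G' H', StableSol 2 f C u G' H' ∧ u 0 = U 0 := by
  induction m with
  | zero => exact fun hU _ => ⟨_, _, _, hU, rfl⟩
  | succ m ih =>
    intro U G H hU hinv
    obtain ⟨G', H', h'⟩ := hU.dropLast hf (hinv (Fin.last _) (by simp))
    obtain ⟨u, G2, H2, h2, h0⟩ := ih h' fun i hi t X => by
      simpa [appendZero_bv] using hinv i.castSucc hi t (appendZero _ X)
    exact ⟨u, G2, H2, h2, by simpa using h0⟩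

end

lemma fderiv_eq_zero_of_notMem_tsupport {E : Type*} [NormedAddCommGroup E] [NormedSpace ℝ E]
    {ψ : E → ℝ} {x : E} (hx : x ∉ tsupport ψ) : fderiv ℝ ψ x = 0 := by
  by_contra h
  exact hx (support_fderiv_subset ℝ h)

lemma integrable_sum_fderiv_sq {n : ℕ} {ξ : EuclideanSpace ℝ (Fin n) → ℝ} (hξ : ContDiff ℝ 1 ξ)
    (hs : HasCompactSupport ξ) : Integrable fun x => ∑ i, (fderiv ℝ ξ x (bv i)) ^ 2 := by
  have h1 : Continuous (fderiv ℝ ξ) := hξ.continuous_fderiv one_ne_zero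
  refine Continuous.integrable_of_hasCompactSupport (by fun_prop) ?_
  refine hs.mono' fun x hx => ?_
  by_contra hx'
  exact hx (by simp [fderiv_eq_zero_of_notMem_tsupport hx'])

lemma fderiv_comp_const_smul {n : ℕ} {ξ : EuclideanSpace ℝ (Fin n) → ℝ} (hξ : ContDiff ℝ 1 ξ)
    (c : ℝ) (x : EuclideanSpace ℝ (Fin n)) :
    fderiv ℝ (fun x => ξ (c • x)) x = c • fderiv ℝ ξ (c • x) := by
  have h : HasFDerivAt (fun x : EuclideanSpace ℝ (Fin n) => c • x)
      (c • ContinuousLinearMap.id ℝ (EuclideanSpace ℝ (Fin n))) x :=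
    (hasFDerivAt_id x).const_smul c
  have h2 := ((hξ.differentiable one_ne_zero (c • x)).hasFDerivAt.comp x h).fderiv
  refine h2.trans ?_
  ext y
  simp

lemma HasCompactSupport.comp_const_smul {n : ℕ} {ξ : EuclideanSpace ℝ (Fin n) → ℝ}
    (hs : HasCompactSupport ξ) {c : ℝ} (hc : c ≠ 0) : HasCompactSupport fun x => ξ (c • x) :=
  hs.comp_homeomorph (Homeomorph.smulOfNeZero c hc)

/-- The Dirichlet energy is invariant under dilations in the plane. -/
lemma energy_comp_const_smul {ξ : EuclideanSpace ℝ (Fin 2) → ℝ} (hξ : ContDiff ℝ 1 ξ)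
    {c : ℝ} (hc : c ≠ 0) :
    ∫ x, ∑ i, (fderiv ℝ (fun x => ξ (c • x)) x (bv i)) ^ 2 =
      ∫ x, ∑ i, (fderiv ℝ ξ x (bv i)) ^ 2 := by
  have : ∀ x, ∑ i, (fderiv ℝ (fun x => ξ (c • x)) x (bv i)) ^ 2 =
      c ^ 2 * ∑ i, (fderiv ℝ ξ (c • x) (bv i)) ^ 2 := by
    intro x
    simp only [fderiv_comp_const_smul hξ, _root_.smul_apply, smul_eq_mul, Fin.sum_univ_two]
    ring
  simp only [this]
  rw [integral_const_mul, Measure.integral_comp_smul volume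
    (fun x => ∑ i, (fderiv ℝ ξ x (bv i)) ^ 2) c]
  have hc2 : (c ^ 2) ≠ 0 := pow_ne_zero 2 hc
  rw [finrank_euclideanSpace_fin, abs_of_nonneg (by positivity), smul_eq_mul,
    mul_inv_cancel_left₀ hc2]

lemma exists_cutoff_energy_half {ξ : EuclideanSpace ℝ (Fin 2) → ℝ} (hξ : ContDiff ℝ 1 ξ)
    (hs : HasCompactSupport ξ) (h1 : ∀ x, ‖x‖ ≤ 1 → ξ x = 1) :
    ∃ ζ : EuclideanSpace ℝ (Fin 2) → ℝ, ContDiff ℝ 1 ζ ∧ HasCompactSupport ζ ∧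
      (∀ x, ‖x‖ ≤ 1 → ζ x = 1) ∧
      ∫ x, ∑ i, (fderiv ℝ ζ x (bv i)) ^ 2 = (∫ x, ∑ i, (fderiv ℝ ξ x (bv i)) ^ 2) / 2 := by
  obtain ⟨R0, hR0⟩ := hs.isCompact.isBounded.exists_norm_le
  set R := max R0 0 + 1 with hR
  have hR1 : 1 ≤ R := by simp [hR]
  have hRpos : 0 < R := by linarith
  have hsupp : ∀ x, R ≤ ‖x‖ → x ∉ tsupport ξ := fun x hx h => by
    have := (hR0 x h).trans (le_max_left _ 0)
    linarith
  have hc : R⁻¹ ≠ 0 := inv_ne_zero hRpos.ne'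
  have hξR : ContDiff ℝ 1 fun x => ξ (R⁻¹ • x) := hξ.comp (contDiff_const_smul _)
  have hone : ∀ x : EuclideanSpace ℝ (Fin 2), ‖x‖ ≤ R → ξ (R⁻¹ • x) = 1 := fun x hx => by
    refine h1 _ ?_
    rw [norm_smul, Real.norm_of_nonneg (by positivity), inv_mul_le_iff₀ hRpos]
    linarith
  refine ⟨fun x => (1 / 2) * (ξ x + ξ (R⁻¹ • x)), ?_, ?_, ?_, ?_⟩
  · exact contDiff_const.mul (hξ.add hξR)
  · exact (hs.add (hs.comp_const_smul hc)).comp_left (g := fun s => (1 / 2) * s) (by simp)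
  · intro x hx
    simp only
    rw [h1 x hx, hone x (hx.trans hR1)]
    norm_num
  · have i1 := integrable_sum_fderiv_sq hξ hs
    have i2 := integrable_sum_fderiv_sq hξR (hs.comp_const_smul hc)
    have hpt : ∀ x, ∑ i, (fderiv ℝ (fun x => (1 / 2) * (ξ x + ξ (R⁻¹ • x))) x (bv i)) ^ 2 =
        (1 / 4) * (∑ i, (fderiv ℝ ξ x (bv i)) ^ 2 +
          ∑ i, (fderiv ℝ (fun x => ξ (R⁻¹ • x)) x (bv i)) ^ 2) := by
      intro x
      have d1 := (hξ.differentiable one_ne_zero x).hasFDerivAt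
      have d2 := (hξR.differentiable one_ne_zero x).hasFDerivAt
      have d3 : fderiv ℝ (fun x => (1 / 2) * (ξ x + ξ (R⁻¹ • x))) x = _ :=
        ((d1.add d2).const_mul (1 / 2)).fderiv
      rw [d3]
      rcases lt_or_ge ‖x‖ R with hx | hx
      · have : fderiv ℝ (fun x => ξ (R⁻¹ • x)) x = 0 := by
          have hev : (fun x => ξ (R⁻¹ • x)) =ᶠ[𝓝 x] fun _ => 1 := by
            filter_upwards [continuous_norm.continuousAt.eventually_lt_const hx] with y hy
            exact hone y hy.le
          rw [hev.fderiv_eq]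
          simp
        simp only [this, add_zero]
        simp only [_root_.smul_apply, smul_eq_mul, Fin.sum_univ_two, zero_apply]
        ring
      · simp only [fderiv_eq_zero_of_notMem_tsupport (hsupp x hx), zero_add]
        simp only [_root_.smul_apply, smul_eq_mul, Fin.sum_univ_two, zero_apply]
        ring
    simp only [hpt]
    rw [integral_const_mul, integral_add i1 i2, energy_comp_const_smul hξ hc]
    ring

lemma exists_cutoff_energy_le {r ε : ℝ} (hr : 0 < r) (hε : 0 < ε) :
    ∃ ξ : EuclideanSpace ℝ (Fin 2) → ℝ, ContDiff ℝ 1 ξ ∧ HasCompactSupport ξ ∧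
      (∀ x, ‖x‖ ≤ r → ξ x = 1) ∧ ∫ x, ∑ i, (fderiv ℝ ξ x (bv i)) ^ 2 ≤ ε := by
  obtain ⟨E, hE⟩ : ∃ E : ℝ, ∀ k : ℕ, ∃ ξ : EuclideanSpace ℝ (Fin 2) → ℝ, ContDiff ℝ 1 ξ ∧
      HasCompactSupport ξ ∧ (∀ x, ‖x‖ ≤ 1 → ξ x = 1) ∧
      ∫ x, ∑ i, (fderiv ℝ ξ x (bv i)) ^ 2 = E * (1 / 2) ^ k := by
    let χ : ContDiffBump (0 : EuclideanSpace ℝ (Fin 2)) := ⟨1, 2, one_pos, one_lt_two⟩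
    refine ⟨∫ x, ∑ i, (fderiv ℝ χ x (bv i)) ^ 2, fun k => ?_⟩
    induction k with
    | zero =>
      exact ⟨χ, χ.contDiff, χ.hasCompactSupport,
        fun x hx => χ.one_of_mem_closedBall (by simpa [χ] using hx), by simp⟩
    | succ k ih =>
      obtain ⟨ξ, a1, a2, a3, a4⟩ := ih
      obtain ⟨ζ, b1, b2, b3, b4⟩ := exists_cutoff_energy_half a1 a2 a3
      exact ⟨ζ, b1, b2, b3, by rw [b4, a4]; ring⟩
  have ht : Tendsto (fun k : ℕ => E * (1 / 2 : ℝ) ^ k) atTop (𝓝 (E * 0)) :=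
    (tendsto_pow_atTop_nhds_zero_of_lt_one (by norm_num) (by norm_num)).const_mul E
  rw [mul_zero] at ht
  obtain ⟨k, hk⟩ := (ht.eventually_le_const hε).exists
  obtain ⟨ξ, a1, a2, a3, a4⟩ := hE k
  have hc : r⁻¹ ≠ 0 := inv_ne_zero hr.ne'
  refine ⟨fun x => ξ (r⁻¹ • x), a1.comp (contDiff_const_smul _), a2.comp_const_smul hc, ?_, ?_⟩
  · intro x hx
    refine a3 _ ?_
    rw [norm_smul, Real.norm_of_nonneg (by positivity), inv_mul_le_iff₀ hr]
    linarith
  · rw [energy_comp_const_smul a1 hc, a4]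
    exact hk

lemma continuous_of_norm_sub_le {E F : Type*} [NormedAddCommGroup E] [NormedAddCommGroup F]
    {w : E → F} {C : ℝ} (h : ∀ x y, ‖w y - w x‖ ≤ C * ‖y - x‖) : Continuous w := by
  refine (LipschitzWith.of_dist_le_mul (K := C.toNNReal) fun x y => ?_).continuous
  rw [dist_eq_norm, dist_eq_norm]
  exact (h y x).trans (mul_le_mul_of_nonneg_right (Real.le_coe_toNNReal C) (norm_nonneg _))

lemma integrable_of_eq_zero_of_notMem_tsupport {n : ℕ} {η F : EuclideanSpace ℝ (Fin n) → ℝ}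
    (hs : HasCompactSupport η) (hF : Continuous F) (h0 : ∀ x, x ∉ tsupport η → F x = 0) :
    Integrable F := by
  refine hF.integrable_of_hasCompactSupport (hs.mono' fun x hx => ?_)
  by_contra hx'
  exact hx (h0 x hx')

section

variable {n : ℕ} {f : ℝ → ℝ} {θ C : ℝ} {u : EuclideanSpace ℝ (Fin n) → ℝ}
  {G : EuclideanSpace ℝ (Fin n) → EuclideanSpace ℝ (Fin n) →L[ℝ] ℝ}
  {H : EuclideanSpace ℝ (Fin n) → EuclideanSpace ℝ (Fin n) →L[ℝ] EuclideanSpace ℝ (Fin n) →L[ℝ] ℝ}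

lemma StableSol.continuous_snd (hu : StableSol n f C u G H) : Continuous H :=
  continuous_of_norm_sub_le
    (F := EuclideanSpace ℝ (Fin n) →L[ℝ] EuclideanSpace ℝ (Fin n) →L[ℝ] ℝ) hu.lipH

lemma StableSol.hasFDerivAt_partial (hu : StableSol n f C u G H) (e x : EuclideanSpace ℝ (Fin n)) :
    HasFDerivAt (fun x => G x e) ((H x).flip e) x :=
  ((ContinuousLinearMap.apply ℝ ℝ e).hasFDerivAt).comp x (hu.hH x)

lemma StableSol.abs_fst_le (hu : StableSol n f C u G H) (x e : EuclideanSpace ℝ (Fin n)) :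
    |G x e| ≤ C * ‖e‖ :=
  (G x).le_of_opNorm_le (hu.bG x) e

lemma StableSol.abs_snd_le (hu : StableSol n f C u G H) (x e : EuclideanSpace ℝ (Fin n))
    (i : Fin n) : |H x e (bv i)| ≤ C * ‖e‖ := by
  have := (H x).le_of_opNorm₂_le_of_le (hu.bH x) (le_refl ‖e‖)
    (show ‖(bv i : EuclideanSpace ℝ (Fin n))‖ ≤ 1 by simp)
  simpa using this

lemma StableSol.symm (hu : StableSol n f C u G H) (x a b : EuclideanSpace ℝ (Fin n)) :
    H x a b = H x b a :=
  second_derivative_symmetric hu.hG (hu.hH x) a b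

lemma StableSol.integral_weak (hf : Bistable f θ) (hu : StableSol n f C u G H)
    {η : EuclideanSpace ℝ (Fin n) → ℝ} (hη : ContDiff ℝ 1 η) (hs : HasCompactSupport η) :
    ∫ x, (∑ i, G x (bv i) * fderiv ℝ η x (bv i) - f (u x) * η x) = 0 := by
  have cη := hη.continuous
  have cdη : Continuous (fderiv ℝ η) := hη.continuous_fderiv one_ne_zero
  have cu := hu.continuous
  have cG := hu.continuous_fst
  have cH := hu.continuous_snd
  have cf := hf.smooth.continuous
  have i1 : ∀ i : Fin n, Integrable fun x => G x (bv i) * fderiv ℝ η x (bv i) := fun i =>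
    integrable_of_eq_zero_of_notMem_tsupport hs (by fun_prop) fun x hx => by
      simp [fderiv_eq_zero_of_notMem_tsupport hx]
  have i2 : Integrable fun x => f (u x) * η x :=
    integrable_of_eq_zero_of_notMem_tsupport hs (by fun_prop) fun x hx => by
      simp [image_eq_zero_of_notMem_tsupport hx]
  have i3 : ∀ i : Fin n, Integrable fun x => H x (bv i) (bv i) * η x := fun i =>
    integrable_of_eq_zero_of_notMem_tsupport hs (by fun_prop) fun x hx => by
      simp [image_eq_zero_of_notMem_tsupport hx]
  have hd : ∀ i x, fderiv ℝ (fun x => G x (bv i)) x (bv i) = H x (bv i) (bv i) := fun i x => by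
    rw [(hu.hasFDerivAt_partial (bv i) x).fderiv]; rfl
  have e1 : ∀ i, ∫ x, G x (bv i) * fderiv ℝ η x (bv i) = - ∫ x, H x (bv i) (bv i) * η x := by
    intro i
    have := integral_mul_fderiv_eq_neg_fderiv_mul_of_integrable (μ := volume)
      (f := fun x => G x (bv i)) (g := η) (v := bv i) (by simpa [hd] using i3 i) (i1 i)
      (integrable_of_eq_zero_of_notMem_tsupport hs (by fun_prop) fun x hx => by
        simp [image_eq_zero_of_notMem_tsupport hx])
      (fun x _ => (hu.hasFDerivAt_partial (bv i) x).differentiableAt)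
      (fun x _ => hη.differentiable one_ne_zero x)
    simpa [hd] using this
  rw [integral_sub (integrable_finsetSum _ fun i _ => i1 i) i2,
    integral_finsetSum _ fun i _ => i1 i]
  simp only [e1]
  rw [Finset.sum_neg_distrib, ← integral_finsetSum _ fun i _ => i3 i, neg_sub_left, neg_eq_zero,
    ← integral_add i2 (integrable_finsetSum _ fun i _ => i3 i)]
  refine integral_eq_zero_of_ae (Eventually.of_forall fun x => ?_)
  have := hu.pde x
  simp only [← Finset.sum_mul, Pi.zero_apply]
  rw [← add_mul, add_comm, this, zero_mul]

/-- Directional derivatives of a solution solve the linearized equation weakly. -/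
lemma StableSol.integral_weak_linearized (hf : Bistable f θ) (hu : StableSol n f C u G H)
    (e : EuclideanSpace ℝ (Fin n)) {η : EuclideanSpace ℝ (Fin n) → ℝ} (hη : ContDiff ℝ 1 η)
    (hs : HasCompactSupport η) :
    ∫ x, (∑ i, H x e (bv i) * fderiv ℝ η x (bv i) - deriv f (u x) * G x e * η x) = 0 := by
  obtain ⟨K, hK0, -, hK, -, -⟩ := hf.exists_bounds
  have hC0 := hu.nonneg
  have cη := hη.continuous
  have cdη : Continuous (fderiv ℝ η) := hη.continuous_fderiv one_ne_zero
  have cu := hu.continuous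
  have cG := hu.continuous_fst
  have cH := hu.continuous_snd
  have cf := hf.smooth.continuous
  have cdf : Continuous (deriv f) := hf.smooth.continuous_deriv le_rfl
  let F : ℝ → EuclideanSpace ℝ (Fin n) → ℝ := fun t x =>
    ∑ i, G (x + t • e) (bv i) * fderiv ℝ η x (bv i) - f (u (x + t • e)) * η x
  let F' : ℝ → EuclideanSpace ℝ (Fin n) → ℝ := fun t x =>
    ∑ i, H (x + t • e) e (bv i) * fderiv ℝ η x (bv i) -
      deriv f (u (x + t • e)) * G (x + t • e) e * η x
  have cF : ∀ t, Continuous (F t) := fun t => by fun_prop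
  have cF' : ∀ t, Continuous (F' t) := fun t => by fun_prop
  let b : EuclideanSpace ℝ (Fin n) → ℝ := fun x =>
    ∑ i, C * ‖e‖ * |fderiv ℝ η x (bv i)| + K * (C * ‖e‖) * |η x|
  have ib : Integrable b := integrable_of_eq_zero_of_notMem_tsupport hs (by fun_prop)
    fun x hx => by
      simp [b, fderiv_eq_zero_of_notMem_tsupport hx, image_eq_zero_of_notMem_tsupport hx]
  have key := (hasDerivAt_integral_of_dominated_loc_of_deriv_le (μ := volume) (F := F) (F' := F')
    (x₀ := 0) (bound := b) (s := univ) univ_mem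
    (Eventually.of_forall fun t => (cF t).aestronglyMeasurable)
    (integrable_of_eq_zero_of_notMem_tsupport hs (cF 0) fun x hx => by
      simp [F, fderiv_eq_zero_of_notMem_tsupport hx, image_eq_zero_of_notMem_tsupport hx])
    (cF' 0).aestronglyMeasurable
    (Eventually.of_forall fun x t _ => ?_) ib (Eventually.of_forall fun x t _ => ?_)).2
  · have hz : ∀ t, ∫ x, F t x = 0 := fun t =>
      (hu.translate (t • e)).integral_weak hf hη hs
    simp only [hz] at key
    have := key.unique (hasDerivAt_const 0 0)
    simpa [F'] using this
  · have hG := hu.abs_fst_le (x + t • e) e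
    have hH := hu.abs_snd_le (x + t • e) e
    have hk := hK _ (hu.range (x + t • e))
    rw [Real.norm_eq_abs]
    refine (abs_sub _ _).trans (add_le_add ((Finset.abs_sum_le_sum_abs _ _).trans
      (Finset.sum_le_sum fun i _ => ?_)) ?_)
    · rw [abs_mul]
      exact mul_le_mul_of_nonneg_right (hH i) (abs_nonneg _)
    · rw [abs_mul, abs_mul]
      gcongr
  · have a1 := HasFDerivAt.hasDerivAt_line hu.hG x e t
    have a2 : ∀ i : Fin n, HasDerivAt (fun t : ℝ => G (x + t • e) (bv i))
        (H (x + t • e) e (bv i)) t := fun i =>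
      HasFDerivAt.hasDerivAt_line (hu.hasFDerivAt_partial (bv i)) x e t
    have a3 := (hf.smooth.differentiable one_ne_zero (u (x + t • e))).hasDerivAt.comp t a1
    exact (HasDerivAt.fun_sum fun i _ => (a2 i).mul_const _).sub (a3.mul_const (η x))

end

lemma tendsto_div_sqrt_sq_add_sq (a : ℝ) {δ : ℕ → ℝ} (hδ : Tendsto δ atTop (𝓝 0)) :
    Tendsto (fun k => a / √(a ^ 2 + δ k ^ 2)) atTop (𝓝 (a / |a|)) := by
  rcases eq_or_ne a 0 with rfl | ha
  · simp
  · have h : Tendsto (fun k => √(a ^ 2 + δ k ^ 2)) atTop (𝓝 (√(a ^ 2 + 0 ^ 2))) :=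
      ((hδ.pow 2).const_add _).sqrt
    have e : √(a ^ 2 + 0 ^ 2) = |a| := by simp [Real.sqrt_sq_eq_abs]
    rw [e] at h
    exact tendsto_const_nhds.div h (abs_ne_zero.2 ha)

lemma tendsto_sqrt_sq_add_sq (a : ℝ) {δ : ℕ → ℝ} (hδ : Tendsto δ atTop (𝓝 0)) :
    Tendsto (fun k => √(a ^ 2 + δ k ^ 2)) atTop (𝓝 |a|) := by
  have h : Tendsto (fun k => √(a ^ 2 + δ k ^ 2)) atTop (𝓝 (√(a ^ 2 + 0 ^ 2))) :=
    ((hδ.pow 2).const_add _).sqrt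
  have e : √(a ^ 2 + 0 ^ 2) = |a| := by simp [Real.sqrt_sq_eq_abs]
  rwa [e] at h

lemma sqrt_sq_add_sq_le_abs_add_one (a : ℝ) {δ : ℝ} (h0 : 0 ≤ δ) (h1 : δ ≤ 1) :
    √(a ^ 2 + δ ^ 2) ≤ |a| + 1 := by
  rw [Real.sqrt_le_left (by positivity)]
  nlinarith [sq_abs a, abs_nonneg a]

lemma abs_div_sqrt_sq_add_sq_le_one (a δ : ℝ) : |a / √(a ^ 2 + δ ^ 2)| ≤ 1 := by
  rw [abs_div, abs_of_nonneg (Real.sqrt_nonneg _)]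
  refine div_le_one_of_le₀ ?_ (Real.sqrt_nonneg _)
  exact Real.abs_le_sqrt (by nlinarith [sq_nonneg δ])

section

variable {n : ℕ} {f : ℝ → ℝ} {θ C : ℝ} {u : EuclideanSpace ℝ (Fin n) → ℝ}
  {G : EuclideanSpace ℝ (Fin n) → EuclideanSpace ℝ (Fin n) →L[ℝ] ℝ}
  {H : EuclideanSpace ℝ (Fin n) → EuclideanSpace ℝ (Fin n) →L[ℝ] EuclideanSpace ℝ (Fin n) →L[ℝ] ℝ}

lemma StableSol.contDiff_partial (hu : StableSol n f C u G H) (e : EuclideanSpace ℝ (Fin n)) :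
    ContDiff ℝ 1 fun x => G x e := by
  have cH := hu.continuous_snd
  rw [contDiff_one_iff_fderiv]
  refine ⟨fun x => (hu.hasFDerivAt_partial e x).differentiableAt, ?_⟩
  have : fderiv ℝ (fun x => G x e) = fun x => (H x).flip e :=
    funext fun x => (hu.hasFDerivAt_partial e x).fderiv
  rw [this]
  have h2 : (fun x => (H x).flip e) = fun x => H x e := by
    funext x
    ext y
    exact hu.symm x y e
  rw [h2]
  fun_prop

lemma StableSol.fderiv_partial (hu : StableSol n f C u G H) (e x y : EuclideanSpace ℝ (Fin n)) :
    fderiv ℝ (fun x => G x e) x y = H x e y := by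
  rw [(hu.hasFDerivAt_partial e x).fderiv]
  exact hu.symm x y e

lemma StableSol.stability_regularized (hu : StableSol n f C u G H)
    (e : EuclideanSpace ℝ (Fin n)) {ξ η : EuclideanSpace ℝ (Fin n) → ℝ} (hξ : ContDiff ℝ 1 ξ)
    (hξs : HasCompactSupport ξ) (hη : ContDiff ℝ 1 η) (hηs : HasCompactSupport η)
    {δ : ℝ} (hδ : 0 < δ) :
    0 ≤ ∫ x, (∑ i, ((G x e / √(G x e ^ 2 + δ ^ 2)) * H x e (bv i) * ξ x +
        √(G x e ^ 2 + δ ^ 2) * fderiv ℝ ξ x (bv i) + fderiv ℝ η x (bv i)) ^ 2 -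
      deriv f (u x) * (√(G x e ^ 2 + δ ^ 2) * ξ x + η x) ^ 2) := by
  have hpos : ∀ x, 0 < G x e ^ 2 + δ ^ 2 := fun x => by positivity
  have hv := hu.contDiff_partial e
  have hsq : ContDiff ℝ 1 fun x => √(G x e ^ 2 + δ ^ 2) :=
    ((hv.pow 2).add contDiff_const).sqrt fun x => (hpos x).ne'
  have hd : ∀ x i, fderiv ℝ (fun x => √(G x e ^ 2 + δ ^ 2) * ξ x + η x) x (bv i) =
      (G x e / √(G x e ^ 2 + δ ^ 2)) * H x e (bv i) * ξ x +
        √(G x e ^ 2 + δ ^ 2) * fderiv ℝ ξ x (bv i) + fderiv ℝ η x (bv i) := by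
    intro x i
    have d1 : HasFDerivAt (fun x => √(G x e ^ 2 + δ ^ 2))
        ((G x e / √(G x e ^ 2 + δ ^ 2)) • fderiv ℝ (fun x => G x e) x) x := by
      have a1 := (hv.differentiable one_ne_zero x).hasFDerivAt
      refine (((a1.pow 2).add_const (δ ^ 2)).sqrt (hpos x).ne').congr_fderiv ?_
      ext y
      have := (Real.sqrt_pos.2 (hpos x)).ne'
      simp
      field_simp
    have d2 := (hξ.differentiable one_ne_zero x).hasFDerivAt
    have d3 := (hη.differentiable one_ne_zero x).hasFDerivAt
    have d4 : fderiv ℝ (fun x => √(G x e ^ 2 + δ ^ 2) * ξ x + η x) x = _ :=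
      ((d1.mul d2).add d3).fderiv
    rw [d4]
    simp only [add_apply, _root_.smul_apply, smul_eq_mul, hu.fderiv_partial]
    ring
  have h := hu.stable (fun x => √(G x e ^ 2 + δ ^ 2) * ξ x + η x) ((hsq.mul hξ).add hη)
    ((hξs.mul_left (f := fun x => √(G x e ^ 2 + δ ^ 2))).add hηs)
  simpa only [hd] using h

/-- The stability inequality tested against `|∂ₑu| ξ + η`. -/
lemma StableSol.stability_abs (hf : Bistable f θ) (hu : StableSol n f C u G H)
    (e : EuclideanSpace ℝ (Fin n)) {ξ η : EuclideanSpace ℝ (Fin n) → ℝ} (hξ : ContDiff ℝ 1 ξ)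
    (hξs : HasCompactSupport ξ) (hη : ContDiff ℝ 1 η) (hηs : HasCompactSupport η) :
    Integrable (fun x => ∑ i, ((G x e / |G x e|) * H x e (bv i) * ξ x +
        |G x e| * fderiv ℝ ξ x (bv i) + fderiv ℝ η x (bv i)) ^ 2 -
      deriv f (u x) * (|G x e| * ξ x + η x) ^ 2) ∧
    0 ≤ ∫ x, (∑ i, ((G x e / |G x e|) * H x e (bv i) * ξ x +
        |G x e| * fderiv ℝ ξ x (bv i) + fderiv ℝ η x (bv i)) ^ 2 -
      deriv f (u x) * (|G x e| * ξ x + η x) ^ 2) := by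
  obtain ⟨K, hK0, -, hK, -, -⟩ := hf.exists_bounds
  have hC0 := hu.nonneg
  have cξ := hξ.continuous
  have cdξ : Continuous (fderiv ℝ ξ) := hξ.continuous_fderiv one_ne_zero
  have cη := hη.continuous
  have cdη : Continuous (fderiv ℝ η) := hη.continuous_fderiv one_ne_zero
  have cu := hu.continuous
  have cG := hu.continuous_fst
  have cH := hu.continuous_snd
  have cdf : Continuous (deriv f) := hf.smooth.continuous_deriv le_rfl
  set M := C * ‖e‖ with hM
  have hM0 : 0 ≤ M := by positivity
  let δ : ℕ → ℝ := fun k => 1 / ((k : ℝ) + 1)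
  have hδ : Tendsto δ atTop (𝓝 0) := tendsto_one_div_add_atTop_nhds_zero_nat
  have hδ0 : ∀ k, 0 < δ k := fun k => by positivity
  have hδ1 : ∀ k, δ k ≤ 1 := fun k => by
    rw [div_le_one (by positivity)]
    linarith [(Nat.cast_nonneg k : (0 : ℝ) ≤ k)]
  let b : EuclideanSpace ℝ (Fin n) → ℝ := fun x =>
    ∑ i, (M * |ξ x| + (M + 1) * |fderiv ℝ ξ x (bv i)| + |fderiv ℝ η x (bv i)|) ^ 2 +
      K * ((M + 1) * |ξ x| + |η x|) ^ 2
  have ib : Integrable b := by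
    have cb : Continuous b := by fun_prop
    refine cb.integrable_of_hasCompactSupport ?_
    refine HasCompactSupport.intro (hξs.isCompact.union hηs.isCompact) fun x hx => ?_
    rw [mem_union, not_or] at hx
    simp [b, fderiv_eq_zero_of_notMem_tsupport hx.1, image_eq_zero_of_notMem_tsupport hx.1,
      fderiv_eq_zero_of_notMem_tsupport hx.2, image_eq_zero_of_notMem_tsupport hx.2]
  let g : ℕ → EuclideanSpace ℝ (Fin n) → ℝ := fun k x =>
    ∑ i, ((G x e / √(G x e ^ 2 + δ k ^ 2)) * H x e (bv i) * ξ x +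
        √(G x e ^ 2 + δ k ^ 2) * fderiv ℝ ξ x (bv i) + fderiv ℝ η x (bv i)) ^ 2 -
      deriv f (u x) * (√(G x e ^ 2 + δ k ^ 2) * ξ x + η x) ^ 2
  suffices h : (∀ k, AEStronglyMeasurable (g k)) ∧ (∀ k x, ‖g k x‖ ≤ b x) ∧
      ∀ x, Tendsto (fun k => g k x) atTop (𝓝 (∑ i, ((G x e / |G x e|) * H x e (bv i) * ξ x +
        |G x e| * fderiv ℝ ξ x (bv i) + fderiv ℝ η x (bv i)) ^ 2 -
      deriv f (u x) * (|G x e| * ξ x + η x) ^ 2)) by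
    obtain ⟨h1, h2, h3⟩ := h
    refine ⟨ib.mono' (aestronglyMeasurable_of_tendsto_ae atTop h1 (Eventually.of_forall h3))
      (Eventually.of_forall fun x => le_of_tendsto' (h3 x).norm fun k => h2 k x), ?_⟩
    exact ge_of_tendsto' (tendsto_integral_of_dominated_convergence b h1 ib
      (fun k => Eventually.of_forall (h2 k)) (Eventually.of_forall h3))
      (fun k => hu.stability_regularized e hξ hξs hη hηs (hδ0 k))
  refine ⟨fun k => ?_, fun k x => ?_, fun x => ?_⟩
  · refine Continuous.aestronglyMeasurable ?_
    have hne : ∀ x, √(G x e ^ 2 + δ k ^ 2) ≠ 0 := fun x =>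
      (Real.sqrt_pos.2 (by have := hδ0 k; positivity)).ne'
    have c1 : Continuous fun x => √(G x e ^ 2 + δ k ^ 2) := by fun_prop
    have c2 : Continuous fun x => G x e / √(G x e ^ 2 + δ k ^ 2) :=
      Continuous.div (by fun_prop) c1 hne
    fun_prop
  · have hv := hu.abs_fst_le x e
    have hk := hK _ (hu.range x)
    have s1 := abs_div_sqrt_sq_add_sq_le_one (G x e) (δ k)
    have s2 : |√(G x e ^ 2 + δ k ^ 2)| ≤ M + 1 := by
      rw [abs_of_nonneg (Real.sqrt_nonneg _)]
      exact (sqrt_sq_add_sq_le_abs_add_one _ (hδ0 k).le (hδ1 k)).trans (by linarith)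
    rw [Real.norm_eq_abs]
    refine (abs_sub _ _).trans (add_le_add ((Finset.abs_sum_le_sum_abs _ _).trans
      (Finset.sum_le_sum fun i _ => ?_)) ?_)
    · rw [abs_pow]
      refine pow_le_pow_left₀ (abs_nonneg _) ?_ 2
      refine (abs_add_three _ _ _).trans ?_
      rw [abs_mul, abs_mul, abs_mul]
      have := mul_le_mul s1 (hu.abs_snd_le x e i) (abs_nonneg _) zero_le_one
      rw [one_mul] at this
      gcongr
    · rw [abs_mul, abs_pow]
      gcongr
      refine (abs_add_le _ _).trans ?_
      rw [abs_mul]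
      gcongr
  · have t1 := tendsto_div_sqrt_sq_add_sq (G x e) hδ
    have t2 := tendsto_sqrt_sq_add_sq (G x e) hδ
    exact (tendsto_finsetSum _ fun i _ => ((((t1.mul_const _).mul_const _).add
      (t2.mul_const _)).add_const _).pow 2).sub ((((t2.mul_const _).add_const _).pow 2).const_mul _)

end

lemma abs_div_abs_le_one (a : ℝ) : |a / (|a|)| ≤ 1 := by
  rw [abs_div, abs_abs]
  exact div_self_le_one _

lemma div_abs_mul_abs (a : ℝ) : a / |a| * |a| = a := by
  rcases eq_or_ne a 0 with rfl | h
  · simp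
  · exact div_mul_cancel₀ _ (abs_ne_zero.2 h)

lemma div_abs_mul_self (a : ℝ) : a / |a| * a = |a| := by
  rcases eq_or_ne a 0 with rfl | h
  · simp
  · rw [div_mul_eq_mul_div, ← sq, ← sq_abs, sq, mul_div_cancel_right₀ _ (abs_ne_zero.2 h)]

lemma nonneg_of_forall_quadratic {B Q : ℝ} (h : ∀ t > 0, 0 ≤ 2 * t * B + t ^ 2 * Q) : 0 ≤ B := by
  by_contra hB
  rw [not_le] at hB
  have h1 : 0 < |Q| + 1 := by positivity
  have ht : 0 < -B / (|Q| + 1) := div_pos (by linarith) h1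
  have h2 := h _ ht
  set t := -B / (|Q| + 1) with htd
  have h3 : t * (|Q| + 1) = -B := div_mul_cancel₀ _ h1.ne'
  have h4 : t * Q ≤ -B := by nlinarith [le_abs_self Q]
  nlinarith

section

variable {f : ℝ → ℝ} {θ C : ℝ} {u : EuclideanSpace ℝ (Fin 2) → ℝ}
  {G : EuclideanSpace ℝ (Fin 2) → EuclideanSpace ℝ (Fin 2) →L[ℝ] ℝ}
  {H : EuclideanSpace ℝ (Fin 2) → EuclideanSpace ℝ (Fin 2) →L[ℝ] EuclideanSpace ℝ (Fin 2) →L[ℝ] ℝ}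

lemma StableSol.integrable_sign (hf : Bistable f θ) (hu : StableSol 2 f C u G H)
    (e : EuclideanSpace ℝ (Fin 2)) {η : EuclideanSpace ℝ (Fin 2) → ℝ} (hη : ContDiff ℝ 1 η)
    (hηs : HasCompactSupport η) :
    Integrable fun x => ∑ i, (G x e / |G x e|) * H x e (bv i) * fderiv ℝ η x (bv i) -
      deriv f (u x) * |G x e| * η x := by
  have cη := hη.continuous
  have cdη : Continuous (fderiv ℝ η) := hη.continuous_fderiv one_ne_zero
  have cu := hu.continuous
  have cG := hu.continuous_fst
  have cH := hu.continuous_snd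
  have cdf : Continuous (deriv f) := hf.smooth.continuous_deriv le_rfl
  refine Integrable.sub (integrable_finsetSum _ fun i _ => ?_) ?_
  · have i1 : Integrable fun x => H x e (bv i) * fderiv ℝ η x (bv i) :=
      integrable_of_eq_zero_of_notMem_tsupport hηs (by fun_prop) fun x hx => by
        simp [fderiv_eq_zero_of_notMem_tsupport hx]
    have m1 : Measurable fun x => G x e / |G x e| := by
      have : Measurable fun x => G x e := Continuous.measurable (by fun_prop)
      exact this.div this.abs
    refine (i1.bdd_mul (c := 1) m1.aestronglyMeasurable
      (Eventually.of_forall fun x => abs_div_abs_le_one _)).congr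
      (Eventually.of_forall fun x => ?_)
    simp only
    ring
  · exact integrable_of_eq_zero_of_notMem_tsupport hηs (by fun_prop) fun x hx => by
      simp [image_eq_zero_of_notMem_tsupport hx]

/-- In the plane, the modulus of a directional derivative of a stable solution is a weak
supersolution of the linearized equation. -/
lemma StableSol.integral_sign_nonneg (hf : Bistable f θ) (hu : StableSol 2 f C u G H)
    (e : EuclideanSpace ℝ (Fin 2)) {η : EuclideanSpace ℝ (Fin 2) → ℝ} (hη : ContDiff ℝ 1 η)
    (hηs : HasCompactSupport η) :
    0 ≤ ∫ x, (∑ i, (G x e / |G x e|) * H x e (bv i) * fderiv ℝ η x (bv i) -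
      deriv f (u x) * |G x e| * η x) := by
  have hC0 := hu.nonneg
  have hd : Continuous (deriv f) := hf.smooth.continuous_deriv le_rfl
  set M := C * ‖e‖ with hM
  have hM0 : 0 ≤ M := by positivity
  have iB := hu.integrable_sign hf e hη hηs
  have iQ := integrable_stability_integrand hd hu.continuous hη hηs
  set B := ∫ x, (∑ i, (G x e / |G x e|) * H x e (bv i) * fderiv ℝ η x (bv i) -
      deriv f (u x) * |G x e| * η x) with hB
  set Q := ∫ x, (∑ i, (fderiv ℝ η x (bv i)) ^ 2 - deriv f (u x) * η x ^ 2) with hQ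
  refine nonneg_of_forall_quadratic (Q := Q) fun t ht => ?_
  refine le_of_forall_pos_le_add fun ε hε => ?_
  obtain ⟨r0, hr0⟩ := hηs.isCompact.isBounded.exists_norm_le
  have hMpos : 0 < M ^ 2 + 1 := by positivity
  obtain ⟨ξ, hξ, hξs, hξ1, hξE⟩ := exists_cutoff_energy_le (r := |r0| + 1) (by positivity)
    (ε := ε / (M ^ 2 + 1)) (by positivity)
  have iE := integrable_sum_fderiv_sq hξ hξs
  have cξ := hξ.continuous
  have cdξ : Continuous (fderiv ℝ ξ) := hξ.continuous_fderiv one_ne_zero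
  have cu := hu.continuous
  have cG := hu.continuous_fst
  have cH := hu.continuous_snd
  have hv := hu.contDiff_partial e
  have hW : ContDiff ℝ 1 fun x => G x e * ξ x ^ 2 := hv.mul (hξ.pow 2)
  have hWs : HasCompactSupport fun x => G x e * ξ x ^ 2 :=
    (hξs.comp_left (g := fun s : ℝ => s ^ 2) (by simp)).mul_left
  have cdW := hW.continuous_fderiv one_ne_zero
  have hlin := hu.integral_weak_linearized hf e hW hWs
  have iL : Integrable fun x => (∑ i, H x e (bv i) *
      fderiv ℝ (fun x => G x e * ξ x ^ 2) x (bv i) - deriv f (u x) * G x e * (G x e * ξ x ^ 2)) :=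
    integrable_of_eq_zero_of_notMem_tsupport hWs (by fun_prop) fun x hx => by
      have : G x e * ξ x ^ 2 = 0 :=
        image_eq_zero_of_notMem_tsupport (f := fun x => G x e * ξ x ^ 2) hx
      rw [fderiv_eq_zero_of_notMem_tsupport hx, this]
      simp
  obtain ⟨iS, hst⟩ := hu.stability_abs hf e hξ hξs (contDiff_const.mul hη : ContDiff ℝ 1 fun x => t * η x)
    (hηs.comp_left (g := fun s => t * s) (by simp))
  have hdW : ∀ x i, fderiv ℝ (fun x => G x e * ξ x ^ 2) x (bv i) =
      H x e (bv i) * ξ x ^ 2 + 2 * G x e * ξ x * fderiv ℝ ξ x (bv i) := by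
    intro x i
    have d1 := (hv.differentiable one_ne_zero x).hasFDerivAt
    have d2 := (hξ.differentiable one_ne_zero x).hasFDerivAt
    have d3 : fderiv ℝ (fun x => G x e * ξ x ^ 2) x = _ := (d1.mul (d2.pow 2)).fderiv
    rw [d3]
    simp only [add_apply, _root_.smul_apply, smul_eq_mul, hu.fderiv_partial]
    simp
    ring
  have hdη : ∀ x i, fderiv ℝ (fun x => t * η x) x (bv i) = t * fderiv ℝ η x (bv i) := by
    intro x i
    rw [((hη.differentiable one_ne_zero x).hasFDerivAt.const_mul t).fderiv]
    simp
  have iR := ((iL.add (iE.const_mul (M ^ 2))).add (iB.const_mul (2 * t))).add (iQ.const_mul (t ^ 2))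
  refine hst.trans ((integral_mono iS iR fun x => ?_).trans ?_)
  · have hq1 : (G x e / |G x e|) ^ 2 ≤ 1 := by
      rw [← sq_abs]
      exact pow_le_one₀ (abs_nonneg _) (abs_div_abs_le_one _)
    have hq2 := div_abs_mul_abs (G x e)
    have hq3 := sq_abs (G x e)
    have hq4 : G x e ^ 2 ≤ M ^ 2 := sq_le_sq' (abs_le.1 (hu.abs_fst_le x e)).1
      (abs_le.1 (hu.abs_fst_le x e)).2
    simp only [Pi.add_apply, hdW, hdη, Fin.sum_univ_two]
    generalize G x e / |G x e| = q at *
    generalize |G x e| = w at *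
    by_cases hx : x ∈ tsupport η
    · have hxr : ‖x‖ < |r0| + 1 := by
        have := hr0 x hx
        linarith [le_abs_self r0]
      have e1 : ξ x = 1 := hξ1 x hxr.le
      have e2 : fderiv ℝ ξ x = 0 := by
        have : ξ =ᶠ[𝓝 x] fun _ => (1 : ℝ) := by
          have ho : IsOpen {y : EuclideanSpace ℝ (Fin 2) | ‖y‖ < |r0| + 1} :=
            isOpen_lt continuous_norm continuous_const
          filter_upwards [ho.mem_nhds hxr] with y hy using hξ1 y (le_of_lt hy)
        rw [this.fderiv_eq]
        simp
      simp only [e1, e2, zero_apply]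
      nlinarith [mul_le_mul_of_nonneg_right hq1 (sq_nonneg (H x e (bv 0))),
        mul_le_mul_of_nonneg_right hq1 (sq_nonneg (H x e (bv 1))), congrArg (deriv f (u x) * ·) hq3]
    · have e1 : η x = 0 := image_eq_zero_of_notMem_tsupport hx
      have e2 := fderiv_eq_zero_of_notMem_tsupport hx
      simp only [e1, e2, zero_apply]
      have b1 : ∀ a c : ℝ, (q * a * ξ x + w * c + t * 0) ^ 2 ≤
          a * (a * ξ x ^ 2 + 2 * G x e * ξ x * c) + M ^ 2 * c ^ 2 := by
        intro a c
        have : (q * a * ξ x + w * c + t * 0) ^ 2 =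
          q ^ 2 * (a * ξ x) ^ 2 + 2 * (q * w) * a * ξ x * c + w ^ 2 * c ^ 2 := by ring
        rw [this, hq2, hq3]
        nlinarith [mul_le_mul_of_nonneg_right hq1 (sq_nonneg (a * ξ x)),
          mul_le_mul_of_nonneg_right hq4 (sq_nonneg c)]
      have b2 : deriv f (u x) * (w * ξ x + t * 0) ^ 2 =
          deriv f (u x) * G x e * (G x e * ξ x ^ 2) := by
        linear_combination deriv f (u x) * ξ x ^ 2 * hq3
      have := b1 (H x e (bv 0)) (fderiv ℝ ξ x (bv 0))
      have := b1 (H x e (bv 1)) (fderiv ℝ ξ x (bv 1))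
      nlinarith
  · have j1 := iE.const_mul (M ^ 2)
    have j2 := iB.const_mul (2 * t)
    have j3 := iQ.const_mul (t ^ 2)
    rw [integral_add' ((iL.add j1).add j2) j3, integral_add' (iL.add j1) j2, integral_add' iL j1,
      integral_const_mul, integral_const_mul, integral_const_mul, hlin]
    have : M ^ 2 * ∫ x, ∑ i, (fderiv ℝ ξ x (bv i)) ^ 2 ≤ ε := by
      refine (mul_le_mul_of_nonneg_left hξE (sq_nonneg M)).trans ?_
      rw [mul_div_assoc', div_le_iff₀ hMpos]
      nlinarith
    linarith

end

lemma exists_antitone_profile : ∃ g : ℝ → ℝ, ContDiff ℝ 2 g ∧ Antitone g ∧ (∀ s, 0 ≤ g s) ∧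
    (∀ s, 1 ≤ s → g s = 0) ∧ 0 < g 0 := by
  refine ⟨fun s => expNegInvGlue (1 - s), ?_, fun a b h => expNegInvGlue.monotone (by linarith),
    fun s => expNegInvGlue.nonneg _, fun s hs => expNegInvGlue.zero_of_nonpos (by linarith),
    expNegInvGlue.pos_of_pos (by norm_num)⟩
  exact expNegInvGlue.contDiff.comp (contDiff_const.sub contDiff_id)

lemma nonneg_of_forall_inv_mul_add {a b : ℝ} (h : ∀ ρ > 0, ρ ≤ 1 → 0 ≤ ρ⁻¹ * a + b) : 0 ≤ a := by
  by_contra ha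
  rw [not_le] at ha
  have h1 : 0 < |b| - a + 1 := by linarith [abs_nonneg b]
  have h2 := h (-a / (|b| - a + 1)) (div_pos (by linarith) h1)
    ((div_le_one h1).2 (by linarith [abs_nonneg b]))
  have h3 : (-a / (|b| - a + 1))⁻¹ * a = -(|b| - a + 1) := by
    have := ha.ne
    field_simp
  rw [h3] at h2
  linarith [le_abs_self b]

section

variable {n : ℕ} {f : ℝ → ℝ} {θ C : ℝ} {u : EuclideanSpace ℝ (Fin n) → ℝ}
  {G : EuclideanSpace ℝ (Fin n) → EuclideanSpace ℝ (Fin n) →L[ℝ] ℝ}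
  {H : EuclideanSpace ℝ (Fin n) → EuclideanSpace ℝ (Fin n) →L[ℝ] EuclideanSpace ℝ (Fin n) →L[ℝ] ℝ}

lemma StableSol.norm_fst_sub_sub_le (hu : StableSol n f C u G H) (x₀ x : EuclideanSpace ℝ (Fin n)) :
    ‖G x - G x₀ - H x₀ (x - x₀)‖ ≤ C * ‖x - x₀‖ * ‖x - x₀‖ := by
  have hC0 := hu.nonneg
  refine (convex_closedBall x₀ ‖x - x₀‖).norm_image_sub_le_of_norm_hasFDerivWithin_le'
    (f' := H) (fun y _ => (hu.hH y).hasFDerivWithinAt) (fun y hy => ?_)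
    (Metric.mem_closedBall_self (norm_nonneg _)) (by simp [dist_eq_norm])
  rw [Metric.mem_closedBall, dist_eq_norm] at hy
  exact (hu.lipH x₀ y).trans (by gcongr)

lemma sum_apply_bv_mul (L : EuclideanSpace ℝ (Fin n) →L[ℝ] ℝ) (y : EuclideanSpace ℝ (Fin n)) :
    ∑ i, L (bv i) * y i = L y := by
  conv_rhs => rw [← (EuclideanSpace.basisFun (Fin n) ℝ).sum_repr y, map_sum]
  refine Finset.sum_congr rfl fun i _ => ?_
  simp [mul_comm]

/-- The derivative of `∂ₑu` in direction `y`, signed by `∂ₑu`, near a zero of `∂ₑu`. -/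
lemma StableSol.le_sign_mul_snd (hu : StableSol n f C u G H) {e x₀ : EuclideanSpace ℝ (Fin n)}
    (h0 : G x₀ e = 0) {ρ : ℝ} (hρ : 0 < ρ) (y : EuclideanSpace ℝ (Fin n)) :
    |H x₀ e y| - 3 * (C * ‖e‖) * ρ * ‖y‖ ^ 2 ≤
      G (x₀ + ρ • y) e / |G (x₀ + ρ • y) e| * H (x₀ + ρ • y) e y := by
  set x := x₀ + ρ • y with hx
  have hxx : x - x₀ = ρ • y := by simp [hx]
  have hn : ‖x - x₀‖ = ρ * ‖y‖ := by rw [hxx, norm_smul, Real.norm_of_nonneg hρ.le]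
  have t1 : |G x e - ρ * H x₀ e y| ≤ C * ‖e‖ * ρ ^ 2 * ‖y‖ ^ 2 := by
    have h := (ContinuousLinearMap.le_opNorm (G x - G x₀ - H x₀ (x - x₀)) e).trans
      (mul_le_mul_of_nonneg_right (hu.norm_fst_sub_sub_le x₀ x) (norm_nonneg e))
    have e1 : (G x - G x₀ - H x₀ (x - x₀)) e = G x e - ρ * H x₀ e y := by
      rw [hxx]
      simp [h0, hu.symm x₀ y e]
    rw [e1, hn, Real.norm_eq_abs] at h
    linarith
  have t2 : |H x e y - H x₀ e y| ≤ C * ‖e‖ * ρ * ‖y‖ ^ 2 := by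
    have h := ((H x - H x₀).le_opNorm₂ e y).trans (mul_le_mul_of_nonneg_right
      (mul_le_mul_of_nonneg_right (hu.lipH x₀ x) (norm_nonneg e)) (norm_nonneg y))
    rw [hn, Real.norm_eq_abs] at h
    have e1 : (H x - H x₀) e y = H x e y - H x₀ e y := rfl
    rw [e1] at h
    linarith
  have q1 := abs_div_abs_le_one (G x e)
  have q2 := div_abs_mul_self (G x e)
  set q := G x e / |G x e|
  have s1 : |q * (H x e y - H x₀ e y)| ≤ C * ‖e‖ * ρ * ‖y‖ ^ 2 := by
    rw [abs_mul]
    exact (mul_le_of_le_one_left (abs_nonneg _) q1).trans t2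
  have s2 : |q * (G x e - ρ * H x₀ e y)| ≤ C * ‖e‖ * ρ ^ 2 * ‖y‖ ^ 2 := by
    rw [abs_mul]
    exact (mul_le_of_le_one_left (abs_nonneg _) q1).trans t1
  have s3 : ρ * |H x₀ e y| - |G x e| ≤ C * ‖e‖ * ρ ^ 2 * ‖y‖ ^ 2 := by
    have := abs_sub_abs_le_abs_sub (ρ * H x₀ e y) (G x e)
    rw [abs_mul, abs_of_pos hρ, abs_sub_comm] at this
    exact this.trans t1
  have a1 := (abs_le.1 s1).1
  have a2 := (abs_le.1 s2).2
  have a3 : ρ * (|H x₀ e y| - 2 * (C * ‖e‖) * ρ * ‖y‖ ^ 2) ≤ ρ * (q * H x₀ e y) := by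
    linarith
  have a4 := le_of_mul_le_mul_left a3 hρ
  linarith

lemma StableSol.abs_fst_le_of_eq_zero (hu : StableSol n f C u G H)
    {e x₀ : EuclideanSpace ℝ (Fin n)} (h0 : G x₀ e = 0) {ρ : ℝ} (hρ : 0 < ρ)
    (y : EuclideanSpace ℝ (Fin n)) : |G (x₀ + ρ • y) e| ≤ C * ‖e‖ * ρ * ‖y‖ := by
  have h := (ContinuousLinearMap.le_opNorm (G (x₀ + ρ • y) - G x₀) e).trans
    (mul_le_mul_of_nonneg_right (norm_sub_le_of_fderiv_bounded hu.hH hu.bH x₀ (x₀ + ρ • y))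
      (norm_nonneg e))
  rw [add_sub_cancel_left, norm_smul, Real.norm_of_nonneg hρ.le, sub_apply, h0, sub_zero,
    Real.norm_eq_abs] at h
  linarith

end
section

variable {f : ℝ → ℝ} {θ C : ℝ} {u : EuclideanSpace ℝ (Fin 2) → ℝ}
  {G : EuclideanSpace ℝ (Fin 2) → EuclideanSpace ℝ (Fin 2) →L[ℝ] ℝ}
  {H : EuclideanSpace ℝ (Fin 2) → EuclideanSpace ℝ (Fin 2) →L[ℝ] EuclideanSpace ℝ (Fin 2) →L[ℝ] ℝ}

/-- In the plane, a directional derivative of a stable solution vanishes only to second order. -/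
lemma StableSol.snd_eq_zero_of_fst_eq_zero (hf : Bistable f θ) (hu : StableSol 2 f C u G H)
    {e x₀ : EuclideanSpace ℝ (Fin 2)} (h0 : G x₀ e = 0) : H x₀ e = 0 := by
  obtain ⟨K, hK0, -, hK, -, -⟩ := hf.exists_bounds
  have hC0 := hu.nonneg
  obtain ⟨g, hg, hga, hgn, hg1, hg0⟩ := exists_antitone_profile
  have cg := hg.continuous
  have cdg : Continuous (deriv g) := hg.continuous_deriv one_le_two
  have hdg : ∀ s, deriv g s ≤ 0 := fun s => hga.deriv_nonpos
  have hdg1 : ∀ s, 1 < s → deriv g s = 0 := fun s hs => by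
    have : g =ᶠ[𝓝 s] fun _ => 0 := by
      filter_upwards [Ioi_mem_nhds hs] with r hr using hg1 r (le_of_lt hr)
    rw [this.deriv_eq, deriv_const]
  have hsq : ∀ y ∉ Metric.closedBall (0 : EuclideanSpace ℝ (Fin 2)) 1, 1 < ‖y‖ ^ 2 := fun y hy => by
    rw [Metric.mem_closedBall, dist_zero_right, not_le] at hy
    nlinarith
  have hcomp : ∀ {F : EuclideanSpace ℝ (Fin 2) → ℝ},
      (∀ y, 1 < ‖y‖ ^ 2 → F y = 0) → HasCompactSupport F := fun hF =>
    HasCompactSupport.intro (isCompact_closedBall 0 1) fun y hy => hF y (hsq y hy)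
  set M := C * ‖e‖ with hM
  have hM0 : 0 ≤ M := by positivity
  let Φ : EuclideanSpace ℝ (Fin 2) → ℝ := fun y => 2 * deriv g (‖y‖ ^ 2) * |H x₀ e y|
  let Ψ : EuclideanSpace ℝ (Fin 2) → ℝ := fun y =>
    -6 * M * (deriv g (‖y‖ ^ 2) * ‖y‖ ^ 2) + K * (M * ‖y‖) * g (‖y‖ ^ 2)
  have cΦ : Continuous Φ := by fun_prop
  have cΨ : Continuous Ψ := by fun_prop
  have sΦ : HasCompactSupport Φ := hcomp fun y hy => by simp [Φ, hdg1 _ hy]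
  have sΨ : HasCompactSupport Ψ := hcomp fun y hy => by simp [Ψ, hdg1 _ hy, hg1 _ hy.le]
  have iΦ : Integrable Φ := cΦ.integrable_of_hasCompactSupport sΦ
  have iΨ : Integrable Ψ := cΨ.integrable_of_hasCompactSupport sΨ
  have hφd : ∀ y, HasFDerivAt (fun y : EuclideanSpace ℝ (Fin 2) => g (‖y‖ ^ 2))
      (deriv g (‖y‖ ^ 2) • (2 • innerSL ℝ y)) y := fun y =>
    ((hg.differentiable two_ne_zero _).hasDerivAt.comp_hasFDerivAt y
      (hasStrictFDerivAt_norm_sq y).hasFDerivAt)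
  have hφ : ContDiff ℝ 1 fun y : EuclideanSpace ℝ (Fin 2) => g (‖y‖ ^ 2) :=
    (hg.of_le one_le_two).comp (contDiff_norm_sq ℝ)
  have hkey : 0 ≤ ∫ y, Φ y := by
    refine nonneg_of_forall_inv_mul_add (b := ∫ y, Ψ y) fun ρ hρ hρ1 => ?_
    have hA : ContDiff ℝ 1 fun x : EuclideanSpace ℝ (Fin 2) => ρ⁻¹ • (x - x₀) := by fun_prop
    have hη := hφ.comp hA
    have hηd : ∀ x i, fderiv ℝ ((fun y => g (‖y‖ ^ 2)) ∘ fun x => ρ⁻¹ • (x - x₀)) x (bv i) =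
        ρ⁻¹ * (2 * deriv g (‖ρ⁻¹ • (x - x₀)‖ ^ 2) * (ρ⁻¹ • (x - x₀)) i) := by
      intro x i
      have d1 : HasFDerivAt (fun x : EuclideanSpace ℝ (Fin 2) => ρ⁻¹ • (x - x₀))
          (ρ⁻¹ • ContinuousLinearMap.id ℝ _) x := ((hasFDerivAt_id x).sub_const x₀).const_smul ρ⁻¹
      rw [((hφd _).comp x d1).fderiv]
      have hi : ∀ y : EuclideanSpace ℝ (Fin 2), inner ℝ y (bv i) = y i := fun y => by
        rw [EuclideanSpace.inner_single_right]
        simp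
      simp only [ContinuousLinearMap.comp_apply, _root_.smul_apply, innerSL_apply_apply, hi,
        ContinuousLinearMap.id_apply, inner_smul_right, smul_eq_mul, nsmul_eq_mul]
      push_cast
      ring
    have hηs : HasCompactSupport ((fun y : EuclideanSpace ℝ (Fin 2) => g (‖y‖ ^ 2)) ∘
        fun x => ρ⁻¹ • (x - x₀)) := by
      refine HasCompactSupport.intro (isCompact_closedBall x₀ ρ) fun x hx => ?_
      rw [Metric.mem_closedBall, dist_eq_norm, not_le] at hx
      refine hg1 _ ?_
      rw [norm_smul, norm_inv, Real.norm_of_nonneg hρ.le, one_le_sq_iff₀ (by positivity),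
        inv_mul_eq_div, one_le_div hρ]
      exact hx.le
    have hB := hu.integral_sign_nonneg hf e hη hηs
    have iB := hu.integrable_sign hf e hη hηs
    have iF : Integrable fun y => ρ⁻¹ * Φ y + Ψ y := (iΦ.const_mul _).add iΨ
    have iF' : Integrable fun x => ρ⁻¹ * Φ (ρ⁻¹ • (x - x₀)) + Ψ (ρ⁻¹ • (x - x₀)) :=
      (iF.comp_smul (inv_ne_zero hρ.ne')).comp_sub_right x₀
    have hle := hB.trans (integral_mono iB iF' fun x => by
      have hxy : x₀ + ρ • (ρ⁻¹ • (x - x₀)) = x := by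
        rw [smul_inv_smul₀ hρ.ne']
        abel
      set y := ρ⁻¹ • (x - x₀) with hy
      have b1 := hu.le_sign_mul_snd h0 hρ y
      have b2 := hu.abs_fst_le_of_eq_zero h0 hρ y
      rw [hxy] at b1 b2
      simp only [hηd, ← hy, Function.comp_apply]
      have e1 : ∑ i, G x e / |G x e| * H x e (bv i) * (ρ⁻¹ * (2 * deriv g (‖y‖ ^ 2) * y i)) =
          ρ⁻¹ * (2 * deriv g (‖y‖ ^ 2)) * (G x e / |G x e| * H x e y) := by
        rw [← sum_apply_bv_mul (H x e) y, Finset.mul_sum, Finset.mul_sum]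
        refine Finset.sum_congr rfl fun i _ => ?_
        ring
      rw [e1]
      have c1 : ρ⁻¹ * (2 * deriv g (‖y‖ ^ 2)) ≤ 0 :=
        mul_nonpos_of_nonneg_of_nonpos (by positivity) (by linarith [hdg (‖y‖ ^ 2)])
      have c2 := mul_le_mul_of_nonpos_left b1 c1
      have c3 : ρ⁻¹ * (2 * deriv g (‖y‖ ^ 2)) * (|H x₀ e y| - 3 * (C * ‖e‖) * ρ * ‖y‖ ^ 2) =
          ρ⁻¹ * Φ y - 6 * M * (deriv g (‖y‖ ^ 2) * ‖y‖ ^ 2) := by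
        simp only [Φ, hM]
        field_simp
        ring
      have c4 : -(deriv f (u x) * |G x e|) ≤ K * (M * ‖y‖) := by
        have b3 : |G x e| ≤ M * ‖y‖ := b2.trans (by
          have := mul_le_mul_of_nonneg_left hρ1 (mul_nonneg hM0 (norm_nonneg y))
          linarith)
        have b4 := mul_le_mul (hK _ (hu.range x)) b3 (abs_nonneg _) hK0
        have b5 := neg_abs_le (deriv f (u x))
        nlinarith [abs_nonneg (G x e)]
      have c5 := mul_le_mul_of_nonneg_right c4 (hgn (‖y‖ ^ 2))
      simp only [Ψ]
      linarith)
    rw [integral_sub_right_eq_self (fun x => ρ⁻¹ * Φ (ρ⁻¹ • x) + Ψ (ρ⁻¹ • x)) x₀,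
      Measure.integral_comp_smul volume (fun y => ρ⁻¹ * Φ y + Ψ y) ρ⁻¹, smul_eq_mul] at hle
    have hpos : 0 < |(ρ⁻¹ ^ Module.finrank ℝ (EuclideanSpace ℝ (Fin 2)))⁻¹| := by positivity
    have := nonneg_of_mul_nonneg_right hle hpos
    rwa [integral_add (iΦ.const_mul _) iΨ, integral_const_mul] at this
  have hzero : ∀ y, Φ y = 0 := by
    by_contra! hne
    obtain ⟨y, hy⟩ := hne
    have := cΦ.neg.integral_pos_of_hasCompactSupport_nonneg_nonzero (μ := volume) sΦ.neg
      (fun y => neg_nonneg.2 (mul_nonpos_of_nonpos_of_nonneg (by linarith [hdg (‖y‖ ^ 2)])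
        (abs_nonneg _))) (x := y) (neg_ne_zero.2 hy)
    rw [integral_neg'] at this
    linarith
  obtain ⟨s, hs, hds⟩ := exists_deriv_eq_slope g zero_lt_one cg.continuousOn
    (hg.differentiable two_ne_zero).differentiableOn
  have hds' : deriv g s ≠ 0 := by
    rw [hds, hg1 1 le_rfl]
    norm_num
    exact hg0.ne'
  have hb : ∀ i, H x₀ e (bv i) = 0 := fun i => by
    have h := hzero (√s • bv i)
    have hn : ‖√s • (bv i : EuclideanSpace ℝ (Fin 2))‖ ^ 2 = s := by
      rw [norm_smul, mul_pow, Real.norm_eq_abs, sq_abs, Real.sq_sqrt hs.1.le]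
      simp
    simp only [Φ, hn, map_smul, smul_eq_mul] at h
    have hs0 := (Real.sqrt_pos.2 hs.1).ne'
    simpa [hds', hs0] using h
  ext y
  rw [← sum_apply_bv_mul (H x₀ e) y]
  simp [hb]

end

lemma Bistable.eq_zero_or_eq_of_apply_eq_zero {f : ℝ → ℝ} {θ : ℝ} (hf : Bistable f θ) {a : ℝ}
    (ha : a ∈ Icc (0 : ℝ) 1) (h : f a = 0) : a = 0 ∨ a = θ ∨ a = 1 := by
  by_contra! hne
  rcases lt_or_gt_of_ne hne.2.1 with h1 | h1
  · exact (hf.neg a ⟨lt_of_le_of_ne ha.1 hne.1.symm, h1⟩).ne h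
  · exact (hf.pos a ⟨h1, lt_of_le_of_ne ha.2 hne.2.2⟩).ne' h

lemma abs_integral_sub_integral_le {f : ℝ → ℝ} (hc : Continuous f) {K a s : ℝ} (hK : 0 ≤ K)
    (ha : a ∈ Icc (0 : ℝ) 1) (hs : s ∈ Icc (0 : ℝ) 1) (h0 : f a = 0)
    (hL : ∀ s ∈ Icc (0 : ℝ) 1, ∀ t ∈ Icc (0 : ℝ) 1, |f s - f t| ≤ K * |s - t|) :
    (∫ r in (0 : ℝ)..a, f r) - ∫ r in (0 : ℝ)..s, f r ≤ K * (s - a) ^ 2 := by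
  rw [intervalIntegral.integral_interval_sub_left (hc.intervalIntegrable _ _)
    (hc.intervalIntegrable _ _)]
  have h : ∀ r ∈ uIoc s a, ‖f r‖ ≤ K * |s - a| := fun r hr => by
    have hr' := uIoc_subset_uIcc hr
    have h1 := hL r (uIcc_subset_Icc hs ha hr') a ha
    rw [h0, sub_zero] at h1
    refine h1.trans (mul_le_mul_of_nonneg_left ?_ hK)
    rw [abs_sub_comm s a]
    have := abs_sub_right_of_mem_uIcc hr'
    rwa [abs_sub_comm a r] at this
  have := (le_abs_self _).trans (intervalIntegral.norm_integral_le_of_norm_le_const h)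
  rwa [abs_sub_comm a s, mul_assoc, ← sq, sq_abs] at this

section

variable {f : ℝ → ℝ} {θ C : ℝ} {u : EuclideanSpace ℝ (Fin 2) → ℝ}
  {G : EuclideanSpace ℝ (Fin 2) → EuclideanSpace ℝ (Fin 2) →L[ℝ] ℝ}
  {H : EuclideanSpace ℝ (Fin 2) → EuclideanSpace ℝ (Fin 2) →L[ℝ] EuclideanSpace ℝ (Fin 2) →L[ℝ] ℝ}

/-- The energy `|∇u|² + 2 F(u)`, where `F` is the primitive of `f` vanishing at `0`. -/
def planarEnergy (f : ℝ → ℝ) (u : EuclideanSpace ℝ (Fin 2) → ℝ)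
    (G : EuclideanSpace ℝ (Fin 2) → EuclideanSpace ℝ (Fin 2) →L[ℝ] ℝ)
    (x : EuclideanSpace ℝ (Fin 2)) : ℝ :=
  G x (bv 0) ^ 2 + G x (bv 1) ^ 2 + 2 * ∫ s in (0 : ℝ)..u x, f s

lemma StableSol.planarEnergy_eq (hf : Bistable f θ) (hu : StableSol 2 f C u G H)
    (x y : EuclideanSpace ℝ (Fin 2)) : planarEnergy f u G x = planarEnergy f u G y := by
  have hd : ∀ x, HasFDerivAt (planarEnergy f u G) 0 x := fun x => by
    have d0 := (hu.hasFDerivAt_partial (bv 0) x).pow 2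
    have d1 := (hu.hasFDerivAt_partial (bv 1) x).pow 2
    have d2 := ((hf.smooth.continuous.integral_hasStrictDerivAt 0
      (u x)).hasDerivAt.comp_hasFDerivAt x (hu.hG x)).const_mul 2
    refine ((d0.add d1).add d2).congr_fderiv ?_
    have hz : H x (-(G x (bv 1)) • bv 0 + G x (bv 0) • bv 1) = 0 := by
      refine hu.snd_eq_zero_of_fst_eq_zero hf ?_
      simp only [map_add, map_smul, smul_eq_mul]
      ring
    have e0 := congrArg (fun L : EuclideanSpace ℝ (Fin 2) →L[ℝ] ℝ => L (bv 0)) hz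
    have e1 := congrArg (fun L : EuclideanSpace ℝ (Fin 2) →L[ℝ] ℝ => L (bv 1)) hz
    have hp := hu.pde x
    simp only [map_add, map_smul, add_apply, _root_.smul_apply, smul_eq_mul, zero_apply,
      hu.symm x (bv 1) (bv 0)] at e0 e1
    rw [Fin.sum_univ_two] at hp
    ext y
    have hH : ∀ a, H x y a = H x a (bv 0) * y 0 + H x a (bv 1) * y 1 := fun a => by
      rw [hu.symm x y a, ← sum_apply_bv_mul (H x a) y, Fin.sum_univ_two]
    have hG : G x y = G x (bv 0) * y 0 + G x (bv 1) * y 1 := by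
      rw [← sum_apply_bv_mul (G x) y, Fin.sum_univ_two]
    simp only [add_apply, _root_.smul_apply, smul_eq_mul, zero_apply,
      ContinuousLinearMap.flip_apply, hH, hG, hu.symm x (bv 1) (bv 0), nsmul_eq_mul]
    push_cast
    linear_combination (2 * G x (bv 0) * y 0 + 2 * G x (bv 1) * y 1) * hp +
      2 * y 1 * e0 - 2 * y 0 * e1
  exact is_const_of_fderiv_eq_zero (fun x => (hd x).differentiableAt) (fun x => (hd x).fderiv) x y

lemma StableSol.eq_of_fst_eq_zero (hf : Bistable f θ) (hu : StableSol 2 f C u G H)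
    {x₀ : EuclideanSpace ℝ (Fin 2)} (h0 : G x₀ = 0) : f (u x₀) = 0 ∧ ∀ x, u x = u x₀ := by
  obtain ⟨K, hK0, -, -, hL, -⟩ := hf.exists_bounds
  have hfa : f (u x₀) = 0 := by
    have hp := hu.pde x₀
    have hz : ∀ e, H x₀ e = 0 := fun e => hu.snd_eq_zero_of_fst_eq_zero hf (by simp [h0])
    simpa [hz] using hp
  refine ⟨hfa, fun x => ?_⟩
  set a := u x₀ with ha
  have hbound : ∀ x y, |G x y| ≤ √(2 * K) * ‖y‖ * |u x - a| := fun x y => by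
    have h1 := hu.planarEnergy_eq hf x x₀
    have h2 := abs_integral_sub_integral_le hf.smooth.continuous hK0 (hu.range x₀) (hu.range x)
      hfa hL
    simp only [planarEnergy, h0, zero_apply] at h1
    have h3 : G x (bv 0) ^ 2 + G x (bv 1) ^ 2 ≤ 2 * K * (u x - a) ^ 2 := by linarith
    have hG : G x y = G x (bv 0) * y 0 + G x (bv 1) * y 1 := by
      rw [← sum_apply_bv_mul (G x) y, Fin.sum_univ_two]
    have hy : ‖y‖ ^ 2 = y 0 ^ 2 + y 1 ^ 2 := by
      rw [EuclideanSpace.real_norm_sq_eq, Fin.sum_univ_two]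
    refine abs_le_of_sq_le_sq ?_ (by positivity)
    rw [mul_pow, mul_pow, Real.sq_sqrt (by positivity), sq_abs, hy, hG]
    nlinarith [mul_le_mul_of_nonneg_right h3 (add_nonneg (sq_nonneg (y 0)) (sq_nonneg (y 1))),
      sq_nonneg (G x (bv 0) * y 1 - G x (bv 1) * y 0)]
  have hline := fun t => (HasFDerivAt.hasDerivAt_line hu.hG x₀ (x - x₀) t).sub_const a
  have h := eq_zero_of_abs_deriv_le_mul_abs_self_of_eq_zero_right (a := 0) (b := 1)
    (K := √(2 * K) * ‖x - x₀‖) (fun t _ => (hline t).continuousAt.continuousWithinAt)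
    (fun t _ => (hline t).hasDerivWithinAt) (by simp [ha]) (fun t _ => hbound _ _)
    1 (right_mem_Icc.2 zero_le_one)
  simpa [sub_eq_zero] using h

lemma measureReal_closedBall_le_integral_sq {ξ : EuclideanSpace ℝ (Fin 2) → ℝ}
    (hi : Integrable fun x => ξ x ^ 2) (h1 : ∀ x, ‖x‖ ≤ 1 → ξ x = 1) :
    volume.real (Metric.closedBall (0 : EuclideanSpace ℝ (Fin 2)) 1) ≤ ∫ x, ξ x ^ 2 := by
  have h : ∫ x in Metric.closedBall (0 : EuclideanSpace ℝ (Fin 2)) 1, ξ x ^ 2 =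
      ∫ x in Metric.closedBall (0 : EuclideanSpace ℝ (Fin 2)) 1, (1 : ℝ) :=
    setIntegral_congr_fun Metric.isClosed_closedBall.measurableSet fun x hx => by
      rw [h1 x (by simpa using hx), one_pow]
  rw [setIntegral_const, smul_eq_mul, mul_one] at h
  rw [← h]
  exact setIntegral_le_integral hi (Eventually.of_forall fun x => sq_nonneg _)

lemma StableSol.not_forall_eq (hf : Bistable f θ) (hu : StableSol 2 f C u G H) :
    ¬ ∀ x, u x = θ := by
  intro h
  obtain ⟨V, hV⟩ : ∃ V, V = volume.real (Metric.closedBall (0 : EuclideanSpace ℝ (Fin 2)) 1) :=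
    ⟨_, rfl⟩
  have hV0 : 0 < V := by
    rw [hV]
    exact ENNReal.toReal_pos (Metric.measure_closedBall_pos _ _ one_pos).ne'
      measure_closedBall_lt_top.ne
  have hθ := hf.dθ
  have hθV := mul_pos hθ hV0
  obtain ⟨ξ, hξ, hξs, hξ1, hξE⟩ := exists_cutoff_energy_le one_pos (half_pos hθV)
  have i1 := integrable_sum_fderiv_sq hξ hξs
  have c2 : Continuous fun x => ξ x ^ 2 := hξ.continuous.pow 2
  have s2 : HasCompactSupport fun x => ξ x ^ 2 :=
    hξs.comp_left (g := fun s : ℝ => s ^ 2) (by simp)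
  have i2 := c2.integrable_of_hasCompactSupport (μ := volume) s2
  have hst := hu.stable ξ hξ hξs
  simp only [h] at hst
  rw [integral_sub i1 (i2.const_mul _), integral_const_mul] at hst
  have := mul_le_mul_of_nonneg_left (measureReal_closedBall_le_integral_sq i2 hξ1) hθ.le
  rw [← hV] at this
  linarith

lemma StableSol.eq_const_of_fst_eq_zero (hf : Bistable f θ) (hu : StableSol 2 f C u G H)
    {x₀ : EuclideanSpace ℝ (Fin 2)} (h0 : G x₀ = 0) : u x₀ = 0 ∨ u x₀ = 1 := by
  obtain ⟨h1, h2⟩ := hu.eq_of_fst_eq_zero hf h0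
  rcases hf.eq_zero_or_eq_of_apply_eq_zero (hu.range x₀) h1 with h | h | h
  · exact Or.inl h
  · exact absurd (fun x => (h2 x).trans h) (hu.not_forall_eq hf)
  · exact Or.inr h

/-- The extremal values of a planar stable solution. -/
lemma StableSol.extremal_value (hf : Bistable f θ) (hu : StableSol 2 f C u G H) {a : ℝ}
    (hext : (∀ x, u x ≤ a) ∨ ∀ x, a ≤ u x) {z : ℕ → EuclideanSpace ℝ (Fin 2)}
    (hz : Tendsto (fun k => u (z k)) atTop (𝓝 a)) :
    (a = 0 ∨ a = 1) ∧ planarEnergy f u G 0 = 2 * ∫ s in (0 : ℝ)..a, f s := by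
  let 𝓕 : Ultrafilter ℕ := hyperfilter ℕ
  have h𝓕 : (𝓕 : Filter ℕ) ≤ atTop := Nat.hyperfilter_le_atTop
  obtain ⟨u', G', H', hu', hlu, hlG⟩ := StableSol.exists_limit hf 𝓕 fun k => hu.translate (z k)
  have hz' := hz.mono_left h𝓕
  have h0 : u' 0 = a := tendsto_nhds_unique (hlu 0) (by simpa using hz')
  have hcrit : G' 0 = 0 := by
    rcases hext with h | h
    · have hm : IsLocalMax u' 0 := Eventually.of_forall fun x => by
        rw [h0]
        exact le_of_tendsto' (hlu x) fun k => h _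
      exact hm.hasFDerivAt_eq_zero (hu'.hG 0)
    · have hm : IsLocalMin u' 0 := Eventually.of_forall fun x => by
        rw [h0]
        exact ge_of_tendsto' (hlu x) fun k => h _
      exact hm.hasFDerivAt_eq_zero (hu'.hG 0)
  refine ⟨h0 ▸ hu'.eq_const_of_fst_eq_zero hf hcrit, ?_⟩
  have hF := ((hf.smooth.continuous.integral_hasStrictDerivAt 0
    a).hasDerivAt.continuousAt.tendsto.comp hz').const_mul 2
  have hGz : ∀ i, Tendsto (fun k => G (z k) (bv i) ^ 2) 𝓕 (𝓝 0) := fun i => by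
    have h1 := hlG 0
    simp only [zero_add, hcrit] at h1
    have h2 := (((ContinuousLinearMap.apply ℝ ℝ (bv i : EuclideanSpace ℝ (Fin 2))).continuous.tendsto
      0).comp h1).pow 2
    simpa using h2
  have hlim := ((hGz 0).add (hGz 1)).add hF
  have hconst : Tendsto (fun k => planarEnergy f u G (z k)) 𝓕 (𝓝 (planarEnergy f u G 0)) := by
    simp only [hu.planarEnergy_eq hf _ 0]
    exact tendsto_const_nhds
  have := tendsto_nhds_unique hconst hlim
  simpa using this

/-- A planar stable solution with values in `[0,1]` is one of the two stable constants. -/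
theorem StableSol.eq_zero_or_eq_one (hf : Bistable f θ) (hu : StableSol 2 f C u G H) :
    (∀ x, u x = 0) ∨ ∀ x, u x = 1 := by
  have hne : (Set.range u).Nonempty := range_nonempty u
  have hba : BddAbove (Set.range u) := ⟨1, by rintro _ ⟨x, rfl⟩; exact (hu.range x).2⟩
  have hbb : BddBelow (Set.range u) := ⟨0, by rintro _ ⟨x, rfl⟩; exact (hu.range x).1⟩
  obtain ⟨s, -, hs, hs'⟩ := exists_seq_tendsto_sSup hne hba
  obtain ⟨m, -, hm, hm'⟩ := exists_seq_tendsto_sInf hne hbb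
  choose z hz using hs'
  choose w hw using hm'
  have hle : ∀ x, u x ≤ sSup (Set.range u) := fun x => le_csSup hba ⟨x, rfl⟩
  have hge : ∀ x, sInf (Set.range u) ≤ u x := fun x => csInf_le hbb ⟨x, rfl⟩
  obtain ⟨h1, h2⟩ := hu.extremal_value hf (Or.inl hle) (z := z) (by simpa only [hz] using hs)
  obtain ⟨h3, h4⟩ := hu.extremal_value hf (Or.inr hge) (z := w) (by simpa only [hw] using hm)
  have hmass := hf.mass
  have h5 := h2.symm.trans h4
  rcases h1 with h1 | h1 <;> rcases h3 with h3 | h3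
  · exact Or.inl fun x => le_antisymm (h1 ▸ hle x) (h3 ▸ hge x)
  · rw [h1, h3, intervalIntegral.integral_same] at h5
    linarith
  · rw [h1, h3, intervalIntegral.integral_same] at h5
    linarith
  · exact Or.inr fun x => le_antisymm (h1 ▸ hle x) (h3 ▸ hge x)

end

section

variable {m : ℕ}

/-- The point of the half-plane spanned by the first two coordinate axes. -/
abbrev planePoint (m : ℕ) (z r : ℝ) : Euc (m + 1) := z • bv 0 + r • bv 1

lemma primeNorm_nonneg {d : ℕ} (x : Euc d) : 0 ≤ primeNorm x := Real.sqrt_nonneg _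

lemma primeNorm_sq {d : ℕ} (x : Euc d) :
    primeNorm x ^ 2 = ∑ i, if i = 0 then 0 else (x i) ^ 2 :=
  Real.sq_sqrt (Finset.sum_nonneg fun i _ => by split_ifs <;> positivity)

lemma abs_apply_le_primeNorm {d : ℕ} (x : Euc d) {i : Fin (d + 1)} (hi : i ≠ 0) :
    |x i| ≤ primeNorm x := by
  refine Real.abs_le_sqrt ?_
  have := Finset.single_le_sum (f := fun i => if i = 0 then 0 else (x i) ^ 2)
    (fun i _ => by dsimp only; split_ifs <;> positivity) (Finset.mem_univ i)
  simpa [hi] using this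

lemma primeNorm_add_smul_sq {d : ℕ} (x : Euc d) (t : ℝ) {i : Fin (d + 1)} (hi : i ≠ 0) :
    primeNorm (x + t • bv i) ^ 2 = primeNorm x ^ 2 + (2 * t * x i + t ^ 2) := by
  have h : ∀ j, (if j = 0 then 0 else ((x + t • bv i : Euc d) j) ^ 2) =
      (if j = 0 then 0 else (x j) ^ 2) + if j = i then 2 * t * x i + t ^ 2 else 0 := by
    intro j
    by_cases hj : j = i
    · subst hj
      simp [hi]
      ring
    · by_cases h0 : j = 0 <;> simp [hj, h0, Ne.symm hi]
  rw [primeNorm_sq, primeNorm_sq, Finset.sum_congr rfl fun j _ => h j, Finset.sum_add_distrib]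
  simp

lemma planePoint_zero (z r : ℝ) : planePoint m z r 0 = z := by simp

lemma primeNorm_planePoint (z : ℝ) {r : ℝ} (hr : 0 ≤ r) : primeNorm (planePoint m z r) = r := by
  have h0 : primeNorm (z • bv 0 : Euc (m + 1)) ^ 2 = 0 := by
    rw [primeNorm_sq]
    refine Finset.sum_eq_zero fun i _ => ?_
    by_cases hi : i = 0 <;> simp [hi]
  have h := primeNorm_add_smul_sq (z • bv 0 : Euc (m + 1)) r (i := 1) (by simp)
  have h1 : (z • bv 0 : Euc (m + 1)) 1 = 0 := by simp
  rw [h0, h1] at h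
  refine (pow_left_inj₀ (primeNorm_nonneg _) hr two_ne_zero).1 ?_
  rw [h]
  ring

lemma abs_primeNorm_add_smul_sub_le {d : ℕ} (x : Euc d) (t : ℝ) {i : Fin (d + 1)} (hi : i ≠ 0)
    (hx : 0 < primeNorm x) :
    |primeNorm (x + t • bv i) - primeNorm x| ≤ |2 * t * x i + t ^ 2| / primeNorm x := by
  rw [le_div_iff₀ hx]
  have h := primeNorm_add_smul_sq x t hi
  have h' : 2 * t * x i + t ^ 2 =
      (primeNorm (x + t • bv i) - primeNorm x) * (primeNorm (x + t • bv i) + primeNorm x) := by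
    linear_combination -h
  have h0 := primeNorm_nonneg (x + t • bv i)
  rw [h', abs_mul, abs_of_nonneg (by linarith : 0 ≤ primeNorm (x + t • bv i) + primeNorm x)]
  exact mul_le_mul_of_nonneg_left (by linarith) (abs_nonneg _)

variable {f : ℝ → ℝ} {θ C : ℝ} {U : Euc (m + 1) → ℝ} {G H}

lemma eq_planePoint (haxi : ∀ x y : Euc (m + 1), x 0 = y 0 → primeNorm x = primeNorm y → U x = U y)
    (x : Euc (m + 1)) : U x = U (planePoint m (x 0) (primeNorm x)) :=
  haxi _ _ (planePoint_zero _ _).symm (primeNorm_planePoint _ (primeNorm_nonneg x)).symm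

lemma StableSol.abs_sub_le_of_axisymmetric (hu : StableSol (m + 2) f C U G H)
    (haxi : ∀ x y : Euc (m + 1), x 0 = y 0 → primeNorm x = primeNorm y → U x = U y)
    {x y : Euc (m + 1)} (h : x 0 = y 0) : |U x - U y| ≤ C * |primeNorm x - primeNorm y| := by
  rw [eq_planePoint haxi x, eq_planePoint haxi y, h]
  have := norm_sub_le_of_fderiv_bounded hu.hG hu.bG (planePoint m (y 0) (primeNorm y))
    (planePoint m (y 0) (primeNorm x))
  rwa [Real.norm_eq_abs, add_sub_add_left_eq_sub, ← sub_smul, norm_smul, Real.norm_eq_abs,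
    PiLp.norm_single, norm_one, mul_one] at this

/-- Far from the axis, an axisymmetric stable solution is close to one of the two stable zeros. -/
lemma StableSol.exists_radius (hf : Bistable f θ) (hu : StableSol (m + 2) f C U G H)
    (haxi : ∀ x y : Euc (m + 1), x 0 = y 0 → primeNorm x = primeNorm y → U x = U y)
    {ε : ℝ} (hε : 0 < ε) : ∃ A : ℝ, ∀ x, A ≤ primeNorm x → U x < ε ∨ 1 - ε < U x := by
  by_contra! hcon
  choose y hy hy1 hy2 using fun k : ℕ => hcon k
  let a : ℕ → Euc (m + 1) := fun k => planePoint m (y k 0) (primeNorm (y k))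
  have hUa : ∀ k, U (a k) = U (y k) := fun k => (eq_planePoint haxi (y k)).symm
  have hC0 := hu.nonneg
  let 𝓕 : Ultrafilter ℕ := hyperfilter ℕ
  have h𝓕 : (𝓕 : Filter ℕ) ≤ atTop := Nat.hyperfilter_le_atTop
  obtain ⟨W, G', H', hW, hlim, -⟩ := StableSol.exists_limit hf 𝓕 fun k => hu.translate (a k)
  have hinv : ∀ i : Fin (m + 2), 2 ≤ i.val → ∀ (t : ℝ) X, W (X + t • bv i) = W X := by
    intro i hi t X
    have hi0 : i ≠ 0 := fun h => by simp [h] at hi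
    have hi1 : i ≠ 1 := fun h => by simp [h] at hi
    have hai : ∀ k, (X + a k) i = X i := fun k => by simp [a, hi0, hi1]
    have ha1 : ∀ k : ℕ, (k : ℝ) - |X 1| ≤ primeNorm (X + a k) := fun k => by
      refine le_trans ?_ (abs_apply_le_primeNorm (X + a k) (i := 1) (by simp))
      have e1 : (X + a k) 1 = X 1 + primeNorm (y k) := by simp [a]
      rw [e1]
      linarith [hy k, neg_abs_le (X 1), le_abs_self (X 1 + primeNorm (y k))]
    have hk : Tendsto (fun k : ℕ => (k : ℝ) - |X 1|) atTop atTop :=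
      tendsto_atTop_add_const_right _ _ tendsto_natCast_atTop_atTop
    have hz : Tendsto (fun k : ℕ => C * (|2 * t * X i + t ^ 2| / ((k : ℝ) - |X 1|))) atTop (𝓝 0) := by
      simpa using (hk.const_div_atTop _).const_mul C
    have hd : Tendsto (fun k => U (X + t • bv i + a k) - U (X + a k)) atTop (𝓝 0) := by
      refine squeeze_zero_norm' ?_ hz
      filter_upwards [hk.eventually_gt_atTop 0] with k hpos
      have e1 : X + t • bv i + a k = X + a k + t • bv i := by abel
      rw [e1, Real.norm_eq_abs]
      have e2 : (X + a k + t • bv i : Euc (m + 1)) 0 = (X + a k) 0 := by simp [Ne.symm hi0]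
      refine (hu.abs_sub_le_of_axisymmetric haxi e2).trans (mul_le_mul_of_nonneg_left ?_ hC0)
      refine (abs_primeNorm_add_smul_sub_le _ t hi0 (hpos.trans_le (ha1 k))).trans ?_
      rw [hai]
      exact div_le_div_of_nonneg_left (abs_nonneg _) hpos (ha1 k)
    have := tendsto_nhds_unique ((hlim (X + t • bv i)).sub (hlim X)) (hd.mono_left h𝓕)
    linarith
  obtain ⟨w, G'', H'', hw, hw0⟩ := StableSol.exists_planar hf hW hinv
  have h0 := hlim 0
  simp only [zero_add, hUa] at h0
  have b1 : ε ≤ W 0 := ge_of_tendsto' h0 hy1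
  have b2 : W 0 ≤ 1 - ε := le_of_tendsto' h0 hy2
  rcases hw.eq_zero_or_eq_one hf with h | h
  · linarith [h 0]
  · linarith [h 0]

/-- The alternative of `StableSol.exists_radius` does not depend on the point. -/
lemma StableSol.exists_radius_forall (hf : Bistable f θ) (hu : StableSol (m + 2) f C U G H)
    (haxi : ∀ x y : Euc (m + 1), x 0 = y 0 → primeNorm x = primeNorm y → U x = U y) :
    ∃ A : ℝ, (∀ x, A ≤ primeNorm x → U x < 1 / 4) ∨ ∀ x, A ≤ primeNorm x → 3 / 4 < U x := by
  obtain ⟨A, hA⟩ := hu.exists_radius hf haxi (ε := 1 / 4) (by norm_num)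
  refine ⟨max A 0, ?_⟩
  by_contra! hcon
  obtain ⟨⟨x, hx, hx'⟩, y, hy, hy'⟩ := hcon
  have hpre : IsPreconnected ((univ : Set ℝ) ×ˢ Ici (max A 0)) :=
    isPreconnected_univ.prod isPreconnected_Ici
  have hcont : Continuous fun p : ℝ × ℝ => U (planePoint m p.1 p.2) :=
    hu.continuous.comp (by fun_prop)
  have hx2 := (hA x ((le_max_left _ _).trans hx)).resolve_left hx'.not_gt
  have hy2 := (hA y ((le_max_left _ _).trans hy)).resolve_right (by linarith)
  rw [eq_planePoint haxi] at hx2 hy2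
  obtain ⟨p, hp, hpe⟩ := hpre.intermediate_value (a := (y 0, primeNorm y))
    (b := (x 0, primeNorm x)) ⟨mem_univ _, hy⟩ ⟨mem_univ _, hx⟩ hcont.continuousOn
    (show (1 / 2 : ℝ) ∈ Icc _ _ from ⟨by dsimp only; linarith, by dsimp only; linarith⟩)
  have hp2 : max A 0 ≤ p.2 := hp.2
  have hn := primeNorm_planePoint (m := m) p.1 ((le_max_right A 0).trans hp2)
  rcases hA (planePoint m p.1 p.2) (by rw [hn]; exact (le_max_left _ _).trans hp2) with h | h
  · dsimp only at hpe
    linarith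
  · dsimp only at hpe
    linarith

end

/-- claim (3.8) in the proof of Proposition 1.6: a stable axisymmetric
solution `0 ≤ U ≤ 1` of `ΔU + f(U) = 0` in `ℝ^N` converges, as `|x'| → +∞` and uniformly in
`x₁`, either to `0` or to `1`. -/
theorem statement17 (d : ℕ) (hd : 1 ≤ d) (f : ℝ → ℝ) (θ : ℝ) (hf : Bistable f θ)
    (U : Euc d → ℝ) (hU : ContDiff ℝ 2 U)
    (hrange : ∀ x : Euc d, U x ∈ Icc (0 : ℝ) 1)
    (hpde : ∀ x : Euc d, lapW Set.univ U x + f (U x) = 0)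
    (hstable : StableOn Set.univ f U)
    (haxi : ∀ x y : Euc d, x 0 = y 0 → primeNorm x = primeNorm y → U x = U y) :
    (∀ ε > (0 : ℝ), ∃ A : ℝ, ∀ x : Euc d, A ≤ primeNorm x → |U x| ≤ ε) ∨
    (∀ ε > (0 : ℝ), ∃ A : ℝ, ∀ x : Euc d, A ≤ primeNorm x → |U x - 1| ≤ ε) := by
  obtain ⟨m, rfl⟩ : ∃ m, d = m + 1 := ⟨d - 1, by omega⟩
  obtain ⟨C, hu⟩ := StableSol.of_contDiff hf hU hrange hpde hstable
  obtain ⟨A₀, hA₀⟩ := hu.exists_radius_forall hf haxi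
  refine hA₀.imp (fun h0 ε hε => ?_) (fun h1 ε hε => ?_)
  · obtain ⟨A, hA⟩ := hu.exists_radius hf haxi (lt_min hε (by norm_num : (0 : ℝ) < 1 / 4))
    refine ⟨max A A₀, fun x hx => ?_⟩
    have hlt := h0 x ((le_max_right _ _).trans hx)
    have hor := hA x ((le_max_left _ _).trans hx)
    rw [abs_of_nonneg (hrange x).1]
    rcases hor with h | h
    · linarith [min_le_left ε (1 / 4)]
    · linarith [min_le_right ε (1 / 4)]
  · obtain ⟨A, hA⟩ := hu.exists_radius hf haxi (lt_min hε (by norm_num : (0 : ℝ) < 1 / 4))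
    refine ⟨max A A₀, fun x hx => ?_⟩
    have hlt := h1 x ((le_max_right _ _).trans hx)
    have hor := hA x ((le_max_left _ _).trans hx)
    rw [abs_sub_comm, abs_of_nonneg (sub_nonneg.2 (hrange x).2)]
    rcases hor with h | h
    · linarith [min_le_right ε (1 / 4)]
    · linarith [min_le_left ε (1 / 4)]
end
end

section
/- Let U be a C²(ℝ^N) solution of ΔU + f(U) = 0 in ℝ^N with 0 ≤ U ≤ 1, and assume U(x₁,x') → 0 as |x'| → +∞ uniformly in x₁ ∈ ℝ (where x = (x₁,x') ∈ ℝ × ℝ^{N−1}). Then there exist constants B > 0 and γ > 0 such that |∇U(x)| ≤ B e^{−γ|x'|} for all x ∈ ℝ^N. -/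
open Set Filter Topology MeasureTheory

noncomputable section

/-- The second derivative of `U` at `x` in the `j`-th coordinate direction. -/
def secondPartial {d : ℕ} (U : Euc d → ℝ) (j : Fin (d + 1)) (x : Euc d) : ℝ :=
  fderiv ℝ (fun y => fderiv ℝ U y (EuclideanSpace.single j 1)) x (EuclideanSpace.single j 1)

lemma lapW_univ {d : ℕ} (U : Euc d → ℝ) (x : Euc d) :
    lapW Set.univ U x = ∑ j, secondPartial U j x := by
  simp [lapW, secondPartial, fderivWithin_univ]

lemma secondPartial_neg {d : ℕ} (U : Euc d → ℝ) (j : Fin (d + 1)) (x : Euc d) :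
    secondPartial (fun y => -U y) j x = -secondPartial U j x := by
  simp [secondPartial, fderiv_fun_neg]

/-- Second-order necessary condition for a local maximum on the line. -/
lemma second_deriv_nonpos_of_isLocalMax_s18 {G G' : ℝ → ℝ} {c : ℝ}
    (hG : ∀ t, HasDerivAt G (G' t) t) (hG' : HasDerivAt G' c 0) (hmax : IsLocalMax G 0) :
    c ≤ 0 := by
  by_contra! hc
  have hd : deriv G = G' := funext fun t => (hG t).deriv
  have hmin : IsLocalMin G 0 := by
    apply isLocalMin_of_deriv_deriv_pos
    · rw [hd, hG'.deriv]; exact hc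
    · exact hmax.deriv_eq_zero
    · exact (hG 0).continuousAt
  have hconst : G =ᶠ[𝓝 0] fun _ => G 0 := by
    filter_upwards [hmax, hmin] with t h1 h2 using le_antisymm h1 h2
  have h0 : G' =ᶠ[𝓝 0] fun _ => 0 := by
    have := hconst.deriv
    rw [hd] at this
    simpa using this
  have := h0.deriv_eq
  rw [hG'.deriv] at this
  simp at this
  linarith

lemma hasDerivAt_slice {d : ℕ} {U : Euc d → ℝ} (hU : ContDiff ℝ 2 U) (p : Euc d)
    (j : Fin (d + 1)) (s t : ℝ) :
    HasDerivAt (fun t => U (p + (s * t) • EuclideanSpace.single j (1 : ℝ)))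
      (s * fderiv ℝ U (p + (s * t) • EuclideanSpace.single j (1 : ℝ))
        (EuclideanSpace.single j 1)) t := by
  have hline : HasDerivAt (fun t : ℝ => p + (s * t) • EuclideanSpace.single j (1 : ℝ))
      (s • EuclideanSpace.single j (1 : ℝ)) t := by
    have h := (((hasDerivAt_id t).const_mul s).smul_const
      (EuclideanSpace.single j (1 : ℝ))).const_add p
    simpa using h
  have hd := (hU.differentiable (by norm_num)
    (p + (s * t) • EuclideanSpace.single j (1 : ℝ))).hasFDerivAt
  refine (hd.comp_hasDerivAt t hline).congr_deriv ?_
  simp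

lemma hasDerivAt_slice_deriv {d : ℕ} {U : Euc d → ℝ} (hU : ContDiff ℝ 2 U) (p : Euc d)
    (j : Fin (d + 1)) (s : ℝ) :
    HasDerivAt (fun t => s * fderiv ℝ U (p + (s * t) • EuclideanSpace.single j (1 : ℝ))
        (EuclideanSpace.single j 1)) (s ^ 2 * secondPartial U j p) 0 := by
  have hline : HasDerivAt (fun t : ℝ => p + (s * t) • EuclideanSpace.single j (1 : ℝ))
      (s • EuclideanSpace.single j (1 : ℝ)) 0 := by
    have h := (((hasDerivAt_id (0 : ℝ)).const_mul s).smul_const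
      (EuclideanSpace.single j (1 : ℝ))).const_add p
    simpa using h
  have hC : ContDiff ℝ 1 (fun y => fderiv ℝ U y (EuclideanSpace.single j (1 : ℝ))) :=
    (hU.fderiv_right (m := 1) (by norm_num)).clm_apply contDiff_const
  have hd := (hC.differentiable (by norm_num)
    (p + (s * 0) • EuclideanSpace.single j (1 : ℝ))).hasFDerivAt
  have h := (hd.comp_hasDerivAt (0 : ℝ) hline).const_mul s
  have he : s * (fderiv ℝ (fun y => fderiv ℝ U y (EuclideanSpace.single j (1 : ℝ)))
      (p + (s * 0) • EuclideanSpace.single j (1 : ℝ))) (s • EuclideanSpace.single j (1 : ℝ))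
      = s ^ 2 * secondPartial U j p := by
    simp [secondPartial]; ring
  rw [he] at h
  exact h

/-- Comparison of second derivatives along a coordinate line, at a local maximum of the
difference of two translates (one possibly reflected) minus a quadratic polynomial. -/
lemma secondPartial_le_of_isLocalMax {d : ℕ} {U : Euc d → ℝ} (hU : ContDiff ℝ 2 U)
    (p q : Euc d) (j : Fin (d + 1)) (r s P₀ P₁ P₂ : ℝ)
    (hmax : IsLocalMax (fun t : ℝ => U (p + t • EuclideanSpace.single j (1 : ℝ))
      - r * U (q + (s * t) • EuclideanSpace.single j (1 : ℝ)) - (P₀ + P₁ * t + P₂ * t ^ 2)) 0) :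
    secondPartial U j p - r * (s ^ 2 * secondPartial U j q) ≤ 2 * P₂ := by
  have h1 := hasDerivAt_slice hU p j 1
  have h1' := hasDerivAt_slice_deriv hU p j 1
  simp only [one_mul, one_pow] at h1 h1'
  have h2 := hasDerivAt_slice hU q j s
  have h2' := hasDerivAt_slice_deriv hU q j s
  have h3 : ∀ t : ℝ, HasDerivAt (fun t : ℝ => P₀ + P₁ * t + P₂ * t ^ 2)
      (P₁ + 2 * P₂ * t) t := by
    intro t
    have h := (((hasDerivAt_id t).const_mul P₁).const_add P₀).add
      (((hasDerivAt_id t).pow 2).const_mul P₂)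
    refine h.congr_deriv ?_
    simp; ring
  have h3' : HasDerivAt (fun t : ℝ => P₁ + 2 * P₂ * t) (2 * P₂) 0 := by
    simpa using ((hasDerivAt_id (0 : ℝ)).const_mul (2 * P₂)).const_add P₁
  have := second_deriv_nonpos_of_isLocalMax_s18
    (fun t => ((h1 t).sub ((h2 t).const_mul r)).sub (h3 t))
    ((h1'.sub (h2'.const_mul r)).sub h3') hmax
  linarith

lemma norm_add_smul_single_sq {d : ℕ} (z : Euc d) (j : Fin (d + 1)) (t : ℝ) :
    ‖z + t • EuclideanSpace.single j (1 : ℝ)‖ ^ 2 = ‖z‖ ^ 2 + 2 * z j * t + t ^ 2 := by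
  rw [norm_add_sq_real, inner_smul_right, EuclideanSpace.inner_single_right, norm_smul]
  simp
  ring

lemma primeNorm_eq_norm {d : ℕ} (x : Euc d) :
    primeNorm x = ‖x - x 0 • EuclideanSpace.single 0 (1 : ℝ)‖ := by
  rw [primeNorm, EuclideanSpace.norm_eq]
  congr 1
  refine Finset.sum_congr rfl fun i _ => ?_
  by_cases h : i = 0 <;> simp [h]

lemma primeNorm_le_norm {d : ℕ} (x : Euc d) : primeNorm x ≤ ‖x‖ := by
  rw [primeNorm, EuclideanSpace.norm_eq]
  apply Real.sqrt_le_sqrt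
  refine Finset.sum_le_sum fun i _ => ?_
  split_ifs <;> simp [sq_nonneg]

lemma primeNorm_sub_norm_le {d : ℕ} (x z : Euc d) : primeNorm x - ‖z‖ ≤ primeNorm (x + z) := by
  have h : primeNorm x ≤ primeNorm (x + z) + primeNorm z := by
    simp only [primeNorm_eq_norm]
    refine le_of_eq_of_le ?_ (norm_sub_le _ _)
    congr 1
    simp only [PiLp.add_apply, add_smul]
    abel
  linarith [primeNorm_le_norm z]

/-- One step of the decay argument: a subsolution of `ΔU = mU` on a unit ball is smaller at the
centre, by a fixed factor, than its upper bound. -/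
lemma le_mul_of_subsolution {d : ℕ} {U : Euc d → ℝ} (hU : ContDiff ℝ 2 U) {m M η : ℝ}
    (hm : 0 < m) (hM : 0 ≤ M) (hη₀ : 0 ≤ η) (hη : 2 * (d + 1) * η ≤ m * (1 - η)) (x₀ : Euc d)
    (hle : ∀ z : Euc d, ‖z‖ ≤ 1 → U (x₀ + z) ≤ M)
    (hsub : ∀ z : Euc d, ‖z‖ ≤ 1 → m * U (x₀ + z) ≤ ∑ j, secondPartial U j (x₀ + z)) :
    U x₀ ≤ M * (1 - η) := by
  by_contra! hlt
  have hcont : Continuous fun z : Euc d => U (x₀ + z) - M * η * ‖z‖ ^ 2 := by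
    have := hU.continuous
    fun_prop
  obtain ⟨z, hz, hzmax⟩ := (isCompact_closedBall (0 : Euc d) 1).exists_isMaxOn
    ⟨0, by simp⟩ hcont.continuousOn
  have hz0 : U x₀ ≤ U (x₀ + z) - M * η * ‖z‖ ^ 2 := by
    have := hzmax (show (0 : Euc d) ∈ Metric.closedBall 0 1 by simp)
    simpa using this
  have hz1 : ‖z‖ ≤ 1 := by simpa using hz
  rcases hz1.eq_or_lt with h1 | h1
  · rw [h1] at hz0
    linarith [hle z hz1]
  · have hloc : IsLocalMax (fun z : Euc d => U (x₀ + z) - M * η * ‖z‖ ^ 2) z :=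
      hzmax.isLocalMax (Metric.closedBall_mem_nhds_of_mem (by simpa using h1))
    have hj : ∀ j, secondPartial U j (x₀ + z) ≤ 2 * (M * η) := by
      intro j
      have hl : Continuous fun t : ℝ => z + t • EuclideanSpace.single j (1 : ℝ) := by fun_prop
      have hloc' := IsLocalMax.comp_continuous (b := (0 : ℝ))
        (g := fun t : ℝ => z + t • EuclideanSpace.single j (1 : ℝ))
        (f := fun z : Euc d => U (x₀ + z) - M * η * ‖z‖ ^ 2) (by simpa using hloc) hl.continuousAt
      have := secondPartial_le_of_isLocalMax hU (x₀ + z) 0 j 0 0 (M * η * ‖z‖ ^ 2)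
        (M * η * (2 * z j)) (M * η) (by
          convert hloc' using 2 with t
          simp only [Function.comp, norm_add_smul_single_sq, add_assoc]
          ring)
      simpa using this
    have hsum : ∑ j, secondPartial U j (x₀ + z) ≤ (d + 1) * (2 * (M * η)) := by
      refine (Finset.sum_le_sum fun j _ => hj j).trans ?_
      simp
    have h2 := hsub z hz1
    have h3 : M * (2 * (d + 1) * η) ≤ M * (m * (1 - η)) := mul_le_mul_of_nonneg_left hη hM
    have h4 : M * (1 - η) < U (x₀ + z) := by
      nlinarith [mul_nonneg (mul_nonneg hM hη₀) (sq_nonneg ‖z‖)]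
    nlinarith

/-- Interior gradient bound: comparison with a quadratic barrier on a half cube. -/
lemma partial_le_of_bounds {d : ℕ} {U : Euc d → ℝ} (hU : ContDiff ℝ 2 U) {M K : ℝ}
    (hM : 0 ≤ M) (hK : 0 < K) (x₀ : Euc d) (i : Fin (d + 1))
    (hle : ∀ z : Euc d, (∀ j, |z j| ≤ 1) → |U (x₀ + z)| ≤ M)
    (hlap : ∀ z : Euc d, (∀ j, |z j| ≤ 1) → |∑ j, secondPartial U j (x₀ + z)| ≤ K) :
    fderiv ℝ U x₀ (EuclideanSpace.single i 1) ≤ (d + 1) * M + K := by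
  set e : Fin (d + 1) → Euc d := fun j => EuclideanSpace.single j (1 : ℝ) with he
  set c : ℝ := 2 * M * (d + 1) + 2 * K with hc
  set S : Euc d → Euc d := fun z => z - (2 * z i) • e i with hS
  set w : Euc d → ℝ := fun z =>
    U (x₀ + z) - U (x₀ + S z) - (2 * M * ‖z‖ ^ 2 + c * z i - c * z i ^ 2) with hw
  set Q : Set (Euc d) := {z | (∀ j, |z j| ≤ 1) ∧ 0 ≤ z i} with hQ
  have hc0 : 0 ≤ c := by positivity
  have hSi : ∀ z, (S z) i = - z i := by
    intro z; simp [hS, he]; ring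
  have hSj : ∀ z j, j ≠ i → (S z) j = z j := by
    intro z j hj; simp [hS, he, hj]
  have hSabs : ∀ z j, |(S z) j| = |z j| := by
    intro z j
    by_cases h : j = i
    · subst h; rw [hSi, abs_neg]
    · rw [hSj z j h]
  have hQclosed : IsClosed Q := by
    have : Q = (⋂ j, {z : Euc d | |z j| ≤ 1}) ∩ {z | 0 ≤ z i} := by
      ext z; simp [hQ]
    rw [this]
    refine (isClosed_iInter fun j => isClosed_le (by fun_prop) (by fun_prop)).inter
      (isClosed_le (by fun_prop) (by fun_prop))
  have hsq : ∀ z : Euc d, ‖z‖ ^ 2 = ∑ j, z j ^ 2 := by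
    intro z; rw [EuclideanSpace.norm_sq_eq]; simp
  have hQb : Q ⊆ Metric.closedBall 0 (d + 1) := by
    intro z hz
    have h1 : ‖z‖ ^ 2 ≤ d + 1 := by
      rw [hsq]
      refine (Finset.sum_le_sum fun j _ => (sq_le_one_iff_abs_le_one _).2 (hz.1 j)).trans ?_
      simp
    have : (0 : ℝ) ≤ d := by positivity
    simp only [Metric.mem_closedBall, dist_zero_right]
    nlinarith [norm_nonneg z]
  have hQc : IsCompact Q := (isCompact_closedBall _ _).of_isClosed_subset hQclosed hQb
  have hwc : Continuous w := by
    have := hU.continuous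
    simp only [hw, hS]
    fun_prop
  obtain ⟨z, hz, hzmax⟩ := hQc.exists_isMaxOn ⟨0, by simp [hQ]⟩ hwc.continuousOn
  have hdiff : ∀ z ∈ Q, U (x₀ + z) - U (x₀ + S z) ≤ 2 * M := by
    intro z hz
    have h1 := abs_le.1 (hle z hz.1)
    have h2 := abs_le.1 (hle (S z) fun j => by rw [hSabs]; exact hz.1 j)
    linarith
  have hwz : w z ≤ 0 := by
    by_contra! hpos
    have hzi1 : z i ≤ 1 := (abs_le.1 (hz.1 i)).2
    have hinner : ∀ j, |z j| < 1 := by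
      intro j
      refine (hz.1 j).lt_of_ne fun h => ?_
      have hn : 1 ≤ ‖z‖ ^ 2 := by
        rw [hsq]
        have h2 : z j ^ 2 = 1 := by rw [← sq_abs, h]; norm_num
        rw [← h2]
        exact Finset.single_le_sum (f := fun j => z j ^ 2) (fun _ _ => sq_nonneg _)
          (Finset.mem_univ j)
      have h3 := hdiff z hz
      have h4 : 0 ≤ c * (z i * (1 - z i)) :=
        mul_nonneg hc0 (mul_nonneg hz.2 (by linarith))
      simp only [hw] at hpos
      nlinarith
    have hzi0 : 0 < z i := by
      refine hz.2.lt_of_ne fun h => ?_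
      have : S z = z := by simp [hS, ← h]
      simp only [hw, this, ← h] at hpos
      nlinarith [sq_nonneg ‖z‖]
    have hQn : Q ∈ 𝓝 z := by
      have h1 : ∀ᶠ y : Euc d in 𝓝 z, ∀ j, |y j| < 1 := by
        rw [eventually_all]
        intro j
        exact (show Continuous fun y : Euc d => |y j| by fun_prop).continuousAt.eventually_lt
          continuousAt_const (hinner j)
      have h2 : ∀ᶠ y : Euc d in 𝓝 z, 0 < y i :=
        continuousAt_const.eventually_lt
          (show Continuous fun y : Euc d => y i by fun_prop).continuousAt hzi0
      filter_upwards [h1, h2] with y hy1 hy2 using ⟨fun j => (hy1 j).le, hy2.le⟩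
    have hloc : IsLocalMax w z := hzmax.isLocalMax hQn
    have hj : ∀ j, secondPartial U j (x₀ + z) - secondPartial U j (x₀ + S z)
        ≤ 2 * (2 * M - if j = i then c else 0) := by
      intro j
      have hl : Continuous fun t : ℝ => z + t • e j := by fun_prop
      have hloc' := IsLocalMax.comp_continuous (b := (0 : ℝ)) (g := fun t : ℝ => z + t • e j)
        (f := w) (by simpa using hloc) hl.continuousAt
      by_cases hji : j = i
      · subst hji
        have := secondPartial_le_of_isLocalMax hU (x₀ + z) (x₀ + S z) j 1 (-1)
          (2 * M * ‖z‖ ^ 2 + c * z j - c * z j ^ 2)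
          (2 * M * (2 * z j) + c - 2 * c * z j) (2 * M - c) (by
            convert hloc' using 2 with t
            have h1 : S (z + t • e j) = S z + (-1 * t) • e j := by
              simp only [hS, he]
              ext k
              by_cases hk : k = j
              · subst hk; simp; ring
              · simp [hk]
            have h2 : (z + t • e j) j = z j + t := by simp [he]
            have h3 : ‖z + t • e j‖ ^ 2 = _ := norm_add_smul_single_sq z j t
            simp only [Function.comp, hw, h1, h2, h3, add_assoc]
            simp only [he]
            ring)
        simpa using this
      · have := secondPartial_le_of_isLocalMax hU (x₀ + z) (x₀ + S z) j 1 1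
          (2 * M * ‖z‖ ^ 2 + c * z i - c * z i ^ 2)
          (2 * M * (2 * z j)) (2 * M) (by
            convert hloc' using 2 with t
            have h2 : (z + t • e j) i = z i := by simp [he, Ne.symm hji]
            have h1 : S (z + t • e j) = S z + (1 * t) • e j := by
              simp only [hS, h2, one_mul]
              abel
            have h3 : ‖z + t • e j‖ ^ 2 = _ := norm_add_smul_single_sq z j t
            simp only [Function.comp, hw, h1, h2, h3, add_assoc]
            simp only [he]
            ring)
        simpa [hji] using this
    have hsum := Finset.sum_le_sum fun j (_ : j ∈ Finset.univ) => hj j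
    rw [Finset.sum_sub_distrib, ← Finset.mul_sum, Finset.sum_sub_distrib] at hsum
    simp only [Finset.sum_const, Finset.card_univ, Fintype.card_fin, nsmul_eq_mul,
      Finset.sum_ite_eq', Finset.mem_univ, if_true] at hsum
    push_cast at hsum
    have h1 := abs_le.1 (hlap z hz.1)
    have h2 := abs_le.1 (hlap (S z) fun j => by rw [hSabs]; exact hz.1 j)
    nlinarith
  have hd1 := hasDerivAt_slice hU x₀ i 1 0
  have hd2 := hasDerivAt_slice hU x₀ i (-1) 0
  have hd3 : HasDerivAt (fun t : ℝ => 2 * M * t ^ 2 + c * t - c * t ^ 2) c 0 := by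
    have h := ((((hasDerivAt_id (0 : ℝ)).pow 2).const_mul (2 * M)).add
      ((hasDerivAt_id (0 : ℝ)).const_mul c)).sub (((hasDerivAt_id (0 : ℝ)).pow 2).const_mul c)
    refine h.congr_deriv ?_
    simp
  have hd := (hd1.sub hd2).sub hd3
  have hle0 := hd.tendsto_slope_zero_right
  have hev : ∀ᶠ t : ℝ in 𝓝[>] 0, t ∈ Ioo (0 : ℝ) 1 := Ioo_mem_nhdsGT one_pos
  have hfin := le_of_tendsto hle0 (b := 0) (by
    filter_upwards [hev] with t ht
    have hmem : t • e i ∈ Q := by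
      refine ⟨fun j => ?_, by simp [he, ht.1.le]⟩
      by_cases h : j = i
      · subst h; simp [he, abs_of_pos ht.1, ht.2.le]
      · simp [he, h]
    have h1 : w (t • e i) ≤ 0 := (hzmax hmem).trans hwz
    have h2 : S (t • e i) = (-1 * t) • e i := by
      simp only [hS, he]
      rw [← sub_smul]
      congr 1
      simp; ring
    have h3 : ‖t • e i‖ ^ 2 = t ^ 2 := by
      rw [norm_smul]; simp [he]
    have h4 : (t • e i) i = t := by simp [he]
    simp only [hw, h2, h3, h4] at h1
    rw [smul_eq_mul]
    refine mul_nonpos_of_nonneg_of_nonpos (by simpa using ht.1.le) ?_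
    simp [he] at h1 ⊢
    linarith)
  simp at hfin
  linarith

/-- A two-sided version of `partial_le_of_bounds`. -/
lemma abs_partial_le_of_bounds {d : ℕ} {U : Euc d → ℝ} (hU : ContDiff ℝ 2 U) {M K : ℝ}
    (hM : 0 ≤ M) (hK : 0 < K) (x₀ : Euc d) (i : Fin (d + 1))
    (hle : ∀ z : Euc d, (∀ j, |z j| ≤ 1) → |U (x₀ + z)| ≤ M)
    (hlap : ∀ z : Euc d, (∀ j, |z j| ≤ 1) → |∑ j, secondPartial U j (x₀ + z)| ≤ K) :
    |fderiv ℝ U x₀ (EuclideanSpace.single i 1)| ≤ (d + 1) * M + K := by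
  rw [abs_le']
  refine ⟨partial_le_of_bounds hU hM hK x₀ i hle hlap, ?_⟩
  have h := partial_le_of_bounds hU.neg hM hK x₀ i (by simpa using hle)
    (by simpa [secondPartial_neg] using hlap)
  simpa [fderiv_fun_neg] using h

lemma norm_gradient_le_sum {d : ℕ} (U : Euc d → ℝ) (x : Euc d) :
    ‖gradient U x‖ ≤ ∑ i, |fderiv ℝ U x (EuclideanSpace.single i 1)| := by
  have hcoord : ∀ i, (gradient U x) i = fderiv ℝ U x (EuclideanSpace.single i 1) := by
    intro i
    have h : inner ℝ (gradient U x) (EuclideanSpace.single i (1 : ℝ))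
        = fderiv ℝ U x (EuclideanSpace.single i 1) := by
      simp [gradient]
    rw [← h, EuclideanSpace.inner_single_right]
    simp
  simp only [← hcoord]
  rw [EuclideanSpace.norm_eq]
  refine Real.sqrt_le_iff.2 ⟨Finset.sum_nonneg fun _ _ => abs_nonneg _, ?_⟩
  simpa using Finset.sum_sq_le_sq_sum_of_nonneg (s := Finset.univ)
    (f := fun i => |(gradient U x) i|) fun _ _ => abs_nonneg _

lemma Bistable.exists_le_neg_mul {f : ℝ → ℝ} {θ : ℝ} (hf : Bistable f θ) :
    ∃ m > 0, ∃ δ > 0, ∀ s ∈ Icc (0 : ℝ) δ, f s ≤ -m * s := by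
  refine ⟨-deriv f 0 / 2, by linarith [hf.df0], ?_⟩
  have hd : HasDerivAt f (deriv f 0) 0 :=
    (hf.smooth.differentiable (by norm_num) 0).hasDerivAt
  have hev := hd.tendsto_slope_zero_right.eventually_lt_const
    (show deriv f 0 < deriv f 0 / 2 by linarith [hf.df0])
  obtain ⟨δ, hδ, h⟩ := (mem_nhdsGT_iff_exists_Ioc_subset).1 hev
  refine ⟨δ, hδ, fun s hs => ?_⟩
  rcases hs.1.eq_or_lt with h0 | h0
  · simp [← h0, hf.f0]
  · have h1 := h ⟨h0, hs.2⟩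
    simp only [mem_ofPred_eq, zero_add, hf.f0, sub_zero, smul_eq_mul] at h1
    rw [inv_mul_lt_iff₀ h0] at h1
    linarith

lemma Bistable.exists_abs_le_mul {f : ℝ → ℝ} {θ : ℝ} (hf : Bistable f θ) :
    ∃ L > 0, ∀ s ∈ Icc (0 : ℝ) 1, |f s| ≤ L * s := by
  obtain ⟨K, hK⟩ := (hf.smooth.contDiffOn (s := Icc (0 : ℝ) 1)).exists_lipschitzOnWith
    (by norm_num) (convex_Icc 0 1) isCompact_Icc
  refine ⟨K + 1, by positivity, fun s hs => ?_⟩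
  have h := hK.dist_le_mul s hs 0 ⟨le_rfl, zero_le_one⟩
  rw [Real.dist_eq, Real.dist_eq, hf.f0, sub_zero, sub_zero, abs_of_nonneg hs.1] at h
  linarith [hs.1]

/-- Exponential decay of `U` in `|x'|`. -/
lemma exists_exp_bound {d : ℕ} {f : ℝ → ℝ} {θ : ℝ} (hf : Bistable f θ)
    {U : Euc d → ℝ} (hU : ContDiff ℝ 2 U) (hrange : ∀ x : Euc d, U x ∈ Icc (0 : ℝ) 1)
    (hpde : ∀ x : Euc d, lapW Set.univ U x + f (U x) = 0)
    (hlim : ∀ ε > (0 : ℝ), ∃ A : ℝ, ∀ x : Euc d, A ≤ primeNorm x → |U x| ≤ ε) :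
    ∃ C > 0, ∃ γ > 0, ∀ x, U x ≤ C * Real.exp (-γ * primeNorm x) := by
  obtain ⟨m, hm, δ, hδ, hfm⟩ := hf.exists_le_neg_mul
  obtain ⟨A, hA⟩ := hlim δ hδ
  have hdpos : (0 : ℝ) < 2 * (d + 1) := by positivity
  set η : ℝ := m / (m + 2 * (d + 1)) with hη
  have hη0 : 0 < η := by positivity
  have hη1 : η < 1 := by rw [hη, div_lt_one (by positivity)]; linarith
  have hηm : 2 * (d + 1) * η ≤ m * (1 - η) := by
    apply le_of_eq
    rw [hη]; field_simp; ring
  have hiter : ∀ k : ℕ, ∀ x : Euc d, A + k ≤ primeNorm x → U x ≤ (1 - η) ^ k := by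
    intro k
    induction k with
    | zero => intro x _; simpa using (hrange x).2
    | succ k ih =>
      intro x hx
      rw [pow_succ]
      push_cast at hx
      have hball : ∀ z : Euc d, ‖z‖ ≤ 1 → A + k ≤ primeNorm (x + z) := fun z hz => by
        linarith [primeNorm_sub_norm_le x z]
      refine le_mul_of_subsolution hU hm (pow_nonneg (by linarith) k) hη0.le hηm x
        (fun z hz => ih _ (hball z hz)) fun z hz => ?_
      have h1 := hpde (x + z)
      rw [lapW_univ] at h1
      have hk : (0 : ℝ) ≤ k := by positivity
      have h2 := hA (x + z) (by linarith [hball z hz])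
      have h3 := hfm (U (x + z)) ⟨(hrange _).1, (le_abs_self _).trans h2⟩
      linarith
  have hγ : 0 < -Real.log (1 - η) := by
    linarith [Real.log_neg (show 0 < 1 - η by linarith) (by linarith)]
  refine ⟨Real.exp (-Real.log (1 - η) * (A + 1)), Real.exp_pos _, -Real.log (1 - η), hγ,
    fun x => ?_⟩
  set k := ⌊primeNorm x - A⌋₊ with hk
  have hUk : U x ≤ (1 - η) ^ k := by
    rcases le_or_gt 0 (primeNorm x - A) with h | h
    · exact hiter k x (by linarith [Nat.floor_le h])
    · rw [hk, Nat.floor_of_nonpos h.le, pow_zero]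
      exact (hrange x).2
  have hlt : primeNorm x - A < k + 1 := Nat.lt_floor_add_one _
  refine hUk.trans ?_
  rw [← Real.exp_add, ← Real.exp_log (show 0 < 1 - η by linarith), ← Real.exp_nat_mul,
    Real.exp_le_exp, Real.exp_log (by linarith)]
  nlinarith

/-- estimate (3.11) in the proof of Proposition 1.6: if a solution
`0 ≤ U ≤ 1` of `ΔU + f(U) = 0` in `ℝ^N` tends to `0` as `|x'| → +∞` uniformly in `x₁`, then
its gradient decays exponentially in `|x'|`. -/
theorem statement18 (d : ℕ) (hd : 1 ≤ d) (f : ℝ → ℝ) (θ : ℝ) (hf : Bistable f θ)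
    (U : Euc d → ℝ) (hU : ContDiff ℝ 2 U)
    (hrange : ∀ x : Euc d, U x ∈ Icc (0 : ℝ) 1)
    (hpde : ∀ x : Euc d, lapW Set.univ U x + f (U x) = 0)
    (hlim : ∀ ε > (0 : ℝ), ∃ A : ℝ, ∀ x : Euc d, A ≤ primeNorm x → |U x| ≤ ε) :
    ∃ B > (0 : ℝ), ∃ γ > (0 : ℝ), ∀ x : Euc d,
      ‖gradient U x‖ ≤ B * Real.exp (-γ * primeNorm x) := by
  obtain ⟨C, hC, γ, hγ, hdecay⟩ := exists_exp_bound hf hU hrange hpde hlim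
  obtain ⟨L, hL, hfL⟩ := hf.exists_abs_le_mul
  set C' : ℝ := C * Real.exp (γ * (d + 1)) with hC'
  have hC'pos : 0 < C' := by positivity
  refine ⟨(d + 1) * ((d + 1) * C' + L * C'), by positivity, γ, hγ, fun x => ?_⟩
  set E : ℝ := Real.exp (-γ * primeNorm x) with hE
  have hEpos : 0 < E := Real.exp_pos _
  have hnear : ∀ z : Euc d, (∀ j, |z j| ≤ 1) → U (x + z) ≤ C' * E := by
    intro z hz
    have hzn : ‖z‖ ≤ d + 1 := by
      have h1 : ‖z‖ ^ 2 ≤ d + 1 := by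
        rw [EuclideanSpace.norm_sq_eq]
        refine (Finset.sum_le_sum fun j _ =>
          show ‖z j‖ ^ 2 ≤ 1 from pow_le_one₀ (norm_nonneg _) (hz j)).trans ?_
        simp
      have : (0 : ℝ) ≤ d := by positivity
      nlinarith [norm_nonneg z]
    refine (hdecay _).trans ?_
    rw [hC', hE, mul_assoc, ← Real.exp_add]
    refine mul_le_mul_of_nonneg_left (Real.exp_le_exp.2 ?_) hC.le
    nlinarith [primeNorm_sub_norm_le x z]
  have hpart : ∀ i, |fderiv ℝ U x (EuclideanSpace.single i 1)|
      ≤ (d + 1) * (C' * E) + L * (C' * E) := fun i =>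
    abs_partial_le_of_bounds hU (by positivity) (by positivity) x i
      (fun z hz => by rw [abs_of_nonneg (hrange _).1]; exact hnear z hz)
      fun z hz => by
        have h1 := hpde (x + z)
        rw [lapW_univ] at h1
        rw [eq_neg_of_add_eq_zero_left h1, abs_neg]
        exact (hfL _ (hrange _)).trans (mul_le_mul_of_nonneg_left (hnear z hz) hL.le)
  refine (norm_gradient_le_sum U x).trans ((Finset.sum_le_sum fun i _ => hpart i).trans ?_)
  simp only [Finset.sum_const, Finset.card_univ, Fintype.card_fin, nsmul_eq_mul]
  push_cast
  apply le_of_eq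
  ring

end
end
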